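/- arXiv:2301.07871 — 2 statements merged into one kernel-verified Lean document; each statement's English description precedes it below -/
import Mathlib

section
/- Ensemble-tight second-order asymptotics for mismatched lossy compression with Gaussian codebooks: let X be a real-valued memoryless source with E[X²] = σ², ζ := E[X⁴] < ∞ and E[X⁶] < ∞, and let D ∈ (0,σ²). Then for every ε ∈ (0,1) and each codebook ensemble † ∈ {sp, iid}, log M*_†(n,ε,σ²,D) = (n/2) log(σ²/D) + √(n V(σ²,ζ)) Q^{-1}(ε) + O(log n), where V(σ²,ζ) := (ζ − σ⁴)/(4σ⁴). -/
/-!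
Ensemble-tight second-order asymptotics for mismatched lossy compression of an arbitrary
memoryless source with spherical and i.i.d. Gaussian codebooks
(Zhou–Tan–Motani, Theorem `secondorder4mismatch`).
-/

open scoped BigOperators NNReal
open MeasureTheory ProbabilityTheory

noncomputable section

/-- Ensemble excess-distortion probability of the mismatched minimum-distance code with
`M` codewords drawn i.i.d. from the codeword distribution `ν`:
`P_{e,n}(M) = E_{X^n}[(1 − ν{y : d(X^n,y) ≤ D})^M]`. -/
def PeEnsemble {n : ℕ} (μn : Measure (Fin n → ℝ)) (ν : Measure (Fin n → ℝ))
    (D : ℝ) (M : ℕ) : ℝ :=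
  ∫ x, (1 - (ν {y | (∑ i, (x i - y i) ^ 2) / n ≤ D}).toReal) ^ M ∂μn

/-- Minimum ensemble codebook size with excess-distortion probability at most `ε`. -/
def MstarEns {n : ℕ} (μn : Measure (Fin n → ℝ)) (ν : Measure (Fin n → ℝ))
    (D ε : ℝ) : ℕ :=
  sInf {M : ℕ | 0 < M ∧ PeEnsemble μn ν D M ≤ ε}

/-- The Gaussian complementary cdf. -/
def gaussQ (t : ℝ) : ℝ :=
  ∫ u in Set.Ioi t, Real.exp (-u ^ 2 / 2) / Real.sqrt (2 * Real.pi)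

namespace MSO

lemma gexp_integrable : Integrable (fun w : ℝ => Real.exp (-w ^ 2 / 2)) := by
  have := integrable_exp_neg_mul_sq (b := 1 / 2) (by norm_num)
  refine this.congr (Filter.Eventually.of_forall fun w => ?_)
  simp only; congr 1; ring

lemma gexp_integral : ∫ w : ℝ, Real.exp (-w ^ 2 / 2) = Real.sqrt (2 * Real.pi) := by
  have := integral_gaussian (1 / 2)
  rw [show (2 * Real.pi) = Real.pi / (1 / 2) by ring, ← this]
  congr 1; ext w; congr 1; ring

lemma sqrt_two_pi_le : Real.sqrt (2 * Real.pi) ≤ 3 := by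
  rw [Real.sqrt_le_left (by norm_num)]
  nlinarith [Real.pi_lt_four]

lemma gtail_bound (x : ℝ) (hx : 0 ≤ x) :
    ∫ w in Set.Ioi x, Real.exp (-w ^ 2 / 2) ≤ 3 * Real.exp (-x ^ 2 / 2) := by
  have hi : Integrable (fun w : ℝ => Real.exp (-x ^ 2 / 2) * Real.exp (-(w - x) ^ 2 / 2)) :=
    (gexp_integrable.comp_sub_right x).const_mul _
  calc ∫ w in Set.Ioi x, Real.exp (-w ^ 2 / 2)
      ≤ ∫ w in Set.Ioi x, Real.exp (-x ^ 2 / 2) * Real.exp (-(w - x) ^ 2 / 2) := by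
        refine setIntegral_mono_on gexp_integrable.integrableOn hi.integrableOn
          measurableSet_Ioi fun w hw => ?_
        rw [← Real.exp_add]
        apply Real.exp_le_exp.2
        have : x < w := hw
        nlinarith
    _ ≤ ∫ w, Real.exp (-x ^ 2 / 2) * Real.exp (-(w - x) ^ 2 / 2) :=
        setIntegral_le_integral hi (Filter.Eventually.of_forall fun w => by positivity)
    _ = Real.exp (-x ^ 2 / 2) * Real.sqrt (2 * Real.pi) := by
        rw [integral_const_mul,
          integral_sub_right_eq_self (fun w : ℝ => Real.exp (-w ^ 2 / 2)) x, gexp_integral]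
    _ ≤ _ := by
        have := sqrt_two_pi_le
        nlinarith [Real.exp_pos (-x ^ 2 / 2)]

lemma gtail_bound' (x : ℝ) (hx : 0 ≤ x) :
    x * ∫ w in Set.Ioi x, Real.exp (-w ^ 2 / 2) ≤ Real.exp (-x ^ 2 / 2) := by
  have hi : Integrable (fun w : ℝ => w * Real.exp (-w ^ 2 / 2)) := by
    have := integrable_mul_exp_neg_mul_sq (b := 1 / 2) (by norm_num)
    refine this.congr (Filter.Eventually.of_forall fun w => ?_)
    simp only; congr 2; ring
  have hd : ∀ w : ℝ, HasDerivAt (fun w : ℝ => -Real.exp (-w ^ 2 / 2))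
      (w * Real.exp (-w ^ 2 / 2)) w := by
    intro w
    have h1 : HasDerivAt (fun w : ℝ => -w ^ 2 / 2) (-w) w := by
      refine ((hasDerivAt_pow 2 w).neg.div_const 2).congr_deriv ?_
      simp
      ring
    exact h1.exp.neg.congr_deriv (by ring)
  have ht : Filter.Tendsto (fun w : ℝ => -Real.exp (-w ^ 2 / 2)) Filter.atTop (nhds 0) := by
    rw [← neg_zero]
    refine Filter.Tendsto.neg (Real.tendsto_exp_atBot.comp ?_)
    have : Filter.Tendsto (fun w : ℝ => w ^ 2 / 2) Filter.atTop Filter.atTop :=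
      (Filter.tendsto_pow_atTop (by norm_num)).atTop_div_const (by norm_num)
    refine (Filter.tendsto_neg_atTop_atBot.comp this).congr fun w => ?_
    simp only [Function.comp]; ring
  have h := integral_Ioi_of_hasDerivAt_of_tendsto (a := x)
    (hd x).continuousAt.continuousWithinAt (fun w _ => hd w) hi.integrableOn ht
  rw [← integral_const_mul]
  calc _ ≤ ∫ w in Set.Ioi x, w * Real.exp (-w ^ 2 / 2) := by
        refine setIntegral_mono_on (gexp_integrable.const_mul _).integrableOn hi.integrableOn
          measurableSet_Ioi fun w hw => ?_
        exact mul_le_mul_of_nonneg_right (le_of_lt hw) (Real.exp_pos _).le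
    _ = _ := by rw [h]; ring

lemma gtail_Iic (x : ℝ) : ∫ w in Set.Iic x, Real.exp (-w ^ 2 / 2)
    = ∫ w in Set.Ioi (-x), Real.exp (-w ^ 2 / 2) := by
  rw [← integral_comp_neg_Iic x (fun w => Real.exp (-w ^ 2 / 2))]
  simp

/-- Bounded solution of the Stein equation. -/
lemma stein_solution (g : ℝ → ℝ) (hc : Continuous g) (hb : ∀ x, |g x| ≤ 1)
    (h0 : ∫ w, g w * Real.exp (-w ^ 2 / 2) = 0) :
    ∃ f : ℝ → ℝ, (∀ x, HasDerivAt f (x * f x + g x) x) ∧ (∀ x, |f x| ≤ 3) ∧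
      (∀ x, |x * f x| ≤ 1) := by
  have hgi : Integrable (fun w => g w * Real.exp (-w ^ 2 / 2)) := by
    refine gexp_integrable.mono' (by fun_prop) (Filter.Eventually.of_forall fun w => ?_)
    rw [Real.norm_eq_abs, abs_mul, abs_of_pos (Real.exp_pos _)]
    have := hb w
    nlinarith [Real.exp_pos (-w ^ 2 / 2)]
  set F : ℝ → ℝ := fun x => ∫ w in Set.Iic x, g w * Real.exp (-w ^ 2 / 2) with hF
  have hFd : ∀ x, HasDerivAt F (g x * Real.exp (-x ^ 2 / 2)) x := by
    intro x
    have h1 : F = fun y => F 0 + ∫ w in (0 : ℝ)..y, g w * Real.exp (-w ^ 2 / 2) := by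
      ext y
      rw [← intervalIntegral.integral_Iic_sub_Iic hgi.integrableOn hgi.integrableOn]
      simp only [hF]; ring
    rw [h1]
    have hcont : Continuous (fun w => g w * Real.exp (-w ^ 2 / 2)) := by fun_prop
    exact (hcont.integral_hasStrictDerivAt 0 x).hasDerivAt.const_add _
  have habs : ∀ s : Set ℝ, |∫ w in s, g w * Real.exp (-w ^ 2 / 2)| ≤
      ∫ w in s, Real.exp (-w ^ 2 / 2) := by
    intro s
    rw [← Real.norm_eq_abs]
    refine norm_integral_le_of_norm_le gexp_integrable.integrableOn
      (Filter.Eventually.of_forall fun w => ?_)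
    rw [Real.norm_eq_abs, abs_mul, abs_of_pos (Real.exp_pos _)]
    have := hb w
    nlinarith [Real.exp_pos (-w ^ 2 / 2)]
  have hFneg : ∀ x, F x = - ∫ w in Set.Ioi x, g w * Real.exp (-w ^ 2 / 2) := by
    intro x
    have := integral_add_compl (measurableSet_Iic (a := x)) hgi
    rw [h0, Set.compl_Iic] at this
    simp only [hF]; linarith
  have hFb : ∀ x, |F x| ≤ ∫ w in Set.Ioi |x|, Real.exp (-w ^ 2 / 2) := by
    intro x
    rcases le_total 0 x with hx | hx
    · rw [hFneg, abs_neg, abs_of_nonneg hx]; exact habs _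
    · rw [abs_of_nonpos hx, ← gtail_Iic]; exact habs _
  refine ⟨fun x => Real.exp (x ^ 2 / 2) * F x, fun x => ?_, fun x => ?_, fun x => ?_⟩
  · have h1 : HasDerivAt (fun w : ℝ => w ^ 2 / 2) x x := by
      refine ((hasDerivAt_pow 2 x).div_const 2).congr_deriv ?_
      simp
    refine (h1.exp.mul (hFd x)).congr_deriv ?_
    have : Real.exp (x ^ 2 / 2) * Real.exp (-x ^ 2 / 2) = 1 := by
      rw [← Real.exp_add]; simp [neg_div]
    linear_combination (g x) * this
  · have h := (hFb x).trans (gtail_bound |x| (abs_nonneg x))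
    rw [sq_abs] at h
    have : Real.exp (x ^ 2 / 2) * Real.exp (-x ^ 2 / 2) = 1 := by
      rw [← Real.exp_add]; simp [neg_div]
    rw [abs_mul, abs_of_pos (Real.exp_pos _)]
    calc _ ≤ Real.exp (x ^ 2 / 2) * (3 * Real.exp (-x ^ 2 / 2)) := by gcongr
      _ = 3 := by linear_combination 3 * this
  · have h := (mul_le_mul_of_nonneg_left (hFb x) (abs_nonneg x)).trans
      (gtail_bound' |x| (abs_nonneg x))
    rw [sq_abs] at h
    have : Real.exp (x ^ 2 / 2) * Real.exp (-x ^ 2 / 2) = 1 := by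
      rw [← Real.exp_add]; simp [neg_div]
    rw [abs_mul, abs_mul, abs_of_pos (Real.exp_pos _)]
    calc _ = Real.exp (x ^ 2 / 2) * (|x| * |F x|) := by ring
      _ ≤ Real.exp (x ^ 2 / 2) * (Real.exp (-x ^ 2 / 2)) := by gcongr
      _ = 1 := this

end MSO

namespace MSO

/-- Smoothed half-line indicator. -/
def hsm (z l x : ℝ) : ℝ := max 0 (min 1 ((z + l - x) / l))

lemma hsm_cont (z l : ℝ) : Continuous (hsm z l) := by
  unfold hsm; fun_prop

lemma hsm_nonneg (z l x : ℝ) : 0 ≤ hsm z l x := le_max_left _ _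

lemma hsm_le_one (z l x : ℝ) : hsm z l x ≤ 1 := by
  unfold hsm; simp

lemma hsm_eq_one {z l x : ℝ} (hl : 0 < l) (hx : x ≤ z) : hsm z l x = 1 := by
  unfold hsm
  have : 1 ≤ (z + l - x) / l := by rw [le_div_iff₀ hl]; linarith
  rw [min_eq_left this]; simp

lemma hsm_eq_zero {z l x : ℝ} (hl : 0 < l) (hx : z + l ≤ x) : hsm z l x = 0 := by
  unfold hsm
  have : (z + l - x) / l ≤ 0 := div_nonpos_of_nonpos_of_nonneg (by linarith) hl.le
  rw [max_eq_left]
  exact (min_le_right _ _).trans this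

/-- Modulus of continuity bound. -/
def Gm (z l x τ : ℝ) : ℝ :=
  (3 + 2 * |x|) * τ + min 1 (τ / l) * (Set.Ioc (z - τ) (z + l + τ)).indicator 1 x

lemma hsm_diff {z l x t τ : ℝ} (hl : 0 < l) (ht : |t| ≤ τ) :
    |hsm z l (x + t) - hsm z l x| ≤
      min 1 (τ / l) * (Set.Ioc (z - τ) (z + l + τ)).indicator 1 x := by
  have ht' := abs_le.1 ht
  by_cases hx : x ∈ Set.Ioc (z - τ) (z + l + τ)
  · rw [Set.indicator_of_mem hx, Pi.one_apply, mul_one]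
    refine le_min ?_ ?_
    · have h1 := hsm_nonneg z l x
      have h2 := hsm_nonneg z l (x + t)
      have h3 := hsm_le_one z l x
      have h4 := hsm_le_one z l (x + t)
      rw [abs_le]; constructor <;> linarith
    · unfold hsm
      refine (abs_max_sub_max_le_max _ _ _ _).trans ?_
      refine max_le (by simp; exact div_nonneg ((abs_nonneg _).trans ht) hl.le) ?_
      refine (abs_min_sub_min_le_max _ _ _ _).trans ?_
      refine max_le (by simp; exact div_nonneg ((abs_nonneg _).trans ht) hl.le) ?_
      rw [← sub_div, abs_div, abs_of_pos hl]
      gcongr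
      rw [show z + l - (x + t) - (z + l - x) = -t by ring, abs_neg]; exact ht
  · rw [Set.indicator_of_notMem hx, mul_zero]
    simp only [Set.mem_Ioc, not_and_or, not_lt, not_le] at hx
    rcases hx with hx | hx
    · rw [hsm_eq_one hl (by linarith), hsm_eq_one hl (by linarith [abs_nonneg t])]; simp
    · rw [hsm_eq_zero hl (by linarith), hsm_eq_zero hl (by linarith [abs_nonneg t])]; simp

lemma Gm_mono {z l x τ τb : ℝ} (hl : 0 < l) (h0 : 0 ≤ τ) (h : τ ≤ τb) :
    Gm z l x τ ≤ Gm z l x τb := by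
  unfold Gm
  have h1 : (Set.Ioc (z - τ) (z + l + τ)).indicator (1 : ℝ → ℝ) x ≤
      (Set.Ioc (z - τb) (z + l + τb)).indicator 1 x := by
    apply Set.indicator_le_indicator_of_subset
    · exact Set.Ioc_subset_Ioc (by linarith) (by linarith)
    · intro; simp
  have h2 : (0 : ℝ) ≤ (Set.Ioc (z - τ) (z + l + τ)).indicator (1 : ℝ → ℝ) x :=
    Set.indicator_nonneg (by simp) _
  have h3 : 0 ≤ min 1 (τb / l) := le_min zero_le_one (by have := h0.trans h; positivity)
  gcongr

lemma gauss_integral_eq (h : ℝ → ℝ) : ∫ x, h x ∂(gaussianReal 0 1) =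
    (Real.sqrt (2 * Real.pi))⁻¹ * ∫ w, h w * Real.exp (-w ^ 2 / 2) := by
  rw [integral_gaussianReal_eq_integral_smul (by norm_num), ← integral_const_mul]
  congr 1; ext w
  rw [gaussianPDFReal_def]
  simp only [NNReal.coe_one, mul_one, sub_zero, smul_eq_mul]
  ring

lemma stein_hsm (z l : ℝ) (hl : 0 < l) :
    ∃ f k : ℝ → ℝ, Continuous f ∧ Continuous k ∧
      (∀ x, k x = x * f x + (hsm z l x - ∫ u, hsm z l u ∂(gaussianReal 0 1))) ∧
      (∀ x, |f x| ≤ 3) ∧ (∀ x, |x * f x| ≤ 1) ∧ (∀ x, |k x| ≤ 2) ∧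
      (∀ x t, |k (x + t) - k x| ≤ Gm z l x |t|) ∧
      (∀ x t, |f (x + t) - f x - t * k x| ≤ |t| * Gm z l x |t|) := by
  set N := ∫ u, hsm z l u ∂(gaussianReal 0 1) with hN
  have hIntg : Integrable (hsm z l) (gaussianReal 0 1) := by
    refine (integrable_const (1 : ℝ)).mono' (hsm_cont z l).aestronglyMeasurable
      (Filter.Eventually.of_forall fun w => ?_)
    rw [Real.norm_eq_abs, abs_of_nonneg (hsm_nonneg _ _ _)]; exact hsm_le_one _ _ _
  have hN0 : 0 ≤ N := integral_nonneg fun u => hsm_nonneg _ _ _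
  have hN1 : N ≤ 1 := by
    have := integral_mono hIntg (integrable_const (1 : ℝ)) (fun u => hsm_le_one z l u)
    simpa using this
  have hz : ∫ w, (hsm z l w - N) * Real.exp (-w ^ 2 / 2) = 0 := by
    have h1 := gauss_integral_eq (fun w => hsm z l w - N)
    have h2 : ∫ x, (hsm z l x - N) ∂(gaussianReal 0 1) = 0 := by
      rw [integral_sub hIntg (integrable_const _)]; simp [hN]
    rw [h2] at h1
    have h3 : (Real.sqrt (2 * Real.pi))⁻¹ ≠ 0 := by
      have : 0 < 2 * Real.pi := by positivity
      have := Real.sqrt_pos.2 this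
      positivity
    rcases mul_eq_zero.1 h1.symm with h | h
    · exact absurd h h3
    · exact h
  have hgc : Continuous (fun w => hsm z l w - N) := (hsm_cont z l).sub continuous_const
  have hgb : ∀ x, |hsm z l x - N| ≤ 1 := by
    intro x
    have h1 := hsm_nonneg z l x
    have h2 := hsm_le_one z l x
    rw [abs_le]; constructor <;> linarith
  obtain ⟨f, hfd, hf3, hf1⟩ := stein_solution _ hgc hgb hz
  have hfc : Continuous f := continuous_iff_continuousAt.2 fun x => (hfd x).continuousAt
  have hkb : ∀ x, |x * f x + (hsm z l x - N)| ≤ 2 := fun x =>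
    (abs_add_le _ _).trans (by linarith [hf1 x, hgb x])
  have hlip : ∀ x t, |f (x + t) - f x| ≤ 2 * |t| := by
    intro x t
    have := convex_univ.norm_image_sub_le_of_norm_hasDerivWithin_le (f := f) (C := 2)
      (x := x) (y := x + t)
      (fun y _ => (hfd y).hasDerivWithinAt) (fun y _ => hkb y) trivial trivial
    simpa using this
  have hG : ∀ x t τ, |t| ≤ τ → |(x + t) * f (x + t) + (hsm z l (x + t) - N) -
      (x * f x + (hsm z l x - N))| ≤ Gm z l x τ := by
    intro x t τ ht
    have e : (x + t) * f (x + t) + (hsm z l (x + t) - N) - (x * f x + (hsm z l x - N))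
      = t * f (x + t) + x * (f (x + t) - f x) + (hsm z l (x + t) - hsm z l x) := by ring
    rw [e]
    refine (abs_add_le _ _).trans ?_
    unfold Gm
    refine add_le_add ((abs_add_le _ _).trans ?_) (hsm_diff hl ht)
    rw [abs_mul, abs_mul]
    have h1 := hf3 (x + t)
    have h2 := hlip x t
    calc |t| * |f (x + t)| + |x| * |f (x + t) - f x| ≤ τ * 3 + |x| * (2 * τ) := by
          gcongr
          · exact (abs_nonneg _).trans ht
          · linarith
      _ = _ := by ring
  refine ⟨f, fun x => x * f x + (hsm z l x - N), hfc, by fun_prop, fun x => rfl, hf3, hf1, hkb,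
    fun x t => hG x t _ le_rfl, fun x t => ?_⟩
  have := (convex_segment (𝕜 := ℝ) (x) (x + t)).norm_image_sub_le_of_norm_hasDerivWithin_le
      (f := fun y => f y - y * (x * f x + (hsm z l x - N))) (C := Gm z l x |t|)
      (f' := fun y => y * f y + (hsm z l y - N) - 1 * (x * f x + (hsm z l x - N)))
      (x := x) (y := x + t)
      (fun y _ => ((hfd y).sub ((hasDerivAt_id y).mul_const _)).hasDerivWithinAt)
      (fun y hy => by
        have h1 : |y - x| ≤ |t| := by
          have := norm_sub_le_of_mem_segment hy
          simpa using this
        have := hG x (y - x) |t| h1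
        simpa using this)
      (left_mem_segment ℝ _ _) (right_mem_segment ℝ _ _)
  simp only [Real.norm_eq_abs, add_sub_cancel_left] at this
  rw [mul_comm |t|]
  refine le_trans (le_of_eq ?_) this
  congr 1; ring

end MSO

namespace MSO

/-- standard normal cdf -/
def Phi (z : ℝ) : ℝ := (gaussianReal 0 1).real (Set.Iic z)

lemma Phi_mono : Monotone Phi := fun _ _ h => measureReal_mono (Set.Iic_subset_Iic.2 h)

lemma Phi_lip {u v : ℝ} (h : u ≤ v) : Phi v - Phi u ≤ (v - u) / 2 := by
  have h1 : Phi v - Phi u = (gaussianReal 0 1).real (Set.Ioc u v) := by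
    unfold Phi
    rw [← measureReal_sdiff (Set.Iic_subset_Iic.2 h) measurableSet_Iic]
    congr 1; ext x; simp [and_comm]
  rw [h1, measureReal_def]
  have h2 : (gaussianReal 0 1) (Set.Ioc u v) ≤ ENNReal.ofReal ((v - u) / 2) := by
    rw [gaussianReal_apply _ (by norm_num)]
    calc ∫⁻ x in Set.Ioc u v, gaussianPDF 0 1 x ≤ ∫⁻ x in Set.Ioc u v, ENNReal.ofReal (1 / 2) := by
          refine lintegral_mono fun x => ?_
          unfold gaussianPDF
          apply ENNReal.ofReal_le_ofReal
          rw [gaussianPDFReal_def]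
          simp only [NNReal.coe_one, mul_one, sub_zero]
          have h3 : Real.exp (-x ^ 2 / 2) ≤ 1 := by
            rw [Real.exp_le_one_iff]; nlinarith [sq_nonneg x]
          have h4 : (Real.sqrt (2 * Real.pi))⁻¹ ≤ 1 / 2 := by
            rw [one_div]
            apply inv_anti₀ (by norm_num)
            apply Real.le_sqrt_of_sq_le
            nlinarith [Real.pi_gt_three]
          calc _ ≤ (1 / 2 : ℝ) * 1 := by gcongr
            _ = _ := by norm_num
      _ = _ := by
          rw [setLIntegral_const, Real.volume_Ioc, ← ENNReal.ofReal_mul (by norm_num)]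
          congr 1; ring
  exact ENNReal.toReal_le_of_le_ofReal (by linarith) h2

section
variable (μ : Measure ℝ) [IsProbabilityMeasure μ]

lemma pi_split (n : ℕ) (F : ℝ → ℝ → ℝ) (i : Fin (n + 1)) :
    ∫ x, F (x i) (∑ j, x j) ∂(Measure.pi fun _ : Fin (n + 1) => μ) =
    ∫ p, F p.1 (p.1 + ∑ j, p.2 j) ∂(μ.prod (Measure.pi fun _ : Fin n => μ)) := by
  have h := (measurePreserving_piFinSuccAbove (fun _ : Fin (n + 1) => μ) i)
  rw [← h.integral_comp' (g := fun p => F p.1 (p.1 + ∑ j, p.2 j))]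
  congr 1; ext x
  simp [Fin.sum_univ_succAbove _ i, Fin.removeNth]

lemma pi_split_int (n : ℕ) (F : ℝ → ℝ → ℝ) (i : Fin (n + 1)) :
    Integrable (fun x => F (x i) (∑ j, x j)) (Measure.pi fun _ : Fin (n + 1) => μ) ↔
    Integrable (fun p : ℝ × (Fin n → ℝ) => F p.1 (p.1 + ∑ j, p.2 j))
      (μ.prod (Measure.pi fun _ : Fin n => μ)) := by
  have h := (measurePreserving_piFinSuccAbove (fun _ : Fin (n + 1) => μ) i)
  rw [← h.integrable_comp_emb (MeasurableEquiv.measurableEmbedding _)]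
  refine Iff.of_eq ?_
  congr 1; ext x
  simp [Fin.sum_univ_succAbove _ i, Fin.removeNth]

lemma sum_sq (hm1 : Integrable (fun x : ℝ => x) μ) (hm2 : Integrable (fun x : ℝ => x ^ 2) μ)
    (hm : ∫ x, x ∂μ = 0) (v : ℝ) (hv : ∫ x, x ^ 2 ∂μ = v) (n : ℕ) :
    Integrable (fun x => ∑ j, x j) (Measure.pi fun _ : Fin n => μ) ∧
    Integrable (fun x => (∑ j, x j) ^ 2) (Measure.pi fun _ : Fin n => μ) ∧
    ∫ x, (∑ j, x j) ^ 2 ∂(Measure.pi fun _ : Fin n => μ) = n * v := by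
  induction n with
  | zero => simp
  | succ n ih =>
    obtain ⟨i1, i2, i3⟩ := ih
    have a1 : Integrable (fun p : ℝ × (Fin n → ℝ) => p.1)
      (μ.prod (Measure.pi fun _ : Fin n => μ)) := hm1.comp_fst _
    have a2 : Integrable (fun p : ℝ × (Fin n → ℝ) => p.1 ^ 2)
      (μ.prod (Measure.pi fun _ : Fin n => μ)) := hm2.comp_fst _
    have b1 : Integrable (fun p : ℝ × (Fin n → ℝ) => ∑ j, p.2 j)
      (μ.prod (Measure.pi fun _ : Fin n => μ)) := i1.comp_snd _
    have b2 : Integrable (fun p : ℝ × (Fin n → ℝ) => (∑ j, p.2 j) ^ 2)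
      (μ.prod (Measure.pi fun _ : Fin n => μ)) := i2.comp_snd _
    have c : Integrable (fun p : ℝ × (Fin n → ℝ) => p.1 * (∑ j, p.2 j))
      (μ.prod (Measure.pi fun _ : Fin n => μ)) := hm1.mul_prod i1
    have e : (fun p : ℝ × (Fin n → ℝ) => (p.1 + ∑ j, p.2 j) ^ 2) =
      fun p => (p.1 ^ 2 + 2 * (p.1 * ∑ j, p.2 j)) + (∑ j, p.2 j) ^ 2 := by ext p; ring
    refine ⟨(pi_split_int μ n (fun _ s => s) 0).2 (a1.add b1),
      (pi_split_int μ n (fun _ s => s ^ 2) 0).2 ?_, ?_⟩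
    · rw [e]; exact (a2.add (c.const_mul 2)).add b2
    · rw [pi_split μ n (fun _ s => s ^ 2) 0, e,
        integral_add (f := fun p : ℝ × (Fin n → ℝ) => p.1 ^ 2 + 2 * (p.1 * ∑ j, p.2 j))
          (a2.add (c.const_mul 2)) b2, integral_add a2 (c.const_mul 2),
        integral_const_mul, integral_prod_mul (fun x : ℝ => x) (fun y : Fin n → ℝ => ∑ j, y j),
        hm, integral_fun_fst (fun x : ℝ => x ^ 2),
        integral_fun_snd (fun y : Fin n → ℝ => (∑ j, y j) ^ 2), i3, hv]
      simp; ring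

lemma interval_bound {n : ℕ} (hn : 1 ≤ n) {d : ℝ}
    (hd : ∀ z, |(Measure.pi fun _ : Fin n => μ).real {y | ∑ j, y j ≤ Real.sqrt n * z} - Phi z| ≤ d)
    {u v : ℝ} (huv : u ≤ v) :
    (Measure.pi fun _ : Fin n => μ).real {y | (∑ j, y j) / Real.sqrt (n + 1) ∈ Set.Ioc u v}
      ≤ 2 * d + (v - u) := by
  have hn0 : (0 : ℝ) < n := by exact_mod_cast hn
  have hs : 0 < Real.sqrt n := Real.sqrt_pos.2 hn0
  have ha : 0 < Real.sqrt (n + 1) := Real.sqrt_pos.2 (by linarith)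
  set a := Real.sqrt (n + 1) with hadef
  set s := Real.sqrt n with hsdef
  have has : a ≤ 2 * s := by
    rw [hadef, hsdef, Real.sqrt_le_left (by positivity), mul_pow, Real.sq_sqrt hn0.le]
    have : (1 : ℝ) ≤ n := by exact_mod_cast hn
    linarith
  have e : ∀ w, {y : Fin n → ℝ | ∑ j, y j ≤ s * (a * w / s)} = {y | (∑ j, y j) / a ≤ w} := by
    intro w; ext y
    simp only [Set.mem_ofPred_eq]
    rw [mul_div_cancel₀ _ hs.ne', div_le_iff₀ ha, mul_comm]
  have h1 := hd (a * v / s)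
  have h2 := hd (a * u / s)
  rw [e, abs_le] at h1 h2
  have hms : ∀ w, MeasurableSet {y : Fin n → ℝ | (∑ j, y j) / a ≤ w} := fun w =>
    measurableSet_le (by fun_prop) measurable_const
  have h3 : {y : Fin n → ℝ | (∑ j, y j) / a ∈ Set.Ioc u v} =
      {y | (∑ j, y j) / a ≤ v} \ {y | (∑ j, y j) / a ≤ u} := by
    ext y; simp [and_comm]
  have hsub : {y : Fin n → ℝ | (∑ j, y j) / a ≤ u} ⊆ {y | (∑ j, y j) / a ≤ v} :=
    fun y hy => le_trans (show (∑ j, y j) / a ≤ u from hy) huv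
  rw [h3, measureReal_sdiff hsub (hms u)]
  have h4 : a * u / s ≤ a * v / s := by gcongr
  have h5 := Phi_lip h4
  have h6 : (a * v / s - a * u / s) / 2 ≤ v - u := by
    rw [← sub_div, ← mul_sub, div_div, div_le_iff₀ (by positivity)]
    nlinarith [sub_nonneg.2 huv]
  linarith [h1.2, h2.1]

end
end MSO

namespace MSO

lemma Gm_meas (z l : ℝ) : Measurable (fun p : ℝ × ℝ => Gm z l p.1 p.2) := by
  have h1 : MeasurableSet {p : ℝ × ℝ | p.1 ∈ Set.Ioc (z - p.2) (z + l + p.2)} :=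
    (measurableSet_lt (f := fun p : ℝ × ℝ => z - p.2) (g := fun p => p.1)
      (by fun_prop) (by fun_prop)).inter
      (measurableSet_le (f := fun p : ℝ × ℝ => p.1) (g := fun p => z + l + p.2)
        (by fun_prop) (by fun_prop))
  have h2 : (fun p : ℝ × ℝ => Gm z l p.1 p.2) = fun p => (3 + 2 * |p.1|) * p.2 +
      min 1 (p.2 / l) * {p : ℝ × ℝ | p.1 ∈ Set.Ioc (z - p.2) (z + l + p.2)}.indicator 1 p := by
    ext p
    unfold Gm
    congr 2
  rw [h2]
  have h3 := measurable_one.indicator h1 (f := (1 : ℝ × ℝ → ℝ))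
  fun_prop

lemma Gm_nonneg (z l x τ : ℝ) (hl : 0 < l) (hτ : 0 ≤ τ) : 0 ≤ Gm z l x τ := by
  unfold Gm
  have h2 : (0 : ℝ) ≤ (Set.Ioc (z - τ) (z + l + τ)).indicator (1 : ℝ → ℝ) x :=
    Set.indicator_nonneg (by simp) _
  have h3 : 0 ≤ min 1 (τ / l) := le_min zero_le_one (by positivity)
  positivity

lemma Gm_le (z l x τ : ℝ) (hl : 0 < l) (hτ : 0 ≤ τ) :
    Gm z l x τ ≤ τ * (3 + 2 * |x| + 1 / l) := by
  unfold Gm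
  have h2 : (Set.Ioc (z - τ) (z + l + τ)).indicator (1 : ℝ → ℝ) x ≤ 1 :=
    Set.indicator_le_self' (f := (1 : ℝ → ℝ)) (by simp) x
  have h3 : min 1 (τ / l) ≤ τ / l := min_le_right _ _
  have h2' : (0 : ℝ) ≤ (Set.Ioc (z - τ) (z + l + τ)).indicator (1 : ℝ → ℝ) x :=
    Set.indicator_nonneg (by simp) _
  have h4 : 0 ≤ τ / l := by positivity
  calc _ ≤ (3 + 2 * |x|) * τ + τ / l * 1 := by gcongr
    _ = _ := by ring

section
variable (μ : Measure ℝ) [IsProbabilityMeasure μ]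

lemma Gm_inner (hm1 : Integrable (fun x : ℝ => x) μ) (hm2 : Integrable (fun x : ℝ => x ^ 2) μ)
    (hm : ∫ x, x ∂μ = 0) (hv : ∫ x, x ^ 2 ∂μ = 1)
    {n : ℕ} (hn : 1 ≤ n) {d : ℝ}
    (hd : ∀ z, |(Measure.pi fun _ : Fin n => μ).real {y | ∑ j, y j ≤ Real.sqrt n * z} - Phi z| ≤ d)
    (z l : ℝ) (hl : 0 < l) (τ : ℝ) (hτ : 0 ≤ τ) :
    ∫ y, Gm z l ((∑ j, y j) / Real.sqrt (n + 1)) τ ∂(Measure.pi fun _ : Fin n => μ) ≤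
      τ * (8 + 2 * d / l) := by
  have hn0 : (0 : ℝ) < n := by exact_mod_cast hn
  have ha : 0 < Real.sqrt (n + 1) := Real.sqrt_pos.2 (by linarith)
  have ha2 : Real.sqrt (n + 1) ^ 2 = n + 1 := Real.sq_sqrt (by linarith)
  have hib := interval_bound μ hn hd (u := z - τ) (v := z + l + τ) (by linarith)
  set a := Real.sqrt (n + 1)
  set m := (Measure.pi fun _ : Fin n => μ)
  obtain ⟨s1, s2, s3⟩ := sum_sq μ hm1 hm2 hm 1 hv n
  have hd0 : 0 ≤ d := (abs_nonneg _).trans (hd 0)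
  have hE : ∫ y, |(∑ j, y j) / a| ∂m ≤ 1 := by
    have h1 : ∀ y : Fin n → ℝ, |(∑ j, y j) / a| ≤ (1 + (∑ j, y j) ^ 2 * (1 / a ^ 2)) / 2 := by
      intro y
      have h := sq_nonneg (|(∑ j, y j) / a| - 1)
      have h' : |(∑ j, y j) / a| ^ 2 = (∑ j, y j) ^ 2 * (1 / a ^ 2) := by
        rw [sq_abs]; ring
      nlinarith
    have h2 := integral_mono (s1.div_const a).abs
      (((integrable_const (1 : ℝ)).add (s2.mul_const (1 / a ^ 2))).div_const 2) h1
    refine h2.trans ?_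
    simp only [Pi.add_apply]
    rw [integral_div, integral_add (integrable_const _) (s2.mul_const _), integral_mul_const, s3,
      ha2]
    simp only [integral_const, probReal_univ, smul_eq_mul, mul_one]
    rw [div_le_iff₀ (by norm_num), mul_one_div]
    have : (n : ℝ) / (n + 1) ≤ 1 := by rw [div_le_one (by linarith)]; linarith
    linarith
  have hms : MeasurableSet {y : Fin n → ℝ | (∑ j, y j) / a ∈ Set.Ioc (z - τ) (z + l + τ)} :=
    (by fun_prop : Measurable fun y : Fin n → ℝ => (∑ j, y j) / a) measurableSet_Ioc
  have e : ∀ y : Fin n → ℝ, Gm z l ((∑ j, y j) / a) τ = (3 + 2 * |(∑ j, y j) / a|) * τ +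
      min 1 (τ / l) * {y : Fin n → ℝ | (∑ j, y j) / a ∈
        Set.Ioc (z - τ) (z + l + τ)}.indicator (fun _ => (1 : ℝ)) y := by
    intro y; unfold Gm; congr 2
  have j1 : Integrable (fun y : Fin n → ℝ => (3 + 2 * |(∑ j, y j) / a|) * τ) m :=
    ((integrable_const (3 : ℝ)).add ((s1.div_const a).abs.const_mul 2)).mul_const τ
  have j2 : Integrable (fun y : Fin n → ℝ => min 1 (τ / l) *
      {y : Fin n → ℝ | (∑ j, y j) / a ∈
        Set.Ioc (z - τ) (z + l + τ)}.indicator (fun _ => (1 : ℝ)) y) m :=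
    ((integrable_const (1 : ℝ)).indicator hms).const_mul _
  simp_rw [e]
  rw [integral_add j1 j2, integral_mul_const, integral_const_mul,
    integral_add (integrable_const _) ((s1.div_const a).abs.const_mul 2), integral_const_mul,
    integral_indicator_const _ hms]
  simp only [integral_const, probReal_univ, smul_eq_mul, mul_one, one_mul]
  have k1 : min 1 (τ / l) ≤ τ / l := min_le_right _ _
  have k2 : min 1 (τ / l) ≤ 1 := min_le_left _ _
  have k0 : 0 ≤ min 1 (τ / l) := le_min zero_le_one (by positivity)
  have k3 : min 1 (τ / l) * m.real {y : Fin n → ℝ | (∑ j, y j) / a ∈ Set.Ioc (z - τ) (z + l + τ)}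
      ≤ min 1 (τ / l) * (2 * d + (z + l + τ - (z - τ))) := mul_le_mul_of_nonneg_left hib k0
  have k4 : min 1 (τ / l) * (2 * d + (z + l + τ - (z - τ))) ≤ 3 * τ + τ * (2 * d / l) := by
    have q1 : min 1 (τ / l) * (2 * d) ≤ τ / l * (2 * d) := by gcongr
    have q2 : min 1 (τ / l) * l ≤ τ / l * l := by gcongr
    have q3 : min 1 (τ / l) * (2 * τ) ≤ 1 * (2 * τ) := by gcongr
    have q4 : τ / l * l = τ := div_mul_cancel₀ _ hl.ne'
    have q5 : τ / l * (2 * d) = τ * (2 * d / l) := by ring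
    nlinarith
  nlinarith

lemma be_step (h3 : Integrable (fun x : ℝ => |x| ^ 3) μ)
    (hm1 : Integrable (fun x : ℝ => x) μ) (hm2 : Integrable (fun x : ℝ => x ^ 2) μ)
    (hm : ∫ x, x ∂μ = 0) (hv : ∫ x, x ^ 2 ∂μ = 1)
    {n : ℕ} (hn : 1 ≤ n) {d : ℝ}
    (hd : ∀ z, |(Measure.pi fun _ : Fin n => μ).real {y | ∑ j, y j ≤ Real.sqrt n * z} - Phi z| ≤ d)
    (z l : ℝ) (hl : 0 < l) :
    |∫ x, hsm z l ((∑ j, x j) / Real.sqrt (n + 1)) ∂(Measure.pi fun _ : Fin (n + 1) => μ) -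
      ∫ u, hsm z l u ∂(gaussianReal 0 1)| ≤
    (∫ x, (|x| + |x| ^ 3) ∂μ) / Real.sqrt (n + 1) * (8 + 2 * d / l) := by
  have hn0 : (0 : ℝ) < n := by exact_mod_cast hn
  have ha : 0 < Real.sqrt (n + 1) := Real.sqrt_pos.2 (by linarith)
  have ha2 : Real.sqrt (n + 1) ^ 2 = n + 1 := Real.sq_sqrt (by linarith)
  have hinner := Gm_inner μ hm1 hm2 hm hv hn hd z l hl
  obtain ⟨s1, s2, s3⟩ := sum_sq μ hm1 hm2 hm 1 hv n
  set a := Real.sqrt (n + 1)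
  set m := (Measure.pi fun _ : Fin n => μ)
  set m' := (Measure.pi fun _ : Fin (n + 1) => μ)
  set Q := μ.prod m
  obtain ⟨f, k, hfc, hkc, hk, hf3, hf1, hk2, hkG, hfG⟩ := stein_hsm z l hl
  set N := ∫ u, hsm z l u ∂(gaussianReal 0 1)
  have hd0 : 0 ≤ d := (abs_nonneg _).trans (hd 0)
  -- integrability
  have bdd : ∀ {α : Type} [MeasurableSpace α] (ρ : Measure α) [IsProbabilityMeasure ρ]
      (F : α → ℝ) (c : ℝ), Measurable F → (∀ x, |F x| ≤ c) → Integrable F ρ := by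
    intro α _ ρ _ F c hF hb
    exact (integrable_const c).mono' hF.aestronglyMeasurable (Filter.Eventually.of_forall hb)
  have hfm := hfc.measurable
  have hkm := hkc.measurable
  have hhm := (hsm_cont z l).measurable
  have A : ∫ x, hsm z l ((∑ j, x j) / a) ∂m' - N =
      ∫ x, k ((∑ j, x j) / a) ∂m' - ∫ x, ((∑ j, x j) / a) * f ((∑ j, x j) / a) ∂m' := by
    have i1 : Integrable (fun x : Fin (n + 1) → ℝ => k ((∑ j, x j) / a)) m' :=
      bdd _ _ 2 (by fun_prop) fun x => hk2 _
    have i2 : Integrable (fun x : Fin (n + 1) → ℝ => ((∑ j, x j) / a) * f ((∑ j, x j) / a)) m' :=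
      bdd _ _ 1 (by fun_prop) fun x => hf1 _
    have i3 : Integrable (fun x : Fin (n + 1) → ℝ => hsm z l ((∑ j, x j) / a)) m' :=
      bdd _ _ 1 (by fun_prop) fun x => by
        rw [abs_of_nonneg (hsm_nonneg _ _ _)]; exact hsm_le_one _ _ _
    rw [← integral_sub i1 i2]
    have : ∫ x, hsm z l ((∑ j, x j) / a) ∂m' - N =
      ∫ x, (hsm z l ((∑ j, x j) / a) - N) ∂m' := by
      rw [integral_sub i3 (integrable_const _)]; simp
    rw [this]
    congr 1; ext x; rw [hk]; ring
  have ic : ∀ F : ℝ × (Fin n → ℝ) → ℝ, Measurable F → (∀ p, |F p| ≤ 3) →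
      Integrable (fun p : ℝ × (Fin n → ℝ) => p.1 * F p) Q := by
    intro F hF hb
    exact (hm1.comp_fst m).mul_bdd (c := 3) hF.aestronglyMeasurable
      (Filter.Eventually.of_forall hb)
  have i1f : Integrable (fun p : ℝ × (Fin n → ℝ) => p.1 * f ((p.1 + ∑ j, p.2 j) / a)) Q :=
    ic _ (by fun_prop) fun p => hf3 _
  have i0f : Integrable (fun p : ℝ × (Fin n → ℝ) => p.1 * f ((∑ j, p.2 j) / a)) Q :=
    ic _ (by fun_prop) fun p => hf3 _
  have i1k : Integrable (fun p : ℝ × (Fin n → ℝ) => k ((p.1 + ∑ j, p.2 j) / a)) Q :=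
    bdd _ _ 2 (by fun_prop) fun x => hk2 _
  have i0k : Integrable (fun p : ℝ × (Fin n → ℝ) => k ((∑ j, p.2 j) / a)) Q :=
    bdd _ _ 2 (by fun_prop) fun x => hk2 _
  have ikm : Integrable (fun y : Fin n → ℝ => k ((∑ j, y j) / a)) m :=
    bdd _ _ 2 (by fun_prop) fun x => hk2 _
  have i2k : Integrable (fun p : ℝ × (Fin n → ℝ) => p.1 ^ 2 * k ((∑ j, p.2 j) / a)) Q :=
    hm2.mul_prod ikm
  have B : ∫ x, k ((∑ j, x j) / a) ∂m' = ∫ p, k ((p.1 + ∑ j, p.2 j) / a) ∂Q :=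
    pi_split μ n (fun _ s => k (s / a)) 0
  have C : ∫ x, ((∑ j, x j) / a) * f ((∑ j, x j) / a) ∂m' =
      a * ∫ p, p.1 * f ((p.1 + ∑ j, p.2 j) / a) ∂Q := by
    have e : ∀ x : Fin (n + 1) → ℝ, ((∑ j, x j) / a) * f ((∑ j, x j) / a) =
        ∑ i, (1 / a) * (x i * f ((∑ j, x j) / a)) := by
      intro x
      rw [← Finset.mul_sum, ← Finset.sum_mul]; ring
    simp_rw [e]
    rw [integral_finsetSum]
    · have : ∀ i : Fin (n + 1), ∫ x, (1 / a) * (x i * f ((∑ j, x j) / a)) ∂m' =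
          (1 / a) * ∫ p, p.1 * f ((p.1 + ∑ j, p.2 j) / a) ∂Q := by
        intro i
        rw [integral_const_mul]
        congr 1
        exact pi_split μ n (fun t s => t * f (s / a)) i
      simp_rw [this]
      rw [Finset.sum_const, Finset.card_univ, Fintype.card_fin, nsmul_eq_mul, ← mul_assoc]
      congr 1
      push_cast
      rw [← ha2]; field_simp
    · intro i _
      exact ((pi_split_int μ n (fun t s => t * f (s / a)) i).2 i1f).const_mul _
  have D1 : ∫ p, p.1 * f ((∑ j, p.2 j) / a) ∂Q = 0 := by
    rw [integral_prod_mul (fun x : ℝ => x) (fun y : Fin n → ℝ => f ((∑ j, y j) / a)), hm, zero_mul]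
  have D2 : ∫ p, p.1 ^ 2 * k ((∑ j, p.2 j) / a) ∂Q = ∫ p, k ((∑ j, p.2 j) / a) ∂Q := by
    rw [integral_prod_mul (fun x : ℝ => x ^ 2) (fun y : Fin n → ℝ => k ((∑ j, y j) / a)), hv,
      integral_fun_snd (fun y : Fin n → ℝ => k ((∑ j, y j) / a))]
    simp
  have E : ∫ p, k ((p.1 + ∑ j, p.2 j) / a) ∂Q - a * ∫ p, p.1 * f ((p.1 + ∑ j, p.2 j) / a) ∂Q =
      ∫ p, ((k ((p.1 + ∑ j, p.2 j) / a) - k ((∑ j, p.2 j) / a)) -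
        (a * (p.1 * f ((p.1 + ∑ j, p.2 j) / a)) - a * (p.1 * f ((∑ j, p.2 j) / a)) -
          p.1 ^ 2 * k ((∑ j, p.2 j) / a))) ∂Q := by
    have w1 : Integrable (fun p : ℝ × (Fin n → ℝ) => a * (p.1 * f ((p.1 + ∑ j, p.2 j) / a)) -
      a * (p.1 * f ((∑ j, p.2 j) / a))) Q := (i1f.const_mul a).sub (i0f.const_mul a)
    have w2 : Integrable (fun p : ℝ × (Fin n → ℝ) => a * (p.1 * f ((p.1 + ∑ j, p.2 j) / a)) -
      a * (p.1 * f ((∑ j, p.2 j) / a)) - p.1 ^ 2 * k ((∑ j, p.2 j) / a)) Q := w1.sub i2k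
    have w3 : Integrable (fun p : ℝ × (Fin n → ℝ) => k ((p.1 + ∑ j, p.2 j) / a) -
      k ((∑ j, p.2 j) / a)) Q := i1k.sub i0k
    rw [integral_sub w3 w2, integral_sub i1k i0k, integral_sub w1 i2k,
      integral_sub (i1f.const_mul a) (i0f.const_mul a), integral_const_mul, integral_const_mul,
      D1, D2]
    ring
  rw [A, B, C, E, ← Real.norm_eq_abs]
  have mG : Measurable (fun p : ℝ × (Fin n → ℝ) => Gm z l ((∑ j, p.2 j) / a) (|p.1| / a)) :=
    (Gm_meas z l).comp (g := fun p : ℝ × ℝ => Gm z l p.1 p.2)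
      (f := fun p : ℝ × (Fin n → ℝ) => ((∑ j, p.2 j) / a, |p.1| / a)) (by fun_prop)
  have hpt : Integrable (fun x : ℝ => |x| + |x| ^ 3) μ := hm1.abs.add h3
  have iG : Integrable (fun p : ℝ × (Fin n → ℝ) =>
      (1 + p.1 ^ 2) * Gm z l ((∑ j, p.2 j) / a) (|p.1| / a)) Q := by
    have hdom : Integrable (fun p : ℝ × (Fin n → ℝ) =>
      ((|p.1| + |p.1| ^ 3) / a) * (3 + 2 * |(∑ j, p.2 j) / a| + 1 / l)) Q :=
      (hpt.div_const a).mul_prod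
        (((integrable_const (3 : ℝ)).add ((s1.div_const a).abs.const_mul 2)).add
          (integrable_const (1 / l)))
    refine hdom.mono' (by fun_prop) (Filter.Eventually.of_forall fun p => ?_)
    have h1 := Gm_nonneg z l ((∑ j, p.2 j) / a) (|p.1| / a) hl (by positivity)
    have h2 := Gm_le z l ((∑ j, p.2 j) / a) (|p.1| / a) hl (by positivity)
    rw [Real.norm_eq_abs, abs_of_nonneg (by positivity)]
    calc _ ≤ (1 + p.1 ^ 2) * (|p.1| / a * (3 + 2 * |(∑ j, p.2 j) / a| + 1 / l)) := by gcongr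
      _ = _ := by rw [← sq_abs p.1]; ring
  refine (norm_integral_le_of_norm_le iG (Filter.Eventually.of_forall fun p => ?_)).trans ?_
  · have e1 : (p.1 + ∑ j, p.2 j) / a = (∑ j, p.2 j) / a + p.1 / a := by ring
    have g1 := hkG ((∑ j, p.2 j) / a) (p.1 / a)
    have g2 := hfG ((∑ j, p.2 j) / a) (p.1 / a)
    rw [← e1, abs_div, abs_of_pos ha] at g1 g2
    set F1 := f ((p.1 + ∑ j, p.2 j) / a)
    set F0 := f ((∑ j, p.2 j) / a)
    set K0 := k ((∑ j, p.2 j) / a)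
    set G := Gm z l ((∑ j, p.2 j) / a) (|p.1| / a)
    have e2 : a * (p.1 * F1) - a * (p.1 * F0) - p.1 ^ 2 * K0 =
        a * p.1 * (F1 - F0 - p.1 / a * K0) := by
      field_simp
    rw [Real.norm_eq_abs, e2]
    refine (abs_sub _ _).trans ?_
    rw [abs_mul, abs_mul, abs_of_pos ha]
    calc _ ≤ G + a * |p.1| * (|p.1| / a * G) := by gcongr
      _ = _ := by rw [← sq_abs p.1]; field_simp
  · rw [integral_prod _ iG]
    have hrhs : (∫ x, (|x| + |x| ^ 3) ∂μ) / a * (8 + 2 * d / l) =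
        ∫ x, (|x| + |x| ^ 3) / a * (8 + 2 * d / l) ∂μ := by
      rw [integral_mul_const, integral_div]
    rw [hrhs]
    refine integral_mono iG.integral_prod_left ((hpt.div_const a).mul_const _) fun x => ?_
    simp only
    rw [integral_const_mul]
    have := hinner (|x| / a) (by positivity)
    calc _ ≤ (1 + x ^ 2) * (|x| / a * (8 + 2 * d / l)) := by gcongr
      _ = _ := by rw [← sq_abs x]; ring

end
end MSO

namespace MSO

theorem berry_esseen (μ : Measure ℝ) [IsProbabilityMeasure μ]
    (h3 : Integrable (fun x : ℝ => |x| ^ 3) μ)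
    (hm1 : Integrable (fun x : ℝ => x) μ) (hm2 : Integrable (fun x : ℝ => x ^ 2) μ)
    (hm : ∫ x, x ∂μ = 0) (hv : ∫ x, x ^ 2 ∂μ = 1) (n : ℕ) (hn : 1 ≤ n) (z : ℝ) :
    |(Measure.pi fun _ : Fin n => μ).real {y | ∑ j, y j ≤ Real.sqrt n * z} - Phi z| ≤
      100 * (∫ x, |x| ^ 3 ∂μ) / Real.sqrt n := by
  set γ := ∫ x, |x| ^ 3 ∂μ with hγ
  have hγ1 : 1 ≤ γ := by
    have h := integral_mono hm2 (((h3.const_mul 2).add (integrable_const (1 : ℝ))).div_const 3)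
      (fun x => by
        have h0 := abs_nonneg x
        show x ^ 2 ≤ (2 * |x| ^ 3 + 1) / 3
        rw [← sq_abs x]
        nlinarith [mul_nonneg (by linarith : 0 ≤ 2 * |x| + 1) (sq_nonneg (|x| - 1))])
    simp only [Pi.add_apply] at h
    rw [integral_div, integral_add (h3.const_mul 2) (integrable_const _), integral_const_mul, hv]
      at h
    simp at h
    linarith
  have hγ2 : ∫ x, (|x| + |x| ^ 3) ∂μ ≤ 2 * γ := by
    rw [integral_add hm1.abs h3]
    have h := integral_mono hm1.abs (((integrable_const (1 : ℝ)).add hm2).div_const 2)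
      (fun x => by
        show |x| ≤ (1 + x ^ 2) / 2
        rw [← sq_abs x]
        nlinarith [sq_nonneg (|x| - 1)])
    simp only [Pi.add_apply] at h
    rw [integral_div, integral_add (integrable_const _) hm2, hv] at h
    simp at h
    linarith
  induction n, hn using Nat.le_induction generalizing z with
  | base =>
    have h1 : (Measure.pi fun _ : Fin 1 => μ).real {y | ∑ j, y j ≤ Real.sqrt (1 : ℕ) * z} ≤ 1 :=
      measureReal_le_one
    have h2 : Phi z ≤ 1 := measureReal_le_one
    have h3 : 0 ≤ Phi z := measureReal_nonneg
    have h4 : 0 ≤ (Measure.pi fun _ : Fin 1 => μ).real {y | ∑ j, y j ≤ Real.sqrt (1 : ℕ) * z} :=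
      measureReal_nonneg
    have h5 : 100 * γ / Real.sqrt ((1 : ℕ) : ℝ) = 100 * γ := by simp
    rw [h5, abs_le]
    constructor <;> linarith
  | succ n hn ih =>
    have hn0 : (0 : ℝ) < n := by exact_mod_cast hn
    have hn1 : (1 : ℝ) ≤ n := by exact_mod_cast hn
    have hs : 0 < Real.sqrt n := Real.sqrt_pos.2 hn0
    have ha : 0 < Real.sqrt (n + 1) := Real.sqrt_pos.2 (by linarith)
    have key := be_step μ h3 hm1 hm2 hm hv hn ih
    push_cast
    set a := Real.sqrt (n + 1) with hadef
    set m' := (Measure.pi fun _ : Fin (n + 1) => μ)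
    set l := 8 * γ / a with hl
    have hl0 : 0 < l := by positivity
    have hbound : (∫ x, (|x| + |x| ^ 3) ∂μ) / a * (8 + 2 * (100 * γ / Real.sqrt n) / l) ≤
        92 * γ / a := by
      have h1 : a / Real.sqrt n ≤ 1.5 := by
        rw [div_le_iff₀ hs, hadef, Real.sqrt_le_left (by positivity), mul_pow,
          Real.sq_sqrt hn0.le]
        linarith
      have h2 : 2 * (100 * γ / Real.sqrt n) / l = 25 * (a / Real.sqrt n) := by
        rw [hl]; field_simp; norm_num
      rw [h2]
      calc _ ≤ (2 * γ) / a * (8 + 25 * 1.5) := by gcongr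
        _ = 91 * γ / a := by ring
        _ ≤ _ := by gcongr; norm_num
    have up : ∀ w, |∫ x, hsm w l ((∑ j, x j) / a) ∂m' - ∫ u, hsm w l u ∂(gaussianReal 0 1)| ≤
      92 * γ / a := fun w => (key w l hl0).trans hbound
    have hset : {y : Fin (n + 1) → ℝ | ∑ j, y j ≤ a * z} = {y | (∑ j, y j) / a ≤ z} := by
      ext y; simp only [Set.mem_ofPred_eq]; rw [div_le_iff₀ ha, mul_comm]
    rw [hset]
    have hms : ∀ w, MeasurableSet {y : Fin (n + 1) → ℝ | (∑ j, y j) / a ≤ w} := fun w =>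
      measurableSet_le (by fun_prop) measurable_const
    have hsan : ∀ {α : Type} [MeasurableSpace α] (ρ : Measure α) [IsProbabilityMeasure ρ]
        (W : α → ℝ), Measurable W → ∀ w,
        ρ.real {y | W y ≤ w} ≤ ∫ y, hsm w l (W y) ∂ρ ∧
        ∫ y, hsm w l (W y) ∂ρ ≤ ρ.real {y | W y ≤ w + l} := by
      intro α _ ρ _ W hW w
      have hms : ∀ w, MeasurableSet {y | W y ≤ w} := fun w => measurableSet_le hW measurable_const
      have hi : Integrable (fun y => hsm w l (W y)) ρ := by
        refine (integrable_const (1 : ℝ)).mono'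
          ((hsm_cont w l).measurable.comp hW).aestronglyMeasurable
          (Filter.Eventually.of_forall fun y => ?_)
        rw [Real.norm_eq_abs, abs_of_nonneg (hsm_nonneg _ _ _)]; exact hsm_le_one _ _ _
      constructor
      · have h := integral_mono ((integrable_const (1 : ℝ)).indicator (hms w)) hi (fun y => by
          by_cases hy : y ∈ {y | W y ≤ w}
          · rw [Set.indicator_of_mem hy, hsm_eq_one hl0 hy]
          · rw [Set.indicator_of_notMem hy]; exact hsm_nonneg _ _ _)
        rw [integral_indicator_const _ (hms w)] at h
        simpa using h
      · have h := integral_mono hi ((integrable_const (1 : ℝ)).indicator (hms (w + l))) (fun y => by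
          by_cases hy : y ∈ {y | W y ≤ w + l}
          · rw [Set.indicator_of_mem hy]; exact hsm_le_one _ _ _
          · rw [Set.indicator_of_notMem hy, hsm_eq_zero hl0]
            simp only [Set.mem_ofPred_eq, not_le] at hy
            exact hy.le)
        rw [integral_indicator_const _ (hms (w + l))] at h
        simpa using h
    have g1 := hsan m' (fun y => (∑ j, y j) / a) (by fun_prop)
    have g2 := hsan (gaussianReal 0 1) (fun y => y) measurable_id
    have hPhi : ∀ w, (gaussianReal 0 1).real {y | y ≤ w} = Phi w := fun w => rfl
    simp only [hPhi] at g2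
    have p1 := Phi_lip (u := z) (v := z + l) (by linarith)
    have p2 := Phi_lip (u := z - l) (v := z) (by linarith)
    have q1 := abs_le.1 (up z)
    have q2 := abs_le.1 (up (z - l))
    have r1 := g1 z
    have r2 := g1 (z - l)
    have r3 := g2 z
    have r4 := g2 (z - l)
    rw [sub_add_cancel] at r2
    have hfin : 92 * γ / a + l = 100 * γ / a := by rw [hl]; ring
    rw [abs_le]
    constructor <;> linarith [r1.1, r1.2, r2.1, r2.2, r3.1, r3.2, r4.1, r4.2, q1.1, q1.2, q2.1, q2.2]

lemma gaussQ_eq (z : ℝ) : gaussQ z = 1 - Phi z := by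
  have h1 : 1 - Phi z = (gaussianReal 0 1).real (Set.Ioi z) := by
    unfold Phi
    rw [← probReal_compl_eq_one_sub measurableSet_Iic, Set.compl_Iic]
  rw [h1, measureReal_def, gaussianReal_apply_eq_integral _ (by norm_num),
    ENNReal.toReal_ofReal (setIntegral_nonneg measurableSet_Ioi fun x _ =>
      gaussianPDFReal_nonneg _ _ _)]
  unfold gaussQ
  congr 1; ext u
  rw [gaussianPDFReal_def]
  simp only [NNReal.coe_one, mul_one, sub_zero]
  ring

lemma Phi_lower {u v R : ℝ} (h : u ≤ v) (hu : |u| ≤ R) (hv : |v| ≤ R) :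
    Real.exp (-R ^ 2 / 2) / 3 * (v - u) ≤ Phi v - Phi u := by
  have h1 : Phi v - Phi u = (gaussianReal 0 1).real (Set.Ioc u v) := by
    unfold Phi
    rw [← measureReal_sdiff (Set.Iic_subset_Iic.2 h) measurableSet_Iic]
    congr 1; ext x; simp [and_comm]
  rw [h1, measureReal_def, gaussianReal_apply_eq_integral _ (by norm_num),
    ENNReal.toReal_ofReal (setIntegral_nonneg measurableSet_Ioc fun x _ =>
      gaussianPDFReal_nonneg _ _ _)]
  have h2 : ∫ x in Set.Ioc u v, Real.exp (-R ^ 2 / 2) / 3 = Real.exp (-R ^ 2 / 2) / 3 * (v - u) := by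
    rw [setIntegral_const, measureReal_def, Real.volume_Ioc,
      ENNReal.toReal_ofReal (by linarith), smul_eq_mul, mul_comm]
  rw [← h2]
  refine setIntegral_mono_on (by simp) (integrable_gaussianPDFReal 0 1).integrableOn
    measurableSet_Ioc fun x hx => ?_
  rw [gaussianPDFReal_def]
  simp only [NNReal.coe_one, mul_one, sub_zero]
  have h3 : Real.exp (-R ^ 2 / 2) ≤ Real.exp (-x ^ 2 / 2) := by
    apply Real.exp_le_exp.2
    have : |x| ≤ R := abs_le.2 ⟨by linarith [hx.1, (abs_le.1 hu).1], by linarith [hx.2, (abs_le.1 hv).2]⟩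
    have : x ^ 2 ≤ R ^ 2 := by
      rw [← sq_abs x]; gcongr
    linarith
  have h4 : (1 : ℝ) / 3 ≤ (Real.sqrt (2 * Real.pi))⁻¹ := by
    rw [one_div]
    exact inv_anti₀ (Real.sqrt_pos.2 (by positivity)) sqrt_two_pi_le
  calc _ = (1 / 3) * Real.exp (-R ^ 2 / 2) := by ring
    _ ≤ _ := by gcongr

end MSO

namespace MSO

lemma pi_map_real (P : Measure ℝ) [IsProbabilityMeasure P] (n : ℕ) (g : ℝ → ℝ) (hg : Measurable g)
    (A : Set ℝ) (hA : MeasurableSet A) :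
    (Measure.pi fun _ : Fin n => P.map g).real {y | ∑ j, y j ∈ A} =
    (Measure.pi fun _ : Fin n => P).real {x | ∑ j, g (x j) ∈ A} := by
  haveI : IsProbabilityMeasure (P.map g) := Measure.isProbabilityMeasure_map hg.aemeasurable
  have h := Measure.pi_map_pi (μ := fun _ : Fin n => P) (f := fun _ => g)
    (fun _ => hg.aemeasurable)
  have hms : MeasurableSet {y : Fin n → ℝ | ∑ j, y j ∈ A} :=
    (by fun_prop : Measurable fun y : Fin n → ℝ => ∑ j, y j) hA
  rw [← h, map_measureReal_apply (by fun_prop) hms]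
  rfl

section
variable (P : Measure ℝ) [IsProbabilityMeasure P] (σ2 ζ : ℝ)

lemma int_x2 (hmom : Integrable (fun x => x ^ 6) P) : Integrable (fun x : ℝ => x ^ 2) P := by
  refine ((integrable_const (1 : ℝ)).add hmom).mono' (by fun_prop)
    (Filter.Eventually.of_forall fun x => ?_)
  show ‖x ^ 2‖ ≤ 1 + x ^ 6
  rw [Real.norm_eq_abs, abs_of_nonneg (sq_nonneg x)]
  have : x ^ 6 = (x ^ 2) ^ 3 := by ring
  rw [this]
  nlinarith [mul_nonneg (sq_nonneg x) (sq_nonneg (x ^ 2 - 1)), sq_nonneg (x ^ 2 - 1),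
    sq_nonneg (x ^ 2)]

lemma int_x4 (hmom : Integrable (fun x => x ^ 6) P) : Integrable (fun x : ℝ => x ^ 4) P := by
  refine ((integrable_const (1 : ℝ)).add hmom).mono' (by fun_prop)
    (Filter.Eventually.of_forall fun x => ?_)
  show ‖x ^ 4‖ ≤ 1 + x ^ 6
  rw [Real.norm_eq_abs, abs_of_nonneg (by positivity)]
  have : x ^ 6 = (x ^ 2) ^ 3 := by ring
  have : x ^ 4 = (x ^ 2) ^ 2 := by ring
  nlinarith [mul_nonneg (sq_nonneg x) (sq_nonneg (x ^ 2 - 1)), sq_nonneg (x ^ 2 - 1),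
    sq_nonneg (x ^ 2), sq_nonneg x]

lemma int_var (hmom : Integrable (fun x => x ^ 6) P)
    (h2 : (∫ x, x ^ 2 ∂P) = σ2) (h4 : (∫ x, x ^ 4 ∂P) = ζ) :
    Integrable (fun x : ℝ => (x ^ 2 - σ2) ^ 2) P ∧ ∫ x, (x ^ 2 - σ2) ^ 2 ∂P = ζ - σ2 ^ 2 := by
  have i2 := int_x2 P hmom
  have i4 := int_x4 P hmom
  have e : (fun x : ℝ => (x ^ 2 - σ2) ^ 2) = fun x => x ^ 4 - (2 * σ2) * x ^ 2 + σ2 ^ 2 := by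
    ext x; ring
  have i5 : Integrable (fun x : ℝ => x ^ 4 - (2 * σ2) * x ^ 2) P := i4.sub (i2.const_mul _)
  rw [e]
  refine ⟨i5.add (integrable_const _), ?_⟩
  rw [integral_add i5 (integrable_const _), integral_sub i4 (i2.const_mul _), integral_const_mul,
    h2, h4]
  simp; ring

lemma int_cube (hmom : Integrable (fun x => x ^ 6) P) :
    Integrable (fun x : ℝ => |x ^ 2 - σ2| ^ 3) P := by
  refine (((integrable_const (|σ2| ^ 3)).add hmom).const_mul 4).mono' (by fun_prop)
    (Filter.Eventually.of_forall fun x => ?_)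
  show ‖|x ^ 2 - σ2| ^ 3‖ ≤ 4 * (|σ2| ^ 3 + x ^ 6)
  rw [Real.norm_eq_abs, abs_of_nonneg (by positivity)]
  have h1 : |x ^ 2 - σ2| ≤ x ^ 2 + |σ2| := by
    refine (abs_sub _ _).trans ?_
    rw [abs_of_nonneg (sq_nonneg x)]
  have h0 := abs_nonneg σ2
  calc |x ^ 2 - σ2| ^ 3 ≤ (x ^ 2 + |σ2|) ^ 3 := by gcongr
    _ ≤ 4 * (|σ2| ^ 3 + (x ^ 2) ^ 3) := by
      nlinarith [mul_nonneg (add_nonneg (sq_nonneg x) h0) (sq_nonneg (x ^ 2 - |σ2|))]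
    _ = _ := by ring

lemma cheb (hmom : Integrable (fun x => x ^ 6) P)
    (h2 : (∫ x, x ^ 2 ∂P) = σ2) (h4 : (∫ x, x ^ 4 ∂P) = ζ) (δ : ℝ) (hδ : 0 < δ)
    (n : ℕ) (hn : 1 ≤ n) :
    (Measure.pi fun _ : Fin n => P).real {x | ∑ j, x j ^ 2 < n * (σ2 - δ)} ≤
      (ζ - σ2 ^ 2) / δ ^ 2 / n := by
  have hn0 : (0 : ℝ) < n := by exact_mod_cast hn
  obtain ⟨iv, hv⟩ := int_var P σ2 ζ hmom h2 h4
  have i2 := int_x2 P hmom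
  have hg : Measurable (fun x : ℝ => x ^ 2 - σ2) := by fun_prop
  haveI : IsProbabilityMeasure (P.map (fun x : ℝ => x ^ 2 - σ2)) :=
    Measure.isProbabilityMeasure_map hg.aemeasurable
  have a1 : Integrable (fun x : ℝ => x) (P.map (fun x : ℝ => x ^ 2 - σ2)) := by
    rw [integrable_map_measure (by fun_prop) hg.aemeasurable]
    exact i2.sub (integrable_const _)
  have a2 : Integrable (fun x : ℝ => x ^ 2) (P.map (fun x : ℝ => x ^ 2 - σ2)) := by
    rw [integrable_map_measure (by fun_prop) hg.aemeasurable]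
    exact iv
  have b1 : ∫ x, x ∂(P.map (fun x : ℝ => x ^ 2 - σ2)) = 0 := by
    rw [integral_map hg.aemeasurable (by fun_prop), integral_sub i2 (integrable_const _), h2]
    simp
  have b2 : ∫ x, x ^ 2 ∂(P.map (fun x : ℝ => x ^ 2 - σ2)) = ζ - σ2 ^ 2 := by
    rw [integral_map hg.aemeasurable (by fun_prop), hv]
  obtain ⟨s1, s2, s3⟩ := sum_sq _ a1 a2 b1 _ b2 n
  have hmk := mul_meas_ge_le_integral_of_nonneg
    (Filter.Eventually.of_forall fun y : Fin n → ℝ => sq_nonneg (∑ j, y j)) s2 ((n * δ) ^ 2)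
  rw [s3] at hmk
  have hsub : (Measure.pi fun _ : Fin n => P).real {x | ∑ j, x j ^ 2 < n * (σ2 - δ)} ≤
      (Measure.pi fun _ : Fin n => P.map (fun x : ℝ => x ^ 2 - σ2)).real
        {y | (n * δ) ^ 2 ≤ (∑ j, y j) ^ 2} := by
    have := pi_map_real P n _ hg {s | (n * δ) ^ 2 ≤ s ^ 2}
      (measurableSet_le measurable_const (by fun_prop))
    refine le_trans ?_ this.symm.le
    refine measureReal_mono fun x hx => ?_
    have hx' : ∑ j, x j ^ 2 < n * (σ2 - δ) := hx
    show (n * δ) ^ 2 ≤ (∑ j, (x j ^ 2 - σ2)) ^ 2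
    rw [Finset.sum_sub_distrib]
    simp only [Finset.sum_const, Finset.card_univ, Fintype.card_fin, nsmul_eq_mul]
    have : 0 < n * δ := by positivity
    nlinarith
  refine hsub.trans ?_
  rw [div_div, le_div_iff₀ (by positivity)]
  have e : (n * δ) ^ 2 = n * (δ ^ 2 * n) := by ring
  have e2 := hmk
  rw [measureReal_def] at *
  set q := ((Measure.pi fun _ : Fin n => P.map (fun x : ℝ => x ^ 2 - σ2))
        {y | (n * δ) ^ 2 ≤ (∑ j, y j) ^ 2}).toReal
  have e3 : n * (δ ^ 2 * n) * q ≤ n * (ζ - σ2 ^ 2) := by rw [← e]; exact e2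
  have e4 : n * (δ ^ 2 * n * q) ≤ n * (ζ - σ2 ^ 2) := by linarith
  have := le_of_mul_le_mul_left e4 hn0
  linarith

lemma exists_sqrt_bound (B : ℝ) : ∃ n₀ : ℕ, 1 ≤ n₀ ∧ ∀ n ≥ n₀, B ≤ Real.sqrt (n : ℝ) := by
  obtain ⟨k, hk⟩ := exists_nat_ge (B ^ 2)
  refine ⟨k + 1, by omega, fun n hn => ?_⟩
  apply Real.le_sqrt_of_sq_le
  have : ((k + 1 : ℕ) : ℝ) ≤ n := by exact_mod_cast hn
  push_cast at this
  linarith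

theorem quantile (hmom : Integrable (fun x => x ^ 6) P)
    (h2 : (∫ x, x ^ 2 ∂P) = σ2) (h4 : (∫ x, x ^ 4 ∂P) = ζ)
    (ε : ℝ) (hε : ε ∈ Set.Ioo (0 : ℝ) 1) (z : ℝ) (hz : gaussQ z = ε) (A : ℝ) (hA : 0 < A) :
    ∃ K : ℝ, 0 ≤ K ∧ ∃ n₀ : ℕ, 1 ≤ n₀ ∧ ∀ n ≥ n₀,
      (Measure.pi fun _ : Fin n => P).real
        {x | n * σ2 + Real.sqrt n * Real.sqrt (ζ - σ2 ^ 2) * z + K < ∑ j, x j ^ 2}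
        ≤ ε - A / Real.sqrt n ∧
      ε + A / Real.sqrt n ≤ (Measure.pi fun _ : Fin n => P).real
        {x | n * σ2 + Real.sqrt n * Real.sqrt (ζ - σ2 ^ 2) * z - K < ∑ j, x j ^ 2} := by
  obtain ⟨iv, hv⟩ := int_var P σ2 ζ hmom h2 h4
  have i2 := int_x2 P hmom
  have hv0 : 0 ≤ ζ - σ2 ^ 2 := by rw [← hv]; exact integral_nonneg fun x => sq_nonneg _
  rcases hv0.eq_or_lt with h0 | hpos
  · -- degenerate
    have hae : ∀ᵐ x ∂P, x ^ 2 = σ2 := by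
      rw [← h0] at hv
      have := (integral_eq_zero_iff_of_nonneg (fun x => sq_nonneg _) iv).1 hv
      filter_upwards [this] with x hx
      have hx' : (x ^ 2 - σ2) ^ 2 = 0 := hx
      have := pow_eq_zero_iff (two_ne_zero) |>.1 hx'
      linarith
    have haen : ∀ n : ℕ, ∀ᵐ x ∂(Measure.pi fun _ : Fin n => P), ∑ j, x j ^ 2 = n * σ2 := by
      intro n
      have : ∀ᵐ x ∂(Measure.pi fun _ : Fin n => P), ∀ j, x j ^ 2 = σ2 := by
        rw [ae_all_iff]
        intro j
        exact (measurePreserving_eval (fun _ : Fin n => P) j).quasiMeasurePreserving.ae hae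
      filter_upwards [this] with x hx
      simp [hx]
    obtain ⟨n1, hn1, hn1'⟩ := exists_sqrt_bound (A / ε)
    obtain ⟨n2, hn2, hn2'⟩ := exists_sqrt_bound (A / (1 - ε))
    refine ⟨1, zero_le_one, max n1 n2, le_max_of_le_left hn1, fun n hn => ?_⟩
    have hs : 0 < Real.sqrt (n : ℝ) := Real.sqrt_pos.2 (by
      have : 1 ≤ n := hn1.trans ((le_max_left _ _).trans hn)
      exact_mod_cast this)
    have b1 := hn1' n ((le_max_left _ _).trans hn)
    have b2 := hn2' n ((le_max_right _ _).trans hn)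
    have hε1 : 0 < 1 - ε := by linarith [hε.2]
    rw [div_le_iff₀ hε.1] at b1
    rw [div_le_iff₀ hε1] at b2
    have b1' : A / Real.sqrt n ≤ ε := by rw [div_le_iff₀ hs]; linarith
    have b2' : A / Real.sqrt n ≤ 1 - ε := by rw [div_le_iff₀ hs]; linarith
    rw [← h0, Real.sqrt_zero]
    constructor
    · have : (Measure.pi fun _ : Fin n => P).real
        {x | n * σ2 + Real.sqrt n * 0 * z + 1 < ∑ j, x j ^ 2} = 0 := by
        rw [measureReal_eq_zero_iff]
        refine measure_mono_null ?_ (ae_iff.1 (haen n))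
        intro x hx
        have hx' : n * σ2 + Real.sqrt n * 0 * z + 1 < ∑ j, x j ^ 2 := hx
        show ¬ _
        intro h
        rw [h] at hx'
        simp at hx'
        linarith
      rw [this]; linarith
    · have : (Measure.pi fun _ : Fin n => P).real
        {x | n * σ2 + Real.sqrt n * 0 * z - 1 < ∑ j, x j ^ 2} = 1 := by
        rw [measureReal_def]
        have h1 : (Measure.pi fun _ : Fin n => P)
            {x | n * σ2 + Real.sqrt n * 0 * z - 1 < ∑ j, x j ^ 2} = 1 := by
          have hms : MeasurableSet {x : Fin n → ℝ | n * σ2 + Real.sqrt n * 0 * z - 1 < ∑ j, x j ^ 2} :=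
            measurableSet_lt (by fun_prop) (by fun_prop)
          rw [← mem_ae_iff_prob_eq_one hms]
          filter_upwards [haen n] with x hx
          show n * σ2 + Real.sqrt n * 0 * z - 1 < ∑ j, x j ^ 2
          rw [hx]; simp
        rw [h1]; simp
      rw [this]; linarith
  · set τ := Real.sqrt (ζ - σ2 ^ 2) with hτ
    have hτ0 : 0 < τ := Real.sqrt_pos.2 hpos
    have hτ2 : τ ^ 2 = ζ - σ2 ^ 2 := Real.sq_sqrt hv0
    have hg : Measurable (fun x : ℝ => (x ^ 2 - σ2) / τ) := by fun_prop
    set μ := P.map (fun x : ℝ => (x ^ 2 - σ2) / τ) with hμ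
    haveI : IsProbabilityMeasure μ := Measure.isProbabilityMeasure_map hg.aemeasurable
    have a1 : Integrable (fun x : ℝ => x) μ := by
      rw [hμ, integrable_map_measure (by fun_prop) hg.aemeasurable]
      exact (i2.sub (integrable_const _)).div_const _
    have a2 : Integrable (fun x : ℝ => x ^ 2) μ := by
      rw [hμ, integrable_map_measure (by fun_prop) hg.aemeasurable]
      refine (iv.div_const (τ ^ 2)).congr (Filter.Eventually.of_forall fun x => ?_)
      simp [div_pow]
    have a3 : Integrable (fun x : ℝ => |x| ^ 3) μ := by
      rw [hμ, integrable_map_measure (by fun_prop) hg.aemeasurable]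
      refine ((int_cube P σ2 hmom).div_const (τ ^ 3)).congr (Filter.Eventually.of_forall fun x => ?_)
      simp [abs_div, div_pow, abs_of_pos hτ0]
    have b1 : ∫ x, x ∂μ = 0 := by
      rw [hμ, integral_map hg.aemeasurable (by fun_prop), integral_div,
        integral_sub i2 (integrable_const _), h2]
      simp
    have b2 : ∫ x, x ^ 2 ∂μ = 1 := by
      rw [hμ, integral_map hg.aemeasurable (by fun_prop)]
      simp only [div_pow]
      rw [integral_div, hv, hτ2, div_self hpos.ne']
    have BE := berry_esseen μ a3 a1 a2 b1 b2
    set γ := ∫ x, |x| ^ 3 ∂μ with hγ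
    have hγ0 : 0 ≤ γ := integral_nonneg fun x => by positivity
    have hsetE : ∀ (n : ℕ) (w : ℝ), 1 ≤ n → (Measure.pi fun _ : Fin n => P).real
        {x | n * σ2 + Real.sqrt n * τ * w < ∑ j, x j ^ 2} =
        1 - (Measure.pi fun _ : Fin n => μ).real {y | ∑ j, y j ≤ Real.sqrt n * w} := by
      intro n w hn
      have h := pi_map_real P n _ hg (Set.Iic (Real.sqrt n * w)) measurableSet_Iic
      have h' : (Measure.pi fun _ : Fin n => μ).real {y | ∑ j, y j ≤ Real.sqrt n * w} =
        (Measure.pi fun _ : Fin n => P).real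
          {x | ∑ j, (x j ^ 2 - σ2) / τ ∈ Set.Iic (Real.sqrt n * w)} := h
      have hms : MeasurableSet {x : Fin n → ℝ | ∑ j, (x j ^ 2 - σ2) / τ ∈ Set.Iic (Real.sqrt n * w)} :=
        (by fun_prop : Measurable fun x : Fin n → ℝ => ∑ j, (x j ^ 2 - σ2) / τ) measurableSet_Iic
      rw [h', ← probReal_compl_eq_one_sub hms]
      congr 1; ext x
      simp only [Set.mem_ofPred_eq, Set.mem_compl_iff, Set.mem_Iic, not_le]
      rw [← Finset.sum_div, Finset.sum_sub_distrib, lt_div_iff₀ hτ0]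
      simp only [Finset.sum_const, Finset.card_univ, Fintype.card_fin, nsmul_eq_mul]
      constructor <;> intro h <;> linarith
    set R := |z| + 1 with hR
    set c := Real.exp (-R ^ 2 / 2) / 3 with hc
    have hc0 : 0 < c := by positivity
    set κ := (A + 100 * γ) / c with hκ
    have hκ0 : 0 ≤ κ := by positivity
    obtain ⟨n1, hn1, hn1'⟩ := exists_sqrt_bound κ
    refine ⟨τ * κ, by positivity, n1, hn1, fun n hn => ?_⟩
    have hn1n : 1 ≤ n := hn1.trans hn
    have hs : 0 < Real.sqrt (n : ℝ) := Real.sqrt_pos.2 (by exact_mod_cast hn1n)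
    have hb := hn1' n hn
    have hle : κ / Real.sqrt n ≤ 1 := by rw [div_le_one hs]; exact hb
    have hge : 0 ≤ κ / Real.sqrt n := by positivity
    have e1 : n * σ2 + Real.sqrt n * τ * z + τ * κ =
        n * σ2 + Real.sqrt n * τ * (z + κ / Real.sqrt n) := by field_simp; ring
    have e2 : n * σ2 + Real.sqrt n * τ * z - τ * κ =
        n * σ2 + Real.sqrt n * τ * (z - κ / Real.sqrt n) := by field_simp; ring
    rw [e1, e2, hsetE _ _ hn1n, hsetE _ _ hn1n]
    have q1 := abs_le.1 (BE n hn1n (z + κ / Real.sqrt n))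
    have q2 := abs_le.1 (BE n hn1n (z - κ / Real.sqrt n))
    have hz1 := neg_abs_le z
    have hz2 := le_abs_self z
    have p1 := Phi_lower (u := z) (v := z + κ / Real.sqrt n) (R := R) (by linarith)
      (by rw [hR]; linarith) (by rw [abs_le, hR]; constructor <;> linarith)
    have p2 := Phi_lower (u := z - κ / Real.sqrt n) (v := z) (R := R) (by linarith)
      (by rw [abs_le, hR]; constructor <;> linarith) (by rw [hR]; linarith)
    rw [gaussQ_eq] at hz
    have e3 : c * (κ / Real.sqrt n) = A / Real.sqrt n + 100 * γ / Real.sqrt n := by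
      rw [hκ]; field_simp
    have p1' : c * (κ / Real.sqrt n) ≤ Phi (z + κ / Real.sqrt n) - Phi z := by
      simpa using p1
    have p2' : c * (κ / Real.sqrt n) ≤ Phi z - Phi (z - κ / Real.sqrt n) := by
      simpa using p2
    constructor <;> linarith [q1.1, q1.2, q2.1, q2.2]

end
end MSO

namespace MSO

/-- the n-fold Gaussian density -/
def gd (v : ℝ≥0) (n : ℕ) (t : ℝ) : ℝ :=
  ((Real.sqrt (2 * Real.pi * v))⁻¹) ^ n * Real.exp (-t / (2 * v))

lemma gd_prod (v : ℝ≥0) (n : ℕ) (y : Fin n → ℝ) :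
    ∏ i, gaussianPDFReal 0 v (y i) = gd v n (∑ i, y i ^ 2) := by
  simp only [gaussianPDFReal, gd, sub_zero]
  rw [Finset.prod_mul_distrib, ← Real.exp_sum, Finset.prod_const, Finset.card_univ,
    Fintype.card_fin]
  congr 2
  rw [← Finset.sum_div, Finset.sum_neg_distrib]

lemma gd_nonneg (v : ℝ≥0) (n : ℕ) (t : ℝ) : 0 ≤ gd v n t := by unfold gd; positivity

lemma gauss_density (v : ℝ≥0) (hv : v ≠ 0) (n : ℕ) :
    Measure.pi (fun _ : Fin n => gaussianReal 0 v) =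
    (volume : Measure (Fin n → ℝ)).withDensity
      (fun y => ENNReal.ofReal (gd v n (∑ i, y i ^ 2))) := by
  refine (Measure.pi_eq fun s hs => ?_)
  rw [withDensity_apply _ (MeasurableSet.univ_pi hs)]
  simp only [← gd_prod]
  rw [volume_pi, Measure.restrict_pi_pi, ← ofReal_integral_eq_lintegral_ofReal]
  · rw [integral_fintype_prod_eq_prod (fun _ => gaussianPDFReal 0 v),
      ENNReal.ofReal_prod_of_nonneg]
    · refine Finset.prod_congr rfl fun i _ => ?_
      rw [gaussianReal_apply_eq_integral _ hv]
    · intro i _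
      exact integral_nonneg fun x => gaussianPDFReal_nonneg _ _ _
  · exact Integrable.fintype_prod fun i => (integrable_gaussianPDFReal 0 v).restrict
  · exact Filter.Eventually.of_forall fun y =>
      Finset.prod_nonneg fun i _ => gaussianPDFReal_nonneg _ _ _

/-- inner product -/
def ip {n : ℕ} (x y : Fin n → ℝ) : ℝ := ∑ i, x i * y i

lemma ip_add_left {n : ℕ} (x y z : Fin n → ℝ) : ip (x + y) z = ip x z + ip y z := by
  simp [ip, add_mul, Finset.sum_add_distrib]
lemma ip_sub_left {n : ℕ} (x y z : Fin n → ℝ) : ip (x - y) z = ip x z - ip y z := by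
  simp [ip, sub_mul, Finset.sum_sub_distrib]
lemma ip_smul_left {n : ℕ} (c : ℝ) (x z : Fin n → ℝ) : ip (c • x) z = c * ip x z := by
  simp [ip, Finset.mul_sum, mul_assoc]
lemma ip_comm {n : ℕ} (x y : Fin n → ℝ) : ip x y = ip y x := by
  simp [ip, mul_comm]
lemma ip_sub_right {n : ℕ} (x y z : Fin n → ℝ) : ip z (x - y) = ip z x - ip z y := by
  rw [ip_comm, ip_sub_left, ip_comm x, ip_comm y]
lemma ip_smul_right {n : ℕ} (c : ℝ) (x z : Fin n → ℝ) : ip z (c • x) = c * ip z x := by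
  rw [ip_comm, ip_smul_left, ip_comm]
lemma ip_self {n : ℕ} (x : Fin n → ℝ) : ip x x = ∑ i, x i ^ 2 := by
  simp [ip, pow_two]
lemma ip_self_nonneg {n : ℕ} (x : Fin n → ℝ) : 0 ≤ ip x x := by
  rw [ip_self]; positivity
lemma ip_self_eq_zero {n : ℕ} (x : Fin n → ℝ) : ip x x = 0 ↔ x = 0 := by
  rw [ip_self, Finset.sum_eq_zero_iff_of_nonneg (fun i _ => sq_nonneg _)]
  constructor
  · intro h; ext i; simpa using h i (Finset.mem_univ i)
  · rintro rfl; simp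
lemma sum_sub_sq {n : ℕ} (x y : Fin n → ℝ) :
    ∑ i, (x i - y i) ^ 2 = ip x x - 2 * ip x y + ip y y := by
  have : ∑ i, (x i - y i) ^ 2 = ip (x - y) (x - y) := by rw [ip_self]; rfl
  rw [this, ip_sub_left, ip_sub_right, ip_sub_right, ip_comm y x]; ring

/-- Householder reflection in direction `d` -/
def hh {n : ℕ} (d : Fin n → ℝ) : (Fin n → ℝ) →ₗ[ℝ] (Fin n → ℝ) where
  toFun w := w - (2 * ip w d / ip d d) • d
  map_add' w w' := by rw [ip_add_left, mul_add, add_div, add_smul]; abel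
  map_smul' c w := by
    rw [ip_smul_left, RingHom.id_apply, smul_sub, smul_smul]; congr 2; ring

lemma hh_apply {n : ℕ} (d w : Fin n → ℝ) : hh d w = w - (2 * ip w d / ip d d) • d := rfl

lemma hh_ip {n : ℕ} (d w w' : Fin n → ℝ) : ip (hh d w) (hh d w') = ip w w' := by
  rw [hh_apply, hh_apply]
  simp only [ip_sub_left, ip_sub_right, ip_smul_left, ip_smul_right]
  rw [ip_comm d w']
  by_cases h : ip d d = 0
  · simp [h]
  · field_simp; ring

lemma hh_hh {n : ℕ} (d w : Fin n → ℝ) : hh d (hh d w) = w := by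
  by_cases h : ip d d = 0
  · simp [hh_apply, h]
  · rw [hh_apply d (hh d w)]
    have : ip (hh d w) d = - ip w d := by
      rw [hh_apply, ip_sub_left, ip_smul_left]; field_simp; ring
    rw [this, hh_apply]
    have e : 2 * -ip w d / ip d d = - (2 * ip w d / ip d d) := by ring
    rw [e, neg_smul]; abel

lemma hh_map {n : ℕ} (u v : Fin n → ℝ) (h : ip u u = ip v v) : hh (u - v) u = v := by
  by_cases hd : ip (u - v) (u - v) = 0
  · have := (ip_self_eq_zero _).1 hd
    have huv : u = v := sub_eq_zero.1 this
    simp [hh_apply, this, huv]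
  · have e1 : ip (u - v) (u - v) = 2 * ip u (u - v) := by
      rw [ip_sub_left, ip_sub_right, ip_sub_right, ip_comm v u]; linarith
    rw [hh_apply, ← e1, div_self hd, one_smul]; abel

lemma hh_norm {n : ℕ} (d y : Fin n → ℝ) : ∑ i, (hh d y) i ^ 2 = ∑ i, y i ^ 2 := by
  rw [← ip_self, ← ip_self, hh_ip]

lemma hh_meas {n : ℕ} (d : Fin n → ℝ) : Measurable (hh d) :=
  (LinearMap.continuous_on_pi (hh d)).measurable

lemma hh_vol {n : ℕ} (d : Fin n → ℝ) : (volume : Measure (Fin n → ℝ)).map (hh d) = volume := by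
  have h1 : (hh d).comp (hh d) = LinearMap.id := LinearMap.ext (hh_hh d)
  have h2 : LinearMap.det (hh d) * LinearMap.det (hh d) = 1 := by
    rw [← LinearMap.det_comp, h1, LinearMap.det_id]
  have h0 : LinearMap.det (hh d) ≠ 0 := by intro h; rw [h] at h2; simp at h2
  rw [Real.map_linearMap_volume_pi_eq_smul_volume_pi h0]
  have : |(LinearMap.det (hh d))⁻¹| = 1 := by
    rw [abs_inv, inv_eq_one]
    have := congrArg abs h2
    rw [abs_mul, abs_one] at this
    nlinarith [abs_nonneg (LinearMap.det (hh d))]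
  rw [this]; simp

lemma hh_equiv_preimage {n : ℕ} (d : Fin n → ℝ) (κ : Measure (Fin n → ℝ)) (h : κ.map (hh d) = κ)
    (A : Set (Fin n → ℝ)) (hA : MeasurableSet A) : κ {y | hh d y ∈ A} = κ A := by
  conv_rhs => rw [← h, Measure.map_apply (hh_meas d) hA]
  rfl

/-- radial-density measures are invariant -/
lemma radial_inv {n : ℕ} (f : ℝ → ENNReal) (hf : Measurable f) (d : Fin n → ℝ) :
    ((volume : Measure (Fin n → ℝ)).withDensity (fun y => f (∑ i, y i ^ 2))).map (hh d) =
    (volume : Measure (Fin n → ℝ)).withDensity (fun y => f (∑ i, y i ^ 2)) := by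
  ext A hA
  rw [Measure.map_apply (hh_meas d) hA, withDensity_apply _ hA,
    withDensity_apply _ (hh_meas d hA)]
  conv_rhs => rw [← hh_vol d]
  rw [setLIntegral_map hA (by fun_prop) (hh_meas d)]
  simp only [hh_norm]

end MSO

namespace MSO

lemma ip_meas {n : ℕ} (x : Fin n → ℝ) : Measurable fun y => ip x y := by unfold ip; fun_prop
lemma ipp_meas {n : ℕ} : Measurable fun y : Fin n → ℝ => ip y y := by unfold ip; fun_prop
lemma ip2_meas {n : ℕ} : Measurable fun y : (Fin n → ℝ) × (Fin n → ℝ) => ip y.1 y.2 := by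
  unfold ip; fun_prop

lemma ip_zero_left {n : ℕ} (x : Fin n → ℝ) : ip 0 x = 0 := by simp [ip]

lemma lemS {n : ℕ} (κ ν : Measure (Fin n → ℝ)) [IsFiniteMeasure κ] [IsProbabilityMeasure ν]
    (hκ : ∀ d, κ.map (hh d) = κ) (hν : ∀ d, ν.map (hh d) = ν) (hκ0 : κ {0} = 0)
    (r : ℝ) (hr : 0 < r) (hνr : ∀ᵐ y ∂ν, ip y y = r) (x : Fin n → ℝ) (hx : x ≠ 0) (T : ℝ) :
    κ Set.univ * ν {y | ∑ i, (x i - y i) ^ 2 ≤ T} =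
    κ {g | ip x x + r - 2 * (Real.sqrt r * ip x g / Real.sqrt (ip g g)) ≤ T} := by
  have hxx : 0 < ip x x := lt_of_le_of_ne (ip_self_nonneg x)
    (fun h => hx ((ip_self_eq_zero x).1 h.symm))
  set a := Real.sqrt (ip x x) with ha
  have ha0 : 0 < a := Real.sqrt_pos.2 hxx
  have ha2 : a ^ 2 = ip x x := Real.sq_sqrt hxx.le
  set b := Real.sqrt r with hb
  have hb0 : 0 < b := Real.sqrt_pos.2 hr
  have hb2 : b ^ 2 = r := Real.sq_sqrt hr.le
  set E : Set ((Fin n → ℝ) × (Fin n → ℝ)) :=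
    {q | ip x x + r - 2 * (a * ip q.1 q.2 / Real.sqrt (ip q.1 q.1)) ≤ T} with hE
  have hEm : MeasurableSet E := by
    refine measurableSet_le ?_ measurable_const
    have := @ip2_meas n
    have h2 : Measurable fun y : (Fin n → ℝ) × (Fin n → ℝ) => ip y.1 y.1 :=
      ipp_meas.comp measurable_fst
    fun_prop
  have hA1 : MeasurableSet {y : Fin n → ℝ | ip x x + r - 2 * ip x y ≤ T} := by
    refine measurableSet_le ?_ measurable_const
    have := ip_meas x
    fun_prop
  have hA2 : MeasurableSet
      {g : Fin n → ℝ | ip x x + r - 2 * (b * ip x g / Real.sqrt (ip g g)) ≤ T} := by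
    refine measurableSet_le ?_ measurable_const
    have := ip_meas x
    have := @ipp_meas n
    fun_prop
  have e1 : (κ.prod ν) E = κ Set.univ * ν {y | ∑ i, (x i - y i) ^ 2 ≤ T} := by
    rw [Measure.prod_apply hEm]
    have hae : ∀ᵐ g ∂κ, ν (Prod.mk g ⁻¹' E) = ν {y | ∑ i, (x i - y i) ^ 2 ≤ T} := by
      have h0 : ∀ᵐ g ∂κ, g ≠ 0 := by
        rw [ae_iff]; simpa using hκ0
      filter_upwards [h0] with g hg
      have hgg : 0 < ip g g := lt_of_le_of_ne (ip_self_nonneg g)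
        (fun h => hg ((ip_self_eq_zero g).1 h.symm))
      set c := Real.sqrt (ip g g) with hc
      have hc0 : 0 < c := Real.sqrt_pos.2 hgg
      have hc2 : c ^ 2 = ip g g := Real.sq_sqrt hgg.le
      have hu : ip ((a / c) • g) ((a / c) • g) = ip x x := by
        rw [ip_smul_left, ip_smul_right, ← hc2, ← ha2]; field_simp
      have h3 : ν (Prod.mk g ⁻¹' E) = ν {y | hh ((a / c) • g - x) y ∈
          {y : Fin n → ℝ | ip x x + r - 2 * ip x y ≤ T}} := by
        congr 1; ext y
        show ip x x + r - 2 * (a * ip g y / c) ≤ T ↔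
          ip x x + r - 2 * ip x (hh ((a / c) • g - x) y) ≤ T
        have : ip x (hh ((a / c) • g - x) y) = a * ip g y / c := by
          conv_lhs => rw [← hh_map _ _ hu]
          rw [hh_map _ _ hu, ← hh_ip ((a / c) • g - x), hh_hh]
          have : hh ((a / c) • g - x) x = (a / c) • g := by
            conv_lhs => rw [← hh_map _ _ hu]
            rw [hh_map _ _ hu]
            conv_lhs => arg 2; rw [← hh_map _ _ hu]
            rw [hh_hh]
          rw [this, ip_smul_left]; ring
        rw [this]
      rw [h3, hh_equiv_preimage _ _ (hν _) _ hA1]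
      refine measure_congr ?_
      filter_upwards [hνr] with y hy
      refine propext ?_
      show ip x x + r - 2 * ip x y ≤ T ↔ ∑ i, (x i - y i) ^ 2 ≤ T
      rw [sum_sub_sq, hy]
      constructor <;> intro h <;> linarith
    rw [lintegral_congr_ae hae, lintegral_const, mul_comm]
  have e2 : (κ.prod ν) E =
      κ {g | ip x x + r - 2 * (b * ip x g / Real.sqrt (ip g g)) ≤ T} := by
    rw [Measure.prod_apply_symm hEm]
    have hae : ∀ᵐ y ∂ν, κ ((fun g => (g, y)) ⁻¹' E) =
        κ {g | ip x x + r - 2 * (b * ip x g / Real.sqrt (ip g g)) ≤ T} := by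
      filter_upwards [hνr] with y hy
      have hu : ip ((a / b) • y) ((a / b) • y) = ip x x := by
        rw [ip_smul_left, ip_smul_right, hy, ← hb2, ← ha2]; field_simp
      have h3 : κ ((fun g => (g, y)) ⁻¹' E) = κ {g | hh ((a / b) • y - x) g ∈
          {g : Fin n → ℝ | ip x x + r - 2 * (b * ip x g / Real.sqrt (ip g g)) ≤ T}} := by
        congr 1; ext g
        show ip x x + r - 2 * (a * ip g y / Real.sqrt (ip g g)) ≤ T ↔
          ip x x + r - 2 * (b * ip x (hh ((a / b) • y - x) g) /
            Real.sqrt (ip (hh ((a / b) • y - x) g) (hh ((a / b) • y - x) g))) ≤ T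
        rw [hh_ip]
        have : ip x (hh ((a / b) • y - x) g) = a / b * ip g y := by
          rw [← hh_ip ((a / b) • y - x), hh_hh]
          have : hh ((a / b) • y - x) x = (a / b) • y := by
            conv_lhs => arg 2; rw [← hh_map _ _ hu]
            rw [hh_hh]
          rw [this, ip_smul_left, ip_comm y g]
        rw [this]
        have : b * (a / b * ip g y) = a * ip g y := by field_simp
        rw [this]
      rw [h3, hh_equiv_preimage _ _ (hκ _) _ hA2]
    rw [lintegral_congr_ae hae, lintegral_const, measure_univ, mul_one]
  rw [← e1, e2]

lemma lemS_lower {n : ℕ} (κ ν : Measure (Fin n → ℝ)) [IsProbabilityMeasure κ]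
    [IsProbabilityMeasure ν]
    (hκ : ∀ d, κ.map (hh d) = κ) (hν : ∀ d, ν.map (hh d) = ν) (hκ0 : κ {0} = 0)
    (r : ℝ) (hr : 0 < r) (hνr : ∀ᵐ y ∂ν, ip y y = r) (x : Fin n → ℝ) (hx : x ≠ 0) (T : ℝ)
    (hT : 0 ≤ ip x x + r - T) :
    κ {g | ip g g ≤ r ∧ ip x x + r - 2 * ip x g ≤ T} ≤ ν {y | ∑ i, (x i - y i) ^ 2 ≤ T} := by
  have h := lemS κ ν hκ hν hκ0 r hr hνr x hx T
  rw [measure_univ, one_mul] at h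
  rw [h]
  refine measure_mono ?_
  intro g hg
  have hg' : ip g g ≤ r ∧ ip x x + r - 2 * ip x g ≤ T := hg
  show ip x x + r - 2 * (Real.sqrt r * ip x g / Real.sqrt (ip g g)) ≤ T
  have h0 : 0 ≤ ip x g := by linarith
  by_cases hgg : ip g g = 0
  · have : g = 0 := (ip_self_eq_zero g).1 hgg
    rw [this] at hg' ⊢
    have : ip x 0 = 0 := by rw [ip_comm, ip_zero_left]
    rw [this] at hg' ⊢
    simpa using hg'.2
  · have hgp : 0 < ip g g := lt_of_le_of_ne (ip_self_nonneg g) (Ne.symm hgg)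
    have : ip x g ≤ Real.sqrt r * ip x g / Real.sqrt (ip g g) := by
      rw [le_div_iff₀ (Real.sqrt_pos.2 hgp), mul_comm]
      exact mul_le_mul_of_nonneg_right (Real.sqrt_le_sqrt hg'.1) h0
    linarith

lemma lemS_upper {n : ℕ} (κ ν : Measure (Fin n → ℝ)) [IsFiniteMeasure κ]
    [IsProbabilityMeasure ν]
    (hκ : ∀ d, κ.map (hh d) = κ) (hν : ∀ d, ν.map (hh d) = ν) (hκ0 : κ {0} = 0)
    (r : ℝ) (hr : 0 < r) (hνr : ∀ᵐ y ∂ν, ip y y = r)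
    (hκr : ∀ᵐ y ∂κ, r ≤ ip y y ∧ ip y y ≤ r + 1) (x : Fin n → ℝ) (hx : x ≠ 0) (T : ℝ)
    (hT : 0 ≤ ip x x + r - T) :
    κ Set.univ * ν {y | ∑ i, (x i - y i) ^ 2 ≤ T} ≤ κ {y | ∑ i, (x i - y i) ^ 2 ≤ T + 1} := by
  rw [lemS κ ν hκ hν hκ0 r hr hνr x hx T]
  refine measure_mono_ae ?_
  filter_upwards [hκr] with g hg h
  have h' : ip x x + r - 2 * (Real.sqrt r * ip x g / Real.sqrt (ip g g)) ≤ T := h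
  show ∑ i, (x i - g i) ^ 2 ≤ T + 1
  rw [sum_sub_sq]
  have hgp : 0 < ip g g := by linarith [hg.1]
  have hsg : 0 < Real.sqrt (ip g g) := Real.sqrt_pos.2 hgp
  have hsr : 0 < Real.sqrt r := Real.sqrt_pos.2 hr
  have h0 : 0 ≤ Real.sqrt r * ip x g / Real.sqrt (ip g g) := by linarith
  have h1 : 0 ≤ ip x g := by
    by_contra hneg
    push Not at hneg
    have : Real.sqrt r * ip x g / Real.sqrt (ip g g) < 0 :=
      div_neg_of_neg_of_pos (mul_neg_of_pos_of_neg hsr hneg) hsg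
    linarith
  have : Real.sqrt r * ip x g / Real.sqrt (ip g g) ≤ ip x g := by
    rw [div_le_iff₀ hsg, mul_comm]
    exact mul_le_mul_of_nonneg_left (Real.sqrt_le_sqrt hg.1) h1
  linarith [hg.2]

end MSO

namespace MSO

lemma gauss_conv (v : ℝ≥0) (hv : v ≠ 0) (D x : ℝ) (hD : 0 < D) :
    ∫ y, Real.exp (-(x - y) ^ 2 / (2 * D)) ∂(gaussianReal 0 v) =
    Real.sqrt (D / (v + D)) * Real.exp (-x ^ 2 / (2 * (v + D))) := by
  have hv0 : 0 < (v : ℝ) := by positivity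
  have hs0 : 0 < (v : ℝ) + D := by positivity
  rw [integral_gaussianReal_eq_integral_smul hv]
  have h1 : ∀ y : ℝ, gaussianPDFReal 0 v y • Real.exp (-(x - y) ^ 2 / (2 * D)) =
      ((Real.sqrt (2 * Real.pi * v))⁻¹ * Real.exp (-x ^ 2 / (2 * (v + D)))) *
        Real.exp (-((v + D) / (2 * v * D)) * (y - v * x / (v + D)) ^ 2) := by
    intro y
    rw [gaussianPDFReal, smul_eq_mul, mul_assoc (Real.sqrt (2 * Real.pi * v))⁻¹,
      mul_assoc (Real.sqrt (2 * Real.pi * v))⁻¹, ← Real.exp_add, ← Real.exp_add]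
    congr 2
    field_simp
    ring
  simp only [h1]
  rw [integral_const_mul, integral_sub_right_eq_self
    (fun y => Real.exp (-((v + D) / (2 * v * D)) * y ^ 2)) (v * x / (v + D)), integral_gaussian,
    mul_right_comm]
  congr 1
  rw [← Real.sqrt_inv, ← Real.sqrt_mul (by positivity)]
  congr 1
  field_simp

lemma chern {n : ℕ} (v : ℝ≥0) (hv : v ≠ 0) (D b : ℝ) (x : Fin n → ℝ) (hD : 0 < D) :
    (Measure.pi (fun _ : Fin n => gaussianReal 0 v)).real {y | ∑ i, (x i - y i) ^ 2 ≤ n * D + b} ≤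
    Real.exp (b / (2 * D)) * (Real.sqrt (D / (v + D)) ^ n *
      Real.exp (-(∑ i, x i ^ 2 - n * (v + D)) / (2 * (v + D)))) := by
  have hv0 : 0 < (v : ℝ) := by positivity
  have hs0 : 0 < (v : ℝ) + D := by positivity
  set γ := Measure.pi (fun _ : Fin n => gaussianReal 0 v) with hγ
  have hI : ∫ y, ∏ i, Real.exp (-(x i - y i) ^ 2 / (2 * D)) ∂γ =
      Real.sqrt (D / (v + D)) ^ n * Real.exp (-(∑ i, x i ^ 2) / (2 * (v + D))) := by
    rw [hγ, integral_fintype_prod_eq_prod (fun i y => Real.exp (-(x i - y) ^ 2 / (2 * D)))]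
    simp only [gauss_conv v hv D _ hD]
    rw [Finset.prod_mul_distrib, ← Real.exp_sum, Finset.prod_const, Finset.card_univ,
      Fintype.card_fin, ← Finset.sum_div, Finset.sum_neg_distrib]
  have hIntg : Integrable (fun y : Fin n → ℝ => ∏ i, Real.exp (-(x i - y i) ^ 2 / (2 * D))) γ := by
    refine Integrable.fintype_prod (f := fun i y => Real.exp (-(x i - y) ^ 2 / (2 * D))) fun i => ?_
    refine (integrable_const (1 : ℝ)).mono' (by fun_prop) (Filter.Eventually.of_forall fun y => ?_)
    rw [Real.norm_eq_abs, Real.abs_exp, Real.exp_le_one_iff]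
    have : 0 ≤ (x i - y) ^ 2 / (2 * D) := by positivity
    rw [neg_div]; linarith
  have hm := mul_meas_ge_le_integral_of_nonneg (μ := γ)
    (f := fun y : Fin n → ℝ => ∏ i, Real.exp (-(x i - y i) ^ 2 / (2 * D)))
    (Filter.Eventually.of_forall fun y => Finset.prod_nonneg fun i _ => (Real.exp_pos _).le) hIntg
    (Real.exp (-(n * D + b) / (2 * D)))
  rw [hI] at hm
  have hset : {y : Fin n → ℝ | ∑ i, (x i - y i) ^ 2 ≤ n * D + b} =
      {y | Real.exp (-(n * D + b) / (2 * D)) ≤ ∏ i, Real.exp (-(x i - y i) ^ 2 / (2 * D))} := by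
    ext y
    show ∑ i, (x i - y i) ^ 2 ≤ n * D + b ↔
      Real.exp (-(n * D + b) / (2 * D)) ≤ ∏ i, Real.exp (-(x i - y i) ^ 2 / (2 * D))
    rw [← Real.exp_sum, Real.exp_le_exp, ← Finset.sum_div, div_le_div_iff_of_pos_right (by positivity),
      Finset.sum_neg_distrib, neg_le_neg_iff]
  rw [hset]
  have e : Real.exp (b / (2 * D)) * (Real.sqrt (D / (v + D)) ^ n *
      Real.exp (-(∑ i, x i ^ 2 - n * (v + D)) / (2 * (v + D)))) =
      Real.exp ((n * D + b) / (2 * D)) *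
      (Real.sqrt (D / (v + D)) ^ n * Real.exp (-(∑ i, x i ^ 2) / (2 * (v + D)))) := by
    rw [mul_left_comm, mul_left_comm (Real.exp ((n * D + b) / (2 * D))), ← Real.exp_add,
      ← Real.exp_add]
    congr 2
    field_simp
    ring
  rw [e]
  have h3 := mul_le_mul_of_nonneg_left hm (Real.exp_pos ((n * D + b) / (2 * D))).le
  rw [← mul_assoc, ← Real.exp_add] at h3
  have : (n * D + b) / (2 * D) + -(n * D + b) / (2 * D) = 0 := by ring
  rw [this, Real.exp_zero, one_mul] at h3
  exact h3

end MSO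

namespace MSO

/-- volume of the unit ball -/
def ww (k : ℕ) : ℝ := Real.sqrt Real.pi ^ k / Real.Gamma (k / 2 + 1)

lemma ww_pos (k : ℕ) : 0 < ww k := by
  unfold ww
  have : 0 < Real.Gamma ((k : ℝ) / 2 + 1) := Real.Gamma_pos_of_pos (by positivity)
  have := Real.pi_pos
  positivity

lemma vol_ball (k : ℕ) (hk : 1 ≤ k) (ρ : ℝ) (hρ : 0 ≤ ρ) :
    volume {y : Fin k → ℝ | ∑ i, y i ^ 2 ≤ ρ ^ 2} = ENNReal.ofReal (ρ ^ k * ww k) := by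
  have : Nonempty (Fin k) := ⟨⟨0, hk⟩⟩
  have h := MeasureTheory.volume_sum_rpow_le (ι := Fin k) (p := 2) (by norm_num) ρ
  have hs : {y : Fin k → ℝ | ∑ i, y i ^ 2 ≤ ρ ^ 2} =
      {x : Fin k → ℝ | (∑ i, |x i| ^ (2 : ℝ)) ^ (1 / (2 : ℝ)) ≤ ρ} := by
    ext y
    show ∑ i, y i ^ 2 ≤ ρ ^ 2 ↔ (∑ i, |y i| ^ (2 : ℝ)) ^ (1 / (2 : ℝ)) ≤ ρ
    rw [← Real.sqrt_eq_rpow, Real.sqrt_le_left hρ]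
    simp
  rw [hs, h, Fintype.card_fin, ← ENNReal.ofReal_pow hρ, ← ENNReal.ofReal_mul (by positivity)]
  congr 2
  unfold ww
  have : 2 * Real.Gamma (1 / 2 + 1) = Real.sqrt Real.pi := by
    rw [Real.Gamma_add_one (by norm_num), Real.Gamma_one_half_eq]; ring
  rw [this]

lemma gamma_bound (k : ℕ) : Real.log (Real.Gamma ((k : ℝ) / 2 + 1)) ≤
    ((k : ℝ) / 2 + 1) * Real.log ((k : ℝ) / 2 + 1) - k / 2 := by
  induction k using Nat.strong_induction_on with
  | _ k ih =>
    match k with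
    | 0 => simp
    | 1 =>
      have h1 : Real.Gamma ((1 : ℕ) / 2 + 1) ≤ 1 := by
        rw [Nat.cast_one, Real.Gamma_add_one (by norm_num), Real.Gamma_one_half_eq]
        have : Real.sqrt Real.pi ≤ 2 := by
          rw [Real.sqrt_le_left (by norm_num)]; linarith [Real.pi_le_four]
        linarith
      have h2 : Real.log (Real.Gamma ((1 : ℕ) / 2 + 1)) ≤ 0 :=
        Real.log_nonpos (Real.Gamma_pos_of_pos (by positivity)).le h1
      have h3 := Real.one_sub_inv_le_log_of_pos (x := (1 : ℕ) / 2 + 1) (by positivity)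
      norm_num at h2 h3 ⊢
      linarith
    | (m + 2) =>
      have hm := ih m (by omega)
      have e : ((m + 2 : ℕ) : ℝ) / 2 + 1 = ((m : ℝ) / 2 + 1) + 1 := by push_cast; ring
      set t : ℝ := (m : ℝ) / 2 + 1 with ht
      have ht0 : 0 < t := by positivity
      rw [e, Real.Gamma_add_one ht0.ne', Real.log_mul ht0.ne' (Real.Gamma_pos_of_pos ht0).ne']
      have h3 := Real.one_sub_inv_le_log_of_pos (x := (t + 1) / t) (by positivity)
      rw [Real.log_div (by positivity) ht0.ne', inv_div] at h3
      have h4 : 1 ≤ (t + 1) * (Real.log (t + 1) - Real.log t) := by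
        have := mul_le_mul_of_nonneg_left h3 (by positivity : 0 ≤ t + 1)
        have e2 : (t + 1) * (1 - t / (t + 1)) = 1 := by field_simp; ring
        linarith
      push_cast
      nlinarith

lemma log_ww (k : ℕ) : (k : ℝ) / 2 * Real.log Real.pi -
    (((k : ℝ) / 2 + 1) * Real.log ((k : ℝ) / 2 + 1) - k / 2) ≤ Real.log (ww k) := by
  have h := gamma_bound k
  unfold ww
  rw [Real.log_div (by have := Real.pi_pos; positivity)
    (Real.Gamma_pos_of_pos (by positivity)).ne', Real.log_pow, Real.log_sqrt Real.pi_pos.le]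
  linarith

lemma log_gd (v : ℝ≥0) (hv : v ≠ 0) (n : ℕ) (t : ℝ) :
    Real.log (gd v n t) = -((n : ℝ) / 2) * Real.log (2 * Real.pi * v) - t / (2 * v) := by
  have hv0 : 0 < (v : ℝ) := by positivity
  have := Real.pi_pos
  unfold gd
  rw [Real.log_mul (by positivity) (Real.exp_pos _).ne', Real.log_exp, Real.log_pow, Real.log_inv,
    Real.log_sqrt (by positivity)]
  ring

lemma gd_pos (v : ℝ≥0) (hv : v ≠ 0) (n : ℕ) (t : ℝ) : 0 < gd v n t := by
  have hv0 : 0 < (v : ℝ) := by positivity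
  have := Real.pi_pos
  unfold gd; positivity

lemma gd_anti (v : ℝ≥0) (n : ℕ) {t t' : ℝ} (h : t ≤ t') : gd v n t' ≤ gd v n t := by
  unfold gd
  refine mul_le_mul_of_nonneg_left (Real.exp_le_exp.2 ?_) (by positivity)
  exact div_le_div_of_nonneg_right (neg_le_neg h) (by positivity)

/-- Gaussian measure of a set inside a ball is at least density times volume -/
lemma gauss_ge (v : ℝ≥0) (hv : v ≠ 0) (n : ℕ) (A : Set (Fin n → ℝ)) (hA : MeasurableSet A) (t : ℝ)
    (hAt : ∀ y ∈ A, ip y y ≤ t) :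
    ENNReal.ofReal (gd v n t) * volume A ≤ Measure.pi (fun _ : Fin n => gaussianReal 0 v) A := by
  rw [gauss_density v hv, withDensity_apply _ hA, ← setLIntegral_const]
  refine setLIntegral_mono' hA fun y hy => ?_
  refine ENNReal.ofReal_le_ofReal (gd_anti v n ?_)
  rw [← ip_self]; exact hAt y hy

lemma gauss_inv (v : ℝ≥0) (hv : v ≠ 0) (n : ℕ) (d : Fin n → ℝ) :
    (Measure.pi (fun _ : Fin n => gaussianReal 0 v)).map (hh d) =
      Measure.pi (fun _ : Fin n => gaussianReal 0 v) := by
  rw [gauss_density v hv]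
  refine radial_inv (fun t => ENNReal.ofReal (gd v n t)) ?_ d
  unfold gd; fun_prop

lemma gauss_zero (v : ℝ≥0) (hv : v ≠ 0) (n : ℕ) (hn : 1 ≤ n) :
    Measure.pi (fun _ : Fin n => gaussianReal 0 v) {0} = 0 := by
  have : Nonempty (Fin n) := ⟨⟨0, hn⟩⟩
  rw [gauss_density v hv]
  exact withDensity_absolutelyContinuous _ _ (measure_singleton 0)

/-- shell measure lower bound -/
lemma shell (v : ℝ≥0) (hv : v ≠ 0) : ∃ C : ℝ, ∀ n : ℕ, 2 ≤ n →
    Real.exp (-(C + Real.log n)) ≤ (Measure.pi (fun _ : Fin n => gaussianReal 0 v)).real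
      {y | n * (v : ℝ) ≤ ip y y ∧ ip y y ≤ n * v + 1} := by
  have hv0 : 0 < (v : ℝ) := by positivity
  have hpi := Real.pi_pos
  refine ⟨1 / (2 * v) + Real.log (2 * v + 1) + 1, fun n hn => ?_⟩
  have hn0 : (0 : ℝ) < n := by positivity
  set a : ℝ := Real.sqrt (n * v) with ha
  set b : ℝ := Real.sqrt (n * v + 1) with hb
  have ha0 : 0 < a := Real.sqrt_pos.2 (by positivity)
  have hb0 : 0 < b := Real.sqrt_pos.2 (by positivity)
  have ha2 : a ^ 2 = n * v := Real.sq_sqrt (by positivity)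
  have hb2 : b ^ 2 = n * v + 1 := Real.sq_sqrt (by positivity)
  have hm : ∀ t : ℝ, MeasurableSet {y : Fin n → ℝ | ∑ i, y i ^ 2 ≤ t} := fun t =>
    measurableSet_le (by fun_prop) measurable_const
  have hvol : ENNReal.ofReal ((b ^ n - a ^ n) * ww n) ≤
      volume {y : Fin n → ℝ | n * (v : ℝ) ≤ ip y y ∧ ip y y ≤ n * v + 1} := by
    have h1 : volume {y : Fin n → ℝ | ∑ i, y i ^ 2 ≤ b ^ 2} - volume {y : Fin n → ℝ | ∑ i, y i ^ 2 ≤ a ^ 2}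
      ≤ volume {y : Fin n → ℝ | n * (v : ℝ) ≤ ip y y ∧ ip y y ≤ n * v + 1} := by
      refine (le_measure_sdiff).trans (measure_mono ?_)
      intro y hy
      have h1 : ∑ i, y i ^ 2 ≤ b ^ 2 := hy.1
      have h2 : ¬ (∑ i, y i ^ 2 ≤ a ^ 2) := hy.2
      rw [← ip_self] at h1 h2
      refine ⟨?_, ?_⟩ <;> linarith
    rw [vol_ball n (by omega) _ hb0.le, vol_ball n (by omega) _ ha0.le,
      ← ENNReal.ofReal_sub _ (by have := ww_pos n; positivity), ← sub_mul] at h1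
    exact h1
  have hg := gauss_ge v hv n {y : Fin n → ℝ | n * (v : ℝ) ≤ ip y y ∧ ip y y ≤ n * v + 1}
    ((measurableSet_le measurable_const ipp_meas).inter (measurableSet_le ipp_meas measurable_const))
    (n * v + 1) (fun y hy => hy.2)
  have hg2 : gd v n (n * v + 1) * ((b ^ n - a ^ n) * ww n) ≤
      (Measure.pi (fun _ : Fin n => gaussianReal 0 v)).real
      {y | n * (v : ℝ) ≤ ip y y ∧ ip y y ≤ n * v + 1} := by
    rw [measureReal_def]
    rw [← ENNReal.ofReal_le_iff_le_toReal (measure_ne_top _ _), ENNReal.ofReal_mul (gd_nonneg _ _ _)]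
    exact (mul_le_mul_right hvol _).trans hg
  refine le_trans ?_ hg2
  -- Bernoulli
  have hbern : a ^ n * (1 / (2 * v + 1)) ≤ b ^ n - a ^ n := by
    have hle : a ≤ b := Real.sqrt_le_sqrt (by linarith)
    have h1 := one_add_mul_le_pow (a := b / a - 1) (by
      have : 0 ≤ b / a := by positivity
      linarith) n
    have h2 : 1 / (2 * v + 1) ≤ n * (b / a - 1) := by
      have : b - a = 1 / (a + b) := by rw [eq_div_iff (by positivity)]; nlinarith
      have e : (n : ℝ) * (b / a - 1) = n / (a * (a + b)) := by
        have : b / a - 1 = (b - a) / a := by field_simp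
        rw [this, ‹b - a = _›]; field_simp
      have hn2 : (2 : ℝ) ≤ n := by exact_mod_cast hn
      rw [e, div_le_div_iff₀ (by positivity) (by positivity)]
      nlinarith [sq_nonneg (b - a)]
    have h3 : 1 + 1 / (2 * v + 1) ≤ b ^ n / a ^ n := by
      rw [← div_pow]; have : 1 + (b / a - 1) = b / a := by ring
      rw [this] at h1; linarith
    rw [le_div_iff₀ (by positivity)] at h3
    linarith
  have hw := ww_pos n
  have hgp := gd_pos v hv n (n * v + 1)
  refine le_trans ?_ (mul_le_mul_of_nonneg_left (mul_le_mul_of_nonneg_right hbern hw.le) hgp.le)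
  rw [← Real.le_log_iff_exp_le (by positivity), Real.log_mul (by positivity) (by positivity),
    Real.log_mul (by positivity) (by positivity), Real.log_mul (by positivity) (by positivity),
    log_gd v hv, one_div (2 * (v : ℝ) + 1), Real.log_inv, Real.log_pow, ha,
    Real.log_sqrt (by positivity), Real.log_mul (by positivity) (by positivity),
    Real.log_mul (by positivity) (by positivity), Real.log_mul (by positivity) (by positivity)]
  have h1 := log_ww n
  have e1 : (n : ℝ) / 2 + 1 = (n + 2) / 2 := by ring
  rw [e1, Real.log_div (by positivity) (by positivity)] at h1
  have h2 : (n : ℝ) / 2 * (Real.log (n + 2) - Real.log n) ≤ 1 := by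
    have h := Real.log_le_sub_one_of_pos (x := ((n : ℝ) + 2) / n) (by positivity)
    rw [Real.log_div (by positivity) (by positivity)] at h
    have h' := mul_le_mul_of_nonneg_left h (by positivity : 0 ≤ (n : ℝ) / 2)
    have e : (n : ℝ) / 2 * ((n + 2) / n - 1) = 1 := by field_simp; ring
    linarith
  have h3 : Real.log (n + 2) ≤ Real.log n + Real.log 2 := by
    rw [← Real.log_mul (by positivity) (by positivity)]
    refine Real.log_le_log (by positivity) ?_
    have hn2 : (2 : ℝ) ≤ n := by exact_mod_cast hn
    linarith
  have e4 : ((n : ℝ) * v + 1) / (2 * v) = n / 2 + 1 / (2 * v) := by field_simp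
  rw [e4]
  linarith

end MSO

namespace MSO

lemma cap_vol (k : ℕ) (hk : 1 ≤ k) (h η ρ : ℝ) (hη : 0 ≤ η) (hρ : 0 ≤ ρ) :
    volume {y : Fin (k + 1) → ℝ | (h ≤ y 0 ∧ y 0 ≤ h + η) ∧ ∑ i : Fin k, y i.succ ^ 2 ≤ ρ ^ 2} =
    ENNReal.ofReal (η * (ρ ^ k * ww k)) := by
  have hp := volume_preserving_piFinSuccAbove (fun _ : Fin (k + 1) => ℝ) 0
  have hm : MeasurableSet (Set.Icc h (h + η) ×ˢ {z : Fin k → ℝ | ∑ i, z i ^ 2 ≤ ρ ^ 2}) :=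
    measurableSet_Icc.prod (measurableSet_le (by fun_prop) measurable_const)
  have h1 := hp.measure_preimage hm.nullMeasurableSet
  rw [Measure.volume_eq_prod, Measure.prod_prod, vol_ball k hk ρ hρ, Real.volume_Icc,
    ← ENNReal.ofReal_mul (by linarith)] at h1
  have e : h + η - h = η := by ring
  rw [e] at h1
  rw [← h1]
  congr 1

lemma cap (v : ℝ≥0) (hv : v ≠ 0) (k : ℕ) (hk : 1 ≤ k) (x : Fin (k + 1) → ℝ) (hx : x ≠ 0)
    (r T η ρ h : ℝ) (hη : 0 ≤ η) (hρ : 0 ≤ ρ) (hh0 : 0 ≤ h)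
    (hh' : ip x x + r - T ≤ 2 * (Real.sqrt (ip x x) * h)) (hr : ρ ^ 2 + (h + η) ^ 2 ≤ r) :
    ENNReal.ofReal (gd v (k + 1) r * (η * (ρ ^ k * ww k))) ≤
    Measure.pi (fun _ : Fin (k + 1) => gaussianReal 0 v)
      {g | ip g g ≤ r ∧ ip x x + r - 2 * ip x g ≤ T} := by
  have hxx : 0 < ip x x := lt_of_le_of_ne (ip_self_nonneg x)
    (fun h => hx ((ip_self_eq_zero x).1 h.symm))
  set a := Real.sqrt (ip x x) with ha
  have ha0 : 0 < a := Real.sqrt_pos.2 hxx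
  have ha2 : a ^ 2 = ip x x := Real.sq_sqrt hxx.le
  set u : Fin (k + 1) → ℝ := Pi.single 0 a with hu
  have hiu : ∀ y : Fin (k + 1) → ℝ, ip u y = a * y 0 := by
    intro y
    simp [ip, hu, Fin.sum_univ_succ]
  have huu : ip u u = ip x x := by rw [hiu, ← ha2, hu]; simp; ring
  have hA : MeasurableSet {g : Fin (k + 1) → ℝ | ip g g ≤ r ∧ ip x x + r - 2 * ip x g ≤ T} := by
    have := ip_meas x
    have h1 : Measurable fun g => ip x x + r - 2 * ip x g := by fun_prop
    exact (measurableSet_le ipp_meas measurable_const).inter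
      (measurableSet_le h1 measurable_const)
  rw [← hh_equiv_preimage (u - x) _ (gauss_inv v hv (k + 1) (u - x)) _ hA]
  rw [ENNReal.ofReal_mul (gd_nonneg _ _ _), ← cap_vol k hk h η ρ hη hρ]
  have hsub : ∀ y ∈ {y : Fin (k + 1) → ℝ | (h ≤ y 0 ∧ y 0 ≤ h + η) ∧
      ∑ i : Fin k, y i.succ ^ 2 ≤ ρ ^ 2}, ip y y ≤ r := by
    intro y hy
    obtain ⟨⟨h1, h2⟩, h3⟩ := hy
    have e : ip y y = y 0 ^ 2 + ∑ i : Fin k, y i.succ ^ 2 := by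
      rw [ip_self, Fin.sum_univ_succ]
    rw [e]
    nlinarith
  refine (gauss_ge v hv (k + 1) _ ?_ r hsub).trans (measure_mono ?_)
  · have h1 : Measurable fun y : Fin (k + 1) → ℝ => y 0 := by fun_prop
    have h2 : Measurable fun y : Fin (k + 1) → ℝ => ∑ i : Fin k, y i.succ ^ 2 := by fun_prop
    exact ((measurableSet_le measurable_const h1).inter (measurableSet_le h1 measurable_const)).inter
      (measurableSet_le h2 measurable_const)
  · intro y hy
    have h1 := hsub y hy
    show ip (hh (u - x) y) (hh (u - x) y) ≤ r ∧ ip x x + r - 2 * ip x (hh (u - x) y) ≤ T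
    rw [hh_ip]
    refine ⟨h1, ?_⟩
    have : ip x (hh (u - x) y) = ip u y := by
      conv_rhs => rw [← hh_ip (u - x), hh_map u x huu]
    rw [this, hiu]
    have h2 : h ≤ y 0 := hy.1.1
    nlinarith

end MSO

namespace MSO

lemma exists_nat_large (L : ℝ) : ∃ n0 : ℕ, 3 ≤ n0 ∧ ∀ n : ℕ, n0 ≤ n → L ≤ n := by
  obtain ⟨m, hm⟩ := _root_.exists_nat_ge L
  refine ⟨max 3 m, le_max_left _ _, fun n hn => hm.trans ?_⟩
  exact_mod_cast (le_max_right _ _).trans hn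

set_option maxHeartbeats 1000000 in
lemma qbound (s D b K : ℝ) (hs : 0 < s) (hD : 0 < D) :
    ∃ C1 : ℝ, ∃ n0 : ℕ, 3 ≤ n0 ∧ ∀ n : ℕ, n0 ≤ n → ∀ u : ℝ, u = b / Real.sqrt n + K / n →
    0 < s + D + u ∧ 0 < 2 * s + u ∧ ∃ q : ℝ, 0 < q ∧ q ≤ s ∧
      n * q + (n * (2 * s + u) / (2 * Real.sqrt (n * (s + D + u))) + 1 / Real.sqrt n) ^ 2 ≤ n * s ∧
      Real.log s - Real.log ((s + D) / D) - u / (s + D) - C1 / n ≤ Real.log q := by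
  set U := |b| + |K| with hU
  have hU0 : 0 ≤ U := by positivity
  set m := min s D / 2 with hm
  have hm0 : 0 < m := by have := lt_min hs hD; positivity
  set C1 := (U ^ 2 / 4 + 2 * (s + D) * (2 + 5 * s)) / (s * D) with hC1
  have hC10 : 0 ≤ C1 := by positivity
  obtain ⟨n1, hn1, h1⟩ := exists_nat_large ((U / m) ^ 2)
  obtain ⟨n2, hn2, h2⟩ := exists_nat_large (2 * C1)
  refine ⟨2 * C1, max n1 n2, hn1.trans (le_max_left _ _), fun n hn u hu => ?_⟩
  have hn3 : 3 ≤ n := hn1.trans ((le_max_left _ _).trans hn)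
  have hnr : (3 : ℝ) ≤ n := by exact_mod_cast hn3
  have hn0 : (0 : ℝ) < n := by linarith
  have g1 := h1 n ((le_max_left _ _).trans hn)
  have g2 := h2 n ((le_max_right _ _).trans hn)
  have hw0 : 0 < Real.sqrt n := Real.sqrt_pos.2 hn0
  have hw2 : Real.sqrt n ^ 2 = n := Real.sq_sqrt hn0.le
  set w := Real.sqrt (n : ℝ) with hw
  have hw1 : 1 ≤ w := by nlinarith
  have huU : |u| ≤ U / w := by
    rw [hu, ← hw2]
    refine (abs_add_le _ _).trans ?_
    rw [abs_div, abs_div, abs_of_pos hw0, abs_of_pos (by positivity : 0 < w ^ 2), hU, add_div]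
    have : |K| / w ^ 2 ≤ |K| / w := div_le_div_of_nonneg_left (abs_nonneg _) hw0 (by nlinarith)
    linarith
  have hum : |u| ≤ m := by
    refine huU.trans ?_
    have : U / m ≤ w := Real.le_sqrt_of_sq_le g1
    rw [div_le_iff₀ hm0] at this
    rw [div_le_iff₀ hw0]; linarith
  have hu2 : u ^ 2 ≤ U ^ 2 / n := by
    rw [← sq_abs, ← hw2, ← div_pow]
    exact pow_le_pow_left₀ (abs_nonneg _) huU 2
  have hms : m ≤ s / 2 := by rw [hm]; linarith [min_le_left s D]
  have hmD : m ≤ D / 2 := by rw [hm]; linarith [min_le_right s D]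
  obtain ⟨hul, hur⟩ := abs_le.1 hum
  have hp0 : 0 < s + D + u := by linarith
  have ht0 : 0 < 2 * s + u := by linarith
  refine ⟨hp0, ht0, ?_⟩
  set p := s + D + u with hp
  have hp2 : p ≤ 2 * (s + D) := by linarith
  have hp1 : (s + D) / 2 ≤ p := by linarith
  set H := (2 * s + u) ^ 2 / (4 * p) with hH
  have hH0 : 0 ≤ H := by positivity
  have hH5 : H ≤ 5 * s := by
    rw [hH, div_le_iff₀ (by positivity)]
    have : (2 * s + u) ^ 2 ≤ (5 / 2 * s) ^ 2 := pow_le_pow_left₀ ht0.le (by linarith) 2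
    nlinarith
  have hsH : s - H = (s * D - u ^ 2 / 4) / p := by
    have hus : u = p - s - D := by rw [hp]; ring
    rw [hH, eq_div_iff hp0.ne', sub_mul, div_mul_eq_mul_div, hus]
    field_simp; ring
  set hst := n * (2 * s + u) / (2 * Real.sqrt (n * p)) with hhst
  have hst0 : 0 ≤ hst := by positivity
  have hst2 : hst ^ 2 = n * H := by
    rw [hhst, div_pow, mul_pow, mul_pow, Real.sq_sqrt (by positivity), hH]; field_simp; ring
  set q := s - (hst + 1 / w) ^ 2 / n with hq
  have hqlow : s * D / p * (1 - C1 / n) ≤ q := by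
    have e1 : (hst + 1 / w) ^ 2 ≤ n * H + (2 + 5 * s) := by
      have i1 : (1 / w) ^ 2 ≤ 1 := by
        rw [div_pow, one_pow, div_le_one (by positivity)]; nlinarith
      have i2 : 2 * hst * (1 / w) ≤ 1 + H := by
        have i3 : (hst * (1 / w)) ^ 2 = H := by
          rw [mul_pow, hst2, div_pow, hw2]; field_simp
        have i4 := sq_nonneg (hst * (1 / w) - 1)
        have i5 : (hst * (1 / w) - 1) ^ 2 = (hst * (1 / w)) ^ 2 - 2 * hst * (1 / w) + 1 := by ring
        rw [i5, i3] at i4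
        linarith
      have i6 : (hst + 1 / w) ^ 2 = hst ^ 2 + 2 * hst * (1 / w) + (1 / w) ^ 2 := by ring
      rw [i6, hst2]
      linarith
    have e2 : s - H - (2 + 5 * s) / n ≤ q := by
      rw [hq]
      have : (hst + 1 / w) ^ 2 / n ≤ (n * H + (2 + 5 * s)) / n :=
        div_le_div_of_nonneg_right e1 hn0.le
      have e3 : (n * H + (2 + 5 * s)) / n = H + (2 + 5 * s) / n := by field_simp
      linarith
    refine le_trans ?_ e2
    have e4 : (2 + 5 * s) / n ≤ (2 * (s + D) * (2 + 5 * s)) / n / p := by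
      rw [le_div_iff₀ hp0, div_mul_eq_mul_div]
      refine div_le_div_of_nonneg_right ?_ hn0.le
      nlinarith
    have e5 : s * D / p * (1 - C1 / n) =
        (s * D - (U ^ 2 / n) / 4) / p - (2 * (s + D) * (2 + 5 * s)) / n / p := by
      rw [hC1]; field_simp; ring
    rw [e5, hsH]
    have : (s * D - (U ^ 2 / n) / 4) / p ≤ (s * D - u ^ 2 / 4) / p :=
      div_le_div_of_nonneg_right (by linarith) hp0.le
    linarith
  have ht : C1 / n ≤ 1 / 2 := by rw [div_le_div_iff₀ hn0 (by norm_num)]; linarith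
  have htn : 0 ≤ C1 / n := by positivity
  have hpos : 0 < s * D / p * (1 - C1 / n) := mul_pos (by positivity) (by linarith)
  refine ⟨q, hpos.trans_le hqlow, ?_, ?_, ?_⟩
  · rw [hq]; have : 0 ≤ (hst + 1 / w) ^ 2 / n := by positivity
    linarith
  · rw [hq]; apply le_of_eq; field_simp; ring
  · refine le_trans ?_ (Real.log_le_log hpos hqlow)
    rw [Real.log_mul (by positivity) (by linarith), Real.log_div (by positivity) hp0.ne',
      Real.log_mul hs.ne' hD.ne', Real.log_div (by positivity) hD.ne']
    have i1 : - (2 * C1 / n) ≤ Real.log (1 - C1 / n) := by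
      have := Real.one_sub_inv_le_log_of_pos (x := 1 - C1 / n) (by linarith)
      refine le_trans ?_ this
      have e : 2 * C1 / n = 2 * (C1 / n) := by ring
      rw [e]
      set t := C1 / n
      have : (1 - t)⁻¹ ≤ 1 + 2 * t := by
        rw [inv_le_iff_one_le_mul₀ (by linarith)]; nlinarith
      linarith
    have i2 : Real.log p ≤ Real.log (s + D) + u / (s + D) := by
      have := Real.log_le_sub_one_of_pos (x := p / (s + D)) (by positivity)
      rw [Real.log_div hp0.ne' (by positivity)] at this
      have e : p / (s + D) - 1 = u / (s + D) := by rw [hp]; field_simp; ring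
      linarith
    linarith

lemma logcap (v : ℝ≥0) (hv : v ≠ 0) : ∃ C2 : ℝ, ∀ k : ℕ, 1 ≤ k → ∀ q : ℝ, 0 < q → q ≤ v →
    -C2 - 3 / 2 * Real.log ((k + 1 : ℕ) : ℝ) +
      ((k + 1 : ℕ) : ℝ) / 2 * (Real.log q - Real.log v) ≤
    Real.log (gd v (k + 1) (((k + 1 : ℕ) : ℝ) * v) * (1 / Real.sqrt ((k + 1 : ℕ) : ℝ) *
      (Real.sqrt (((k + 1 : ℕ) : ℝ) * q) ^ k * ww k))) := by
  have hv0 : 0 < (v : ℝ) := by positivity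
  have hpi := Real.pi_pos
  refine ⟨1 + 1 / 2 * |Real.log v| + 1 / 2 * Real.log Real.pi + 1, fun k hk q hq hqv => ?_⟩
  have hkn : ((k : ℕ) : ℝ) = ((k + 1 : ℕ) : ℝ) - 1 := by push_cast; ring
  have hw := log_ww k
  have hwp := ww_pos k
  have hn2 : (2 : ℝ) ≤ ((k + 1 : ℕ) : ℝ) := by
    exact_mod_cast Nat.succ_le_succ hk
  have hgp := gd_pos v hv (k + 1) (((k + 1 : ℕ) : ℝ) * v)
  have hlg := log_gd v hv (k + 1) (((k + 1 : ℕ) : ℝ) * v)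
  rw [hkn] at hw
  set n : ℝ := ((k + 1 : ℕ) : ℝ) with hn
  have hn0 : 0 < n := by linarith
  have e1 : (n - 1) / 2 + 1 = (n + 1) / 2 := by ring
  rw [e1, Real.log_div (by positivity) (by positivity)] at hw
  have hs : 0 < Real.sqrt n := Real.sqrt_pos.2 hn0
  have hsq : 0 < Real.sqrt (n * q) := Real.sqrt_pos.2 (by positivity)
  rw [Real.log_mul hgp.ne' (by positivity), Real.log_mul (by positivity) (by positivity),
    Real.log_mul (by positivity) hwp.ne', hlg, one_div (Real.sqrt n), Real.log_inv, Real.log_pow,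
    Real.log_sqrt hn0.le, Real.log_sqrt (by positivity), Real.log_mul hn0.ne' hq.ne', hkn,
    Real.log_mul (by positivity) hv0.ne', Real.log_mul (by positivity) (by positivity)]
  have e2 : n * v / (2 * v) = n / 2 := by field_simp
  rw [e2]
  have h2 : (n + 1) / 2 * (Real.log (n + 1) - Real.log n) ≤ 1 := by
    have h := Real.log_le_sub_one_of_pos (x := (n + 1) / n) (by positivity)
    rw [Real.log_div (by positivity) (by positivity)] at h
    have h' := mul_le_mul_of_nonneg_left h (by positivity : 0 ≤ (n + 1) / 2)
    have e : (n + 1) / 2 * ((n + 1) / n - 1) = (n + 1) / (2 * n) := by field_simp; ring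
    have : (n + 1) / (2 * n) ≤ 1 := by rw [div_le_one (by positivity)]; linarith
    linarith
  have h3 : Real.log q ≤ |Real.log v| := (Real.log_le_log hq hqv).trans (le_abs_self _)
  have h4 : 0 ≤ Real.log 2 := Real.log_nonneg (by norm_num)
  nlinarith

end MSO

namespace MSO

lemma one_le_log {n : ℕ} (hn : 3 ≤ n) : 1 ≤ Real.log n := by
  rw [Real.le_log_iff_exp_le (by positivity)]
  have h1 : (3 : ℝ) ≤ n := by exact_mod_cast hn
  have := Real.exp_one_lt_d9
  linarith

lemma mono_h (A B c t : ℝ) (hA : 0 < A) (hAB : A ≤ B) (ht : t ≤ A) (hc : c ≤ t) :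
    A + c ≤ 2 * (Real.sqrt A * ((B + c) / (2 * Real.sqrt B))) := by
  have hB : 0 < B := hA.trans_le hAB
  set a := Real.sqrt A with ha
  set b := Real.sqrt B with hb
  have ha0 : 0 < a := Real.sqrt_pos.2 hA
  have hb0 : 0 < b := Real.sqrt_pos.2 hB
  have ha2 : a ^ 2 = A := Real.sq_sqrt hA.le
  have hb2 : b ^ 2 = B := Real.sq_sqrt hB.le
  have hab : a ≤ b := Real.sqrt_le_sqrt hAB
  have e : 2 * (a * ((B + c) / (2 * b))) = a * (B + c) / b := by field_simp
  rw [e, le_div_iff₀ hb0, ← ha2, ← hb2]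
  have h1 : c ≤ a * b := by nlinarith
  nlinarith [mul_nonneg (sub_nonneg.2 hab) (sub_nonneg.2 h1)]

lemma ach_cap (v : ℝ≥0) (hv : v ≠ 0) (D b K : ℝ) (hD : 0 < D) :
    ∃ C : ℝ, ∃ n0 : ℕ, 3 ≤ n0 ∧ ∀ n : ℕ, n0 ≤ n → ∀ x : Fin n → ℝ, n * (v : ℝ) ≤ ip x x →
      ip x x ≤ n * (v + D) + Real.sqrt n * b + K →
      Real.exp (-((n : ℝ) / 2 * Real.log ((v + D) / D) + Real.sqrt n * b / (2 * (v + D)) +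
        C * Real.log n)) ≤
      (Measure.pi (fun _ : Fin n => gaussianReal 0 v)).real
        {g | ip g g ≤ n * v ∧ ip x x + n * v - 2 * ip x g ≤ n * D} := by
  have hv0 : 0 < (v : ℝ) := by positivity
  obtain ⟨C1, n0, hn0, H1⟩ := qbound v D b K hv0 hD
  obtain ⟨C2, H2⟩ := logcap v hv
  refine ⟨|C2| + 3 / 2 + |K| / (2 * (v + D)) + |C1| / 2, n0, hn0, fun n hn x hx1 hx2 => ?_⟩
  have hn3 : 3 ≤ n := hn0.trans hn
  obtain ⟨k, rfl⟩ : ∃ k, n = k + 1 := ⟨n - 1, by omega⟩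
  have hk : 1 ≤ k := by omega
  obtain ⟨hp0, ht0, q, hq0, hqv, hq1, hq2⟩ := H1 (k + 1) hn _ rfl
  have hlog := H2 k hk q hq0 hqv
  have hL := one_le_log hn3
  have hnpos : (0 : ℝ) < ((k + 1 : ℕ) : ℝ) := by positivity
  set n : ℝ := ((k + 1 : ℕ) : ℝ) with hndef
  have hw0 : 0 < Real.sqrt n := Real.sqrt_pos.2 hnpos
  have hw2 : Real.sqrt n ^ 2 = n := Real.sq_sqrt hnpos.le
  set w := Real.sqrt n with hw
  set u := b / w + K / n with hu
  have hnu : n * u = w * b + K := by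
    rw [hu, mul_add]
    have : n * (b / w) = w * b := by rw [← hw2]; field_simp
    rw [this]; field_simp
  have hB : n * (v + D) + w * b + K = n * (v + D + u) := by linarith [mul_add n ((v : ℝ) + D) u]
  rw [hB] at hx2
  have hA0 : 0 < ip x x := (by positivity : 0 < n * (v : ℝ)).trans_le hx1
  have hx : x ≠ 0 := by rintro rfl; simp [ip] at hA0
  have hcap := cap v hv k hk x hx (n * v) (n * D) (1 / w) (Real.sqrt (n * q))
    (n * (2 * v + u) / (2 * Real.sqrt (n * (v + D + u)))) (by positivity) (Real.sqrt_nonneg _)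
    (by positivity) (by
      have := mono_h (ip x x) (n * (v + D + u)) (n * v - n * D) (n * v) hA0 hx2 hx1
        (by nlinarith)
      have e : n * (v + D + u) + (n * v - n * D) = n * (2 * v + u) := by ring
      rw [e] at this
      linarith) (by
      rw [Real.sq_sqrt (by positivity)]; exact hq1)
  have hwp := ww_pos k
  have hgp := gd_pos v hv (k + 1) (n * v)
  have hsq : 0 < Real.sqrt (n * q) := Real.sqrt_pos.2 (by positivity)
  rw [measureReal_def, ← ENNReal.ofReal_le_iff_le_toReal (measure_ne_top _ _)]
  refine le_trans (ENNReal.ofReal_le_ofReal ?_) hcap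
  rw [← Real.le_log_iff_exp_le (by positivity)]
  refine le_trans ?_ hlog
  have g1 := mul_le_mul_of_nonneg_left hq2 (by positivity : 0 ≤ n / 2)
  have e1 : n / 2 * (Real.log v - Real.log ((v + D) / D) - u / (v + D) - C1 / n) =
      n / 2 * Real.log v - n / 2 * Real.log ((v + D) / D) - (n * u) / (2 * (v + D)) - C1 / 2 := by
    field_simp
  rw [e1, hnu, add_div (w * b)] at g1
  have g2 : K / (2 * (v + D)) ≤ |K| / (2 * (v + D)) :=
    div_le_div_of_nonneg_right (le_abs_self K) (by positivity)
  have g3 := le_abs_self C1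
  have g4 := le_abs_self C2
  have g5 : 0 ≤ |K| / (2 * (v + D)) := by positivity
  have g6 := mul_le_mul_of_nonneg_left hL
    (by positivity : 0 ≤ |C2| + |K| / (2 * (v + D)) + |C1| / 2)
  linarith

lemma sqrt_pow_exp (v : ℝ≥0) (D : ℝ) (hD : 0 < D) (n : ℕ) :
    Real.sqrt (D / (v + D)) ^ n = Real.exp (-((n : ℝ) / 2 * Real.log ((v + D) / D))) := by
  have hv0 : 0 ≤ (v : ℝ) := by positivity
  have h1 : 0 < D / (v + D) := by positivity
  have e : Real.log ((v + D) / D) = - Real.log (D / (v + D)) := by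
    rw [← Real.log_inv, inv_div]
  have h2 : Real.log (Real.sqrt (D / (v + D))) = Real.log (D / (v + D)) / 2 :=
    Real.log_sqrt h1.le
  rw [← Real.exp_log (Real.sqrt_pos.2 h1), ← Real.exp_nat_mul, h2, e]
  congr 1; ring

lemma conv_g (v : ℝ≥0) (hv : v ≠ 0) (D b K β : ℝ) (hD : 0 < D) (n : ℕ) (x : Fin n → ℝ)
    (hx : n * (v + D) + Real.sqrt n * b - K < ip x x) :
    (Measure.pi (fun _ : Fin n => gaussianReal 0 v)).real
      {y | ∑ i, (x i - y i) ^ 2 ≤ n * D + β} ≤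
    Real.exp (-((n : ℝ) / 2 * Real.log ((v + D) / D) + Real.sqrt n * b / (2 * (v + D)) -
        (K / (2 * (v + D)) + β / (2 * D)))) := by
  have hv0 : 0 < (v : ℝ) := by positivity
  refine (chern v hv D β x hD).trans ?_
  rw [sqrt_pow_exp v D hD, ← Real.exp_add, ← Real.exp_add, Real.exp_le_exp, ← ip_self]
  have : -(ip x x - n * (v + D)) / (2 * (v + D)) ≤ -(Real.sqrt n * b - K) / (2 * (v + D)) :=
    div_le_div_of_nonneg_right (by linarith) (by positivity)
  have e : -(Real.sqrt n * b - K) / (2 * (v + D)) =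
    K / (2 * (v + D)) - Real.sqrt n * b / (2 * (v + D)) := by ring
  linarith

lemma conv_iid (v : ℝ≥0) (hv : v ≠ 0) (D b K : ℝ) (hD : 0 < D) :
    ∃ C : ℝ, ∃ n0 : ℕ, 3 ≤ n0 ∧ ∀ n : ℕ, n0 ≤ n → ∀ x : Fin n → ℝ,
      n * (v + D) + Real.sqrt n * b - K < ip x x →
    (Measure.pi (fun _ : Fin n => gaussianReal 0 v)).real
      {y | ∑ i, (x i - y i) ^ 2 ≤ n * D} ≤
    Real.exp (-((n : ℝ) / 2 * Real.log ((v + D) / D) + Real.sqrt n * b / (2 * (v + D)) -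
        C * Real.log n)) := by
  refine ⟨|K| / (2 * (v + D)), 3, le_rfl, fun n hn x hx => ?_⟩
  have h := conv_g v hv D b K 0 hD n x hx
  rw [add_zero] at h
  refine h.trans (Real.exp_le_exp.2 ?_)
  have hL := one_le_log hn
  have g2 : K / (2 * (v + D)) ≤ |K| / (2 * (v + D)) :=
    div_le_div_of_nonneg_right (le_abs_self K) (by positivity)
  have g6 := mul_le_mul_of_nonneg_left hL (by positivity : 0 ≤ |K| / (2 * (v + D)))
  rw [zero_div]
  linarith

lemma conv_sp (v : ℝ≥0) (hv : v ≠ 0) (D b K : ℝ) (hD : 0 < D)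
    (ν : ∀ n : ℕ, Measure (Fin n → ℝ)) (hp : ∀ n, IsProbabilityMeasure (ν n))
    (hinv : ∀ (n : ℕ) d, (ν n).map (hh d) = ν n) (hs : ∀ n : ℕ, ∀ᵐ y ∂(ν n), ip y y = n * (v : ℝ)) :
    ∃ C : ℝ, ∃ n0 : ℕ, 3 ≤ n0 ∧ ∀ n : ℕ, n0 ≤ n → ∀ x : Fin n → ℝ,
      n * (v + D) + Real.sqrt n * b - K < ip x x →
    (ν n).real {y | ∑ i, (x i - y i) ^ 2 ≤ n * D} ≤
    Real.exp (-((n : ℝ) / 2 * Real.log ((v + D) / D) + Real.sqrt n * b / (2 * (v + D)) -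
        C * Real.log n)) := by
  have hv0 : 0 < (v : ℝ) := by positivity
  obtain ⟨_, n0, hn0, H1⟩ := qbound v D b (-K) hv0 hD
  obtain ⟨C0, hC0⟩ := shell v hv
  refine ⟨|C0| + 1 + |K| / (2 * (v + D)) + 1 / (2 * D), n0, hn0, fun n hn x hx => ?_⟩
  have hn3 : 3 ≤ n := hn0.trans hn
  have hL := one_le_log hn3
  obtain ⟨hp0, ht0, -⟩ := H1 n hn _ rfl
  have hnpos : (0 : ℝ) < n := by positivity
  have hw0 : 0 < Real.sqrt n := Real.sqrt_pos.2 hnpos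
  have hw2 : Real.sqrt n ^ 2 = n := Real.sq_sqrt hnpos.le
  set w := Real.sqrt (n : ℝ) with hw
  set u := b / w + -K / n with hu
  have hnu : n * u = w * b - K := by
    rw [hu, mul_add]
    have : n * (b / w) = w * b := by rw [← hw2]; field_simp
    rw [this]; field_simp; ring
  have hx0 : 0 < ip x x := by
    have : 0 < n * (v + D + u) := by positivity
    nlinarith
  have hT : 0 ≤ ip x x + n * v - n * D := by
    have : 0 < n * (2 * v + u) := by positivity
    nlinarith
  have hxne : x ≠ 0 := by rintro rfl; simp [ip] at hx0
  set γ := Measure.pi (fun _ : Fin n => gaussianReal 0 v) with hγ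
  set B := {y : Fin n → ℝ | n * (v : ℝ) ≤ ip y y ∧ ip y y ≤ n * v + 1} with hB
  have hBm : MeasurableSet B := (measurableSet_le measurable_const ipp_meas).inter
    (measurableSet_le ipp_meas measurable_const)
  have hκinv : ∀ d, (γ.restrict B).map (hh d) = γ.restrict B := by
    intro d
    ext A hA
    rw [Measure.map_apply (hh_meas d) hA, Measure.restrict_apply (hh_meas d hA),
      Measure.restrict_apply hA, ← hh_equiv_preimage d γ (gauss_inv v hv n d) _ (hA.inter hBm)]
    congr 1
    ext y
    show hh d y ∈ A ∧ (n * (v : ℝ) ≤ ip y y ∧ ip y y ≤ n * v + 1) ↔ hh d y ∈ A ∧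
      (n * (v : ℝ) ≤ ip (hh d y) (hh d y) ∧ ip (hh d y) (hh d y) ≤ n * v + 1)
    rw [hh_ip]
  have hκ0 : (γ.restrict B) {0} = 0 :=
    Measure.restrict_le_self.absolutelyContinuous (gauss_zero v hv n (by omega))
  have := hp n
  have hup := lemS_upper (γ.restrict B) (ν n) hκinv (hinv n) hκ0 (n * v) (by positivity) (hs n)
    (by filter_upwards [ae_restrict_mem hBm] with y hy using hy) x hxne (n * D) hT
  rw [Measure.restrict_apply_univ] at hup
  have hup2 : γ.real B * (ν n).real {y | ∑ i, (x i - y i) ^ 2 ≤ n * D} ≤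
      γ.real {y | ∑ i, (x i - y i) ^ 2 ≤ n * D + 1} := by
    have h3 := hup.trans (Measure.restrict_le_self _)
    rw [measureReal_def, measureReal_def, measureReal_def, ← ENNReal.toReal_mul]
    exact ENNReal.toReal_mono (measure_ne_top _ _) h3
  have hc := conv_g v hv D b K 1 hD n x hx
  have hsh := hC0 n (by omega)
  have h5 : Real.exp (-(C0 + Real.log n)) * (ν n).real {y | ∑ i, (x i - y i) ^ 2 ≤ n * D} ≤
      Real.exp (-((n : ℝ) / 2 * Real.log ((v + D) / D) + w * b / (2 * (v + D)) -
        (K / (2 * (v + D)) + 1 / (2 * D)))) :=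
    (mul_le_mul_of_nonneg_right hsh measureReal_nonneg).trans (hup2.trans hc)
  rw [mul_comm, ← le_div_iff₀ (Real.exp_pos _), ← Real.exp_sub] at h5
  refine h5.trans (Real.exp_le_exp.2 ?_)
  have g2 : K / (2 * (v + D)) ≤ |K| / (2 * (v + D)) :=
    div_le_div_of_nonneg_right (le_abs_self K) (by positivity)
  have g4 := le_abs_self C0
  have g6 := mul_le_mul_of_nonneg_left hL
    (by positivity : 0 ≤ |C0| + |K| / (2 * (v + D)) + 1 / (2 * D))
  linarith

end MSO

namespace MSO

lemma F_meas {n : ℕ} (ν : Measure (Fin n → ℝ)) [IsProbabilityMeasure ν] (D : ℝ) :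
    Measurable fun x : Fin n → ℝ => (ν {y | (∑ i, (x i - y i) ^ 2) / n ≤ D}).toReal := by
  have hm : MeasurableSet {q : (Fin n → ℝ) × (Fin n → ℝ) | (∑ i, (q.1 i - q.2 i) ^ 2) / n ≤ D} :=
    measurableSet_le (by fun_prop) measurable_const
  exact (measurable_measure_prodMk_left hm).ennreal_toReal

lemma F_nonneg {n : ℕ} (ν : Measure (Fin n → ℝ)) (D : ℝ) (x : Fin n → ℝ) :
    0 ≤ (ν {y | (∑ i, (x i - y i) ^ 2) / n ≤ D}).toReal := ENNReal.toReal_nonneg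

lemma F_le_one {n : ℕ} (ν : Measure (Fin n → ℝ)) [IsProbabilityMeasure ν] (D : ℝ)
    (x : Fin n → ℝ) : (ν {y | (∑ i, (x i - y i) ^ 2) / n ≤ D}).toReal ≤ 1 :=
  ENNReal.toReal_le_of_le_ofReal zero_le_one (by simpa using prob_le_one)

lemma F_int {n : ℕ} (μ ν : Measure (Fin n → ℝ)) [IsProbabilityMeasure μ] [IsProbabilityMeasure ν]
    (D : ℝ) (M : ℕ) :
    Integrable (fun x => (1 - (ν {y | (∑ i, (x i - y i) ^ 2) / n ≤ D}).toReal) ^ M) μ := by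
  have := F_meas ν D
  refine (integrable_const (1 : ℝ)).mono' ((measurable_const.sub (F_meas ν D)).pow_const M).aestronglyMeasurable (Filter.Eventually.of_forall fun x => ?_)
  have h1 := F_nonneg ν D x
  have h2 := F_le_one ν D x
  rw [Real.norm_eq_abs, abs_of_nonneg (pow_nonneg (by linarith) _)]
  exact pow_le_one₀ (by linarith) (by linarith)

lemma achM {n : ℕ} (μ ν : Measure (Fin n → ℝ)) [IsProbabilityMeasure μ] [IsProbabilityMeasure ν]
    (D Ψ : ℝ) (M : ℕ) (G : Set (Fin n → ℝ)) (hG : MeasurableSet G)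
    (h : ∀ x ∈ G, Ψ ≤ (ν {y | (∑ i, (x i - y i) ^ 2) / n ≤ D}).toReal) :
    PeEnsemble μ ν D M ≤ μ.real Gᶜ + Real.exp (-(M * Ψ)) := by
  have hI : Integrable (Gᶜ.indicator (fun _ => (1 : ℝ))) μ :=
    (integrable_const _).indicator hG.compl
  have hle : PeEnsemble μ ν D M ≤
      ∫ x, (Gᶜ.indicator (fun _ => (1 : ℝ)) x + Real.exp (-(M * Ψ))) ∂μ := by
    refine integral_mono (F_int μ ν D M) (hI.add (integrable_const _)) fun x => ?_
    show (1 - (ν {y | (∑ i, (x i - y i) ^ 2) / n ≤ D}).toReal) ^ M ≤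
      Gᶜ.indicator (fun _ => (1 : ℝ)) x + Real.exp (-(M * Ψ))
    have h1 := F_nonneg ν D x
    have h2 := F_le_one ν D x
    by_cases hx : x ∈ G
    · have h3 := h x hx
      set f := (ν {y | (∑ i, (x i - y i) ^ 2) / n ≤ D}).toReal
      have e : Gᶜ.indicator (fun _ => (1 : ℝ)) x = 0 := Set.indicator_of_notMem (by simpa using hx) _
      rw [e, zero_add]
      calc (1 - f) ^ M ≤ (Real.exp (-Ψ)) ^ M := by
            refine pow_le_pow_left₀ (by linarith) ?_ M
            have := Real.add_one_le_exp (-Ψ)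
            linarith
        _ = Real.exp (-(M * Ψ)) := by rw [← Real.exp_nat_mul]; congr 1; ring
    · have e : Gᶜ.indicator (fun _ => (1 : ℝ)) x = 1 := Set.indicator_of_mem (by simpa using hx) _
      rw [e]
      have : (1 - (ν {y | (∑ i, (x i - y i) ^ 2) / n ≤ D}).toReal) ^ M ≤ 1 :=
        pow_le_one₀ (by linarith) (by linarith)
      linarith [Real.exp_pos (-(M * Ψ))]
  refine hle.trans (le_of_eq ?_)
  rw [integral_add hI (integrable_const _), integral_indicator hG.compl]
  simp [measureReal_def]

lemma convM {n : ℕ} (μ ν : Measure (Fin n → ℝ)) [IsProbabilityMeasure μ] [IsProbabilityMeasure ν]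
    (D Ψ : ℝ) (M : ℕ) (G : Set (Fin n → ℝ)) (hG : MeasurableSet G)
    (h : ∀ x ∈ G, (ν {y | (∑ i, (x i - y i) ^ 2) / n ≤ D}).toReal ≤ Ψ) :
    μ.real G * (1 - M * Ψ) ≤ PeEnsemble μ ν D M := by
  have hI : Integrable (G.indicator (fun _ => (1 - M * Ψ : ℝ))) μ :=
    (integrable_const _).indicator hG
  have hle : ∫ x, G.indicator (fun _ => (1 - M * Ψ : ℝ)) x ∂μ ≤ PeEnsemble μ ν D M := by
    refine integral_mono hI (F_int μ ν D M) fun x => ?_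
    show G.indicator (fun _ => (1 - M * Ψ : ℝ)) x ≤
      (1 - (ν {y | (∑ i, (x i - y i) ^ 2) / n ≤ D}).toReal) ^ M
    have h1 := F_nonneg ν D x
    have h2 := F_le_one ν D x
    by_cases hx : x ∈ G
    · have h3 := h x hx
      rw [Set.indicator_of_mem hx]
      have h4 := one_add_mul_le_pow (a := -(ν {y | (∑ i, (x i - y i) ^ 2) / n ≤ D}).toReal)
        (by linarith) M
      have h5 : (M : ℝ) * (ν {y | (∑ i, (x i - y i) ^ 2) / n ≤ D}).toReal ≤ M * Ψ :=
        mul_le_mul_of_nonneg_left h3 (by positivity)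
      rw [← sub_eq_add_neg] at h4
      linarith
    · rw [Set.indicator_of_notMem hx]
      exact pow_nonneg (by linarith) _
  refine le_trans (le_of_eq ?_) hle
  rw [integral_indicator hG]
  simp [measureReal_def]

lemma set_eq_div {n : ℕ} (hn : 1 ≤ n) (ν : Measure (Fin n → ℝ)) (D : ℝ) (x : Fin n → ℝ) :
    (ν {y | (∑ i, (x i - y i) ^ 2) / n ≤ D}).toReal = ν.real {y | ∑ i, (x i - y i) ^ 2 ≤ n * D} := by
  rw [measureReal_def]
  congr 2
  ext y
  show (∑ i, (x i - y i) ^ 2) / n ≤ D ↔ ∑ i, (x i - y i) ^ 2 ≤ n * D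
  rw [div_le_iff₀ (by positivity), mul_comm]

end MSO

namespace MSO

lemma inv_n_le {n : ℕ} (hn : 3 ≤ n) : 1 / (n : ℝ) ≤ 1 / Real.sqrt n := by
  have h1 : (1 : ℝ) ≤ n := by exact_mod_cast (by omega : 1 ≤ n)
  have h2 : 0 < Real.sqrt n := Real.sqrt_pos.2 (by linarith)
  refine one_div_le_one_div_of_le h2 ?_
  rw [Real.sqrt_le_left (by linarith)]
  nlinarith

lemma step_ach {n : ℕ} (hn : 3 ≤ n) (μ ν : Measure (Fin n → ℝ)) [IsProbabilityMeasure μ]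
    [IsProbabilityMeasure ν] (D ε E : ℝ) (hE : 0 ≤ E) (G : Set (Fin n → ℝ)) (hG : MeasurableSet G)
    (hGm : μ.real Gᶜ ≤ ε - 1 / Real.sqrt n)
    (h : ∀ x ∈ G, Real.exp (-E) ≤ (ν {y | (∑ i, (x i - y i) ^ 2) / n ≤ D}).toReal) :
    0 < MstarEns μ ν D ε ∧ PeEnsemble μ ν D (MstarEns μ ν D ε) ≤ ε ∧
      Real.log (MstarEns μ ν D ε) ≤ E + 2 * Real.log n := by
  have hL := one_le_log hn
  have hnr : (3 : ℝ) ≤ n := by exact_mod_cast hn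
  have hE1 : 1 ≤ Real.exp E := Real.one_le_exp hE
  set M := ⌈Real.log n * Real.exp E⌉₊ with hM
  have hMl : Real.log n * Real.exp E ≤ M := Nat.le_ceil _
  have hpos : 1 ≤ Real.log n * Real.exp E := by nlinarith
  have hM0 : 0 < M := by
    have : (0 : ℝ) < M := by linarith
    exact_mod_cast this
  have hPe : PeEnsemble μ ν D M ≤ ε := by
    have h1 := achM μ ν D (Real.exp (-E)) M G hG h
    have h2 : Real.log n ≤ M * Real.exp (-E) := by
      have := mul_le_mul_of_nonneg_right hMl (Real.exp_pos (-E)).le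
      rwa [mul_assoc, ← Real.exp_add, add_neg_cancel, Real.exp_zero, mul_one] at this
    have h3 : Real.exp (-(M * Real.exp (-E))) ≤ 1 / (n : ℝ) := by
      calc Real.exp (-(M * Real.exp (-E))) ≤ Real.exp (-Real.log n) :=
            Real.exp_le_exp.2 (by linarith)
        _ = 1 / (n : ℝ) := by rw [Real.exp_neg, Real.exp_log (by linarith), one_div]
    have h4 := inv_n_le hn
    linarith
  have hmem : M ∈ {M : ℕ | 0 < M ∧ PeEnsemble μ ν D M ≤ ε} := ⟨hM0, hPe⟩
  have hs : 0 < MstarEns μ ν D ε ∧ PeEnsemble μ ν D (MstarEns μ ν D ε) ≤ ε := Nat.sInf_mem ⟨M, hmem⟩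
  refine ⟨hs.1, hs.2, ?_⟩
  have hle : MstarEns μ ν D ε ≤ M := Nat.sInf_le hmem
  have hle' : (MstarEns μ ν D ε : ℝ) ≤ n ^ 2 * Real.exp E := by
    have h1 : (MstarEns μ ν D ε : ℝ) ≤ M := by exact_mod_cast hle
    have h2 : (M : ℝ) < Real.log n * Real.exp E + 1 := Nat.ceil_lt_add_one (by linarith)
    have h3 : Real.log n ≤ n := (Real.log_le_sub_one_of_pos (by linarith)).trans (by linarith)
    have h4 : Real.log n * Real.exp E ≤ n * Real.exp E :=
      mul_le_mul_of_nonneg_right h3 (Real.exp_pos E).le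
    have h5 : ((n : ℝ) + 1) * Real.exp E ≤ n ^ 2 * Real.exp E :=
      mul_le_mul_of_nonneg_right (by nlinarith) (Real.exp_pos E).le
    linarith
  have h5 := Real.log_le_log (by exact_mod_cast hs.1) hle'
  rw [Real.log_mul (by positivity) (Real.exp_pos _).ne', Real.log_exp, Real.log_pow] at h5
  push_cast at h5
  linarith

lemma step_conv {n : ℕ} (hn : 3 ≤ n) (μ ν : Measure (Fin n → ℝ)) [IsProbabilityMeasure μ]
    [IsProbabilityMeasure ν] (D ε E : ℝ) (M : ℕ) (hM : 0 < M) (hP : PeEnsemble μ ν D M ≤ ε)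
    (G : Set (Fin n → ℝ)) (hG : MeasurableSet G)
    (hGm : ε + 1 / Real.sqrt n ≤ μ.real G)
    (h : ∀ x ∈ G, (ν {y | (∑ i, (x i - y i) ^ 2) / n ≤ D}).toReal ≤ Real.exp (-E)) :
    E - Real.log n ≤ Real.log M := by
  have hnr : (3 : ℝ) ≤ n := by exact_mod_cast hn
  have h1 := convM μ ν D (Real.exp (-E)) M G hG h
  have h4 := inv_n_le hn
  have hMr : (0 : ℝ) < M := by exact_mod_cast hM
  have h0 : 0 < M * Real.exp (-E) := by positivity
  have hg1 : μ.real G ≤ 1 := measureReal_le_one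
  have h5 : 1 / (n : ℝ) ≤ M * Real.exp (-E) := by nlinarith
  have h6 := Real.log_le_log (by positivity) h5
  rw [Real.log_mul hMr.ne' (Real.exp_pos _).ne', Real.log_exp, one_div, Real.log_inv] at h6
  linarith

lemma final (P : Measure ℝ) [IsProbabilityMeasure P] (σ2 ζ D : ℝ)
    (hmom : Integrable (fun x => x ^ 6) P)
    (h2 : (∫ x, x ^ 2 ∂P) = σ2) (h4 : (∫ x, x ^ 4 ∂P) = ζ)
    (hD0 : 0 < D) (hDσ : D < σ2)
    (ν : ∀ n : ℕ, Measure (Fin n → ℝ)) (hp : ∀ n, IsProbabilityMeasure (ν n))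
    (ε : ℝ) (hε : ε ∈ Set.Ioo (0 : ℝ) 1) (z : ℝ) (hz : gaussQ z = ε) (δ : ℝ) (hδ : 0 < δ)
    (hach : ∀ b K : ℝ, ∃ C : ℝ, ∃ n0 : ℕ, 3 ≤ n0 ∧ ∀ n : ℕ, n0 ≤ n → ∀ x : Fin n → ℝ,
      n * (σ2 - δ) ≤ ip x x → ip x x ≤ n * σ2 + Real.sqrt n * b + K →
      Real.exp (-((n : ℝ) / 2 * Real.log (σ2 / D) + Real.sqrt n * b / (2 * σ2) +
        C * Real.log n)) ≤ (ν n).real {y | ∑ i, (x i - y i) ^ 2 ≤ n * D})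
    (hconv : ∀ b K : ℝ, ∃ C : ℝ, ∃ n0 : ℕ, 3 ≤ n0 ∧ ∀ n : ℕ, n0 ≤ n → ∀ x : Fin n → ℝ,
      n * σ2 + Real.sqrt n * b - K < ip x x →
      (ν n).real {y | ∑ i, (x i - y i) ^ 2 ≤ n * D} ≤
      Real.exp (-((n : ℝ) / 2 * Real.log (σ2 / D) + Real.sqrt n * b / (2 * σ2) -
        C * Real.log n))) :
    ∃ C > (0 : ℝ), ∃ n₀ : ℕ, ∀ n ≥ n₀,
      |Real.log (MstarEns (Measure.pi fun _ : Fin n => P) (ν n) D ε)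
          - ((n / 2) * Real.log (σ2 / D)
              + Real.sqrt (n * ((ζ - σ2 ^ 2) / (4 * σ2 ^ 2))) * z)| ≤
        C * Real.log n := by
  have hσ : 0 < σ2 := hD0.trans hDσ
  obtain ⟨K, hK0, m1, hm1, Hq⟩ := quantile P σ2 ζ hmom h2 h4 ε hε z hz 2 two_pos
  set b := Real.sqrt (ζ - σ2 ^ 2) * z with hb
  obtain ⟨C1, m2, hm2, Ha⟩ := hach b K
  obtain ⟨C2, m3, hm3, Hc⟩ := hconv b K
  have hlog : 0 < Real.log (σ2 / D) := Real.log_pos (by rw [lt_div_iff₀ hD0]; linarith)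
  obtain ⟨m4, hm4, H4⟩ := exists_sqrt_bound (|b| / (σ2 * Real.log (σ2 / D)))
  obtain ⟨m5, hm5, H5⟩ := exists_sqrt_bound ((ζ - σ2 ^ 2) / δ ^ 2)
  refine ⟨|C1| + |C2| + 2, by positivity, m1 + m2 + m3 + m4 + m5, fun n hn => ?_⟩
  have hn3 : 3 ≤ n := by omega
  have hnr : (3 : ℝ) ≤ n := by exact_mod_cast hn3
  have hL := one_le_log hn3
  have hs0 : 0 < Real.sqrt n := Real.sqrt_pos.2 (by linarith)
  have hss : Real.sqrt n * Real.sqrt n = n := Real.mul_self_sqrt (by linarith)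
  obtain ⟨q1, q2⟩ := Hq n (by omega)
  have hsq : Real.sqrt (n * ((ζ - σ2 ^ 2) / (4 * σ2 ^ 2))) * z = Real.sqrt n * b / (2 * σ2) := by
    rw [Real.sqrt_mul (by positivity), Real.sqrt_div' _ (by positivity),
      show 4 * σ2 ^ 2 = (2 * σ2) ^ 2 by ring, Real.sqrt_sq (by positivity), hb]
    ring
  rw [hsq]
  set R := (n : ℝ) / 2 * Real.log (σ2 / D) + Real.sqrt n * b / (2 * σ2) with hR
  have hR0 : 0 ≤ R := by
    have h := H4 n (by omega)
    rw [div_le_iff₀ (by positivity)] at h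
    have h' : 0 ≤ Real.sqrt n * (Real.sqrt n * (σ2 * Real.log (σ2 / D)) + b) :=
      mul_nonneg hs0.le (by linarith [neg_abs_le b])
    have : R = Real.sqrt n * (Real.sqrt n * (σ2 * Real.log (σ2 / D)) + b) / (2 * σ2) := by
      rw [hR, ← hss]; simp only [Real.sqrt_mul_self hs0.le]; field_simp
    rw [this]; positivity
  have hmS : Measurable fun x : Fin n → ℝ => ∑ j, x j ^ 2 := by fun_prop
  haveI := hp n
  -- achievability
  have hGm : MeasurableSet {x : Fin n → ℝ | n * (σ2 - δ) ≤ ∑ j, x j ^ 2 ∧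
      ∑ j, x j ^ 2 ≤ n * σ2 + Real.sqrt n * Real.sqrt (ζ - σ2 ^ 2) * z + K} :=
    (measurableSet_le measurable_const hmS).inter (measurableSet_le hmS measurable_const)
  have hGc : (Measure.pi fun _ : Fin n => P).real {x : Fin n → ℝ | n * (σ2 - δ) ≤ ∑ j, x j ^ 2 ∧
      ∑ j, x j ^ 2 ≤ n * σ2 + Real.sqrt n * Real.sqrt (ζ - σ2 ^ 2) * z + K}ᶜ ≤
      ε - 1 / Real.sqrt n := by
    have c1 := cheb P σ2 ζ hmom h2 h4 δ hδ n (by omega)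
    have c2 : (ζ - σ2 ^ 2) / δ ^ 2 / n ≤ 1 / Real.sqrt n := by
      rw [div_le_div_iff₀ (by linarith) hs0, one_mul]
      calc _ ≤ Real.sqrt n * Real.sqrt n := mul_le_mul_of_nonneg_right (H5 n (by omega)) hs0.le
        _ = n := hss
    have hsub : {x : Fin n → ℝ | n * (σ2 - δ) ≤ ∑ j, x j ^ 2 ∧
      ∑ j, x j ^ 2 ≤ n * σ2 + Real.sqrt n * Real.sqrt (ζ - σ2 ^ 2) * z + K}ᶜ ⊆
        {x | ∑ j, x j ^ 2 < n * (σ2 - δ)} ∪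
        {x | n * σ2 + Real.sqrt n * Real.sqrt (ζ - σ2 ^ 2) * z + K < ∑ j, x j ^ 2} := by
      intro x hx
      by_contra hcon
      apply hx
      constructor
      · by_contra hh'
        exact hcon (Or.inl (not_le.1 hh'))
      · by_contra hh'
        exact hcon (Or.inr (not_le.1 hh'))
    have c3 := (measureReal_mono (μ := Measure.pi fun _ : Fin n => P) hsub).trans
      (measureReal_union_le _ _)
    have c4 : 2 / Real.sqrt n = 1 / Real.sqrt n + 1 / Real.sqrt n := by ring
    linarith
  obtain ⟨a1, a2, a3⟩ := step_ach hn3 (Measure.pi fun _ : Fin n => P) (ν n) D ε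
    (R + |C1| * Real.log n) (by positivity) _ hGm hGc (by
      rintro x ⟨hx1, hx2⟩
      rw [set_eq_div (by omega)]
      rw [← ip_self] at hx1 hx2
      refine le_trans (Real.exp_le_exp.2 ?_) (Ha n (by omega) x hx1 (by rw [hb]; linarith))
      have := mul_le_mul_of_nonneg_right (le_abs_self C1) (by linarith : 0 ≤ Real.log n)
      linarith)
  have a4 := step_conv hn3 (Measure.pi fun _ : Fin n => P) (ν n) D ε
    (R - |C2| * Real.log n) _ a1 a2
    {x | n * σ2 + Real.sqrt n * Real.sqrt (ζ - σ2 ^ 2) * z - K < ∑ j, x j ^ 2}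
    (measurableSet_lt measurable_const hmS) (by
      refine le_trans ?_ q2
      have : 1 / Real.sqrt n ≤ 2 / Real.sqrt n :=
        div_le_div_of_nonneg_right (by norm_num) hs0.le
      linarith) (by
      intro x hx1
      have hx2 : n * σ2 + Real.sqrt n * Real.sqrt (ζ - σ2 ^ 2) * z - K < ∑ j, x j ^ 2 := hx1
      rw [set_eq_div (by omega)]
      rw [← ip_self] at hx2
      refine le_trans (Hc n (by omega) x (by rw [hb]; linarith)) (Real.exp_le_exp.2 ?_)
      have := mul_le_mul_of_nonneg_right (le_abs_self C2) (by linarith : 0 ≤ Real.log n)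
      linarith)
  have p1 : 0 ≤ |C1| * Real.log n := by positivity
  have p2 : 0 ≤ |C2| * Real.log n := by positivity
  rw [abs_le]
  constructor <;> nlinarith

lemma ach_iid (v : ℝ≥0) (hv : v ≠ 0) (D b K : ℝ) (hD : 0 < D) :
    ∃ C : ℝ, ∃ n0 : ℕ, 3 ≤ n0 ∧ ∀ n : ℕ, n0 ≤ n → ∀ x : Fin n → ℝ,
      n * (v + D - min D v) ≤ ip x x → ip x x ≤ n * (v + D) + Real.sqrt n * b + K →
      Real.exp (-((n : ℝ) / 2 * Real.log ((v + D) / D) + Real.sqrt n * b / (2 * (v + D)) +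
        C * Real.log n)) ≤
      (Measure.pi (fun _ : Fin n => gaussianReal 0 v)).real
        {y | ∑ i, (x i - y i) ^ 2 ≤ n * D} := by
  obtain ⟨C, n0, hn0, H⟩ := ach_cap v hv D b K hD
  refine ⟨C, n0, hn0, fun n hn x hx1 hx2 => (H n hn x ?_ hx2).trans ?_⟩
  · refine le_trans (mul_le_mul_of_nonneg_left ?_ (by positivity)) hx1
    linarith [min_le_left D (v : ℝ)]
  · refine measureReal_mono ?_
    rintro g ⟨hg1, hg2⟩
    show ∑ i, (x i - g i) ^ 2 ≤ n * D
    rw [sum_sub_sq]; linarith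

lemma ach_sp (v : ℝ≥0) (hv : v ≠ 0) (D b K : ℝ) (hD : 0 < D)
    (ν : ∀ n : ℕ, Measure (Fin n → ℝ)) (hp : ∀ n, IsProbabilityMeasure (ν n))
    (hinv : ∀ (n : ℕ) d, (ν n).map (hh d) = ν n)
    (hs : ∀ n : ℕ, ∀ᵐ y ∂(ν n), ip y y = n * (v : ℝ)) :
    ∃ C : ℝ, ∃ n0 : ℕ, 3 ≤ n0 ∧ ∀ n : ℕ, n0 ≤ n → ∀ x : Fin n → ℝ,
      n * (v + D - min D v) ≤ ip x x → ip x x ≤ n * (v + D) + Real.sqrt n * b + K →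
      Real.exp (-((n : ℝ) / 2 * Real.log ((v + D) / D) + Real.sqrt n * b / (2 * (v + D)) +
        C * Real.log n)) ≤
      (ν n).real {y | ∑ i, (x i - y i) ^ 2 ≤ n * D} := by
  have hv0 : 0 < (v : ℝ) := by positivity
  obtain ⟨C, n0, hn0, H⟩ := ach_cap v hv D b K hD
  refine ⟨C, n0, hn0, fun n hn x hx1 hx2 => ?_⟩
  have hn0' : (0 : ℝ) < n := by exact_mod_cast (by omega : 0 < n)
  have e1 : n * (v : ℝ) ≤ ip x x := by
    refine le_trans (mul_le_mul_of_nonneg_left ?_ (by positivity)) hx1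
    linarith [min_le_left D (v : ℝ)]
  have e2 : n * D ≤ ip x x := by
    refine le_trans (mul_le_mul_of_nonneg_left ?_ (by positivity)) hx1
    linarith [min_le_right D (v : ℝ)]
  have e3 : 0 < n * (v : ℝ) := by positivity
  refine (H n hn x e1 hx2).trans ?_
  haveI := hp n
  have hx0 : x ≠ 0 := by
    intro h
    have := (ip_self_eq_zero x).2 h
    linarith
  exact ENNReal.toReal_mono (measure_ne_top _ _)
    (lemS_lower _ (ν n) (gauss_inv v hv n) (hinv n) (gauss_zero v hv n (by omega)) (n * v)
      e3 (hs n) x hx0 (n * D) (by linarith))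

end MSO

/-- **Ensemble-tight second-order asymptotics for mismatched compression with Gaussian
codebooks.**  For any real memoryless source with `E[X²]=σ²`, `ζ = E[X⁴] < ∞`,
`E[X⁶] < ∞` and any `D ∈ (0,σ²)`, both the spherical codebook (`νsp`: the uniform,
i.e. rotation-invariant, probability measure on the sphere of radius `√(n(σ²−D))`) and
the i.i.d. Gaussian codebook (`νiid`) satisfy
`log M*(n,ε,σ²,D) = (n/2) log(σ²/D) + √(n V(σ²,ζ)) Q⁻¹(ε) + O(log n)`,
where `V(σ²,ζ) = (ζ − σ⁴)/(4σ⁴)` and `Q(z) = ε`. -/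
theorem mismatched_second_order
    (P : Measure ℝ) [IsProbabilityMeasure P]
    (σ2 ζ D : ℝ)
    (hmom : Integrable (fun x => x ^ 6) P)
    (h2 : (∫ x, x ^ 2 ∂P) = σ2) (h4 : (∫ x, x ^ 4 ∂P) = ζ)
    (hD0 : 0 < D) (hDσ : D < σ2)
    (νsp : ∀ n : ℕ, Measure (Fin n → ℝ))
    (hsp_prob : ∀ n, IsProbabilityMeasure (νsp n))
    (hsp_sphere : ∀ n, νsp n {y | ∑ i, (y i) ^ 2 = n * (σ2 - D)} = 1)
    (hsp_inv : ∀ (n : ℕ) (L : (Fin n → ℝ) →ₗ[ℝ] (Fin n → ℝ)),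
      (∀ y, ∑ i, (L y) i ^ 2 = ∑ i, (y i) ^ 2) → (νsp n).map L = νsp n)
    (νiid : ∀ n : ℕ, Measure (Fin n → ℝ))
    (hiid : ∀ n, νiid n = Measure.pi (fun _ : Fin n => gaussianReal 0 (σ2 - D).toNNReal))
    (ε : ℝ) (hε : ε ∈ Set.Ioo (0 : ℝ) 1) (z : ℝ) (hz : gaussQ z = ε) :
    (∃ C > (0 : ℝ), ∃ n₀ : ℕ, ∀ n ≥ n₀,
      |Real.log (MstarEns (Measure.pi fun _ : Fin n => P) (νsp n) D ε)
          - ((n / 2) * Real.log (σ2 / D)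
              + Real.sqrt (n * ((ζ - σ2 ^ 2) / (4 * σ2 ^ 2))) * z)| ≤
        C * Real.log n) ∧
    (∃ C > (0 : ℝ), ∃ n₀ : ℕ, ∀ n ≥ n₀,
      |Real.log (MstarEns (Measure.pi fun _ : Fin n => P) (νiid n) D ε)
          - ((n / 2) * Real.log (σ2 / D)
              + Real.sqrt (n * ((ζ - σ2 ^ 2) / (4 * σ2 ^ 2))) * z)| ≤
        C * Real.log n) := by
  obtain ⟨v, hvdef⟩ : ∃ v : ℝ≥0, v = (σ2 - D).toNNReal := ⟨_, rfl⟩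
  have hvr : (v : ℝ) = σ2 - D := by rw [hvdef, Real.coe_toNNReal _ (by linarith)]
  have hv : v ≠ 0 := by
    intro h
    rw [h] at hvr
    simp at hvr
    linarith
  have hσ : σ2 = v + D := by linarith
  have hδ : 0 < min D (v : ℝ) := lt_min hD0 (by rw [hvr]; linarith)
  constructor
  · have hinv : ∀ (n : ℕ) d, (νsp n).map (MSO.hh d) = νsp n :=
      fun n d => hsp_inv n (MSO.hh d) (MSO.hh_norm d)
    have hs : ∀ n : ℕ, ∀ᵐ y ∂(νsp n), MSO.ip y y = n * (v : ℝ) := by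
      intro n
      haveI := hsp_prob n
      have hmS : Measurable fun x : Fin n → ℝ => ∑ j, x j ^ 2 := by fun_prop
      have hm : MeasurableSet {y : Fin n → ℝ | ∑ i, (y i) ^ 2 = n * (σ2 - D)} :=
        measurableSet_eq_fun hmS measurable_const
      have := (mem_ae_iff_prob_eq_one hm).2 (hsp_sphere n)
      filter_upwards [this] with y hy
      have hy' : ∑ i, (y i) ^ 2 = n * (σ2 - D) := hy
      rw [MSO.ip_self, hy', hvr]
    refine MSO.final P σ2 ζ D hmom h2 h4 hD0 hDσ νsp hsp_prob ε hε z hz _ hδ ?_ ?_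
    · intro b K
      rw [hσ]
      exact MSO.ach_sp v hv D b K hD0 νsp hsp_prob hinv hs
    · intro b K
      rw [hσ]
      exact MSO.conv_sp v hv D b K hD0 νsp hsp_prob hinv hs
  · rw [← hvdef] at hiid
    obtain rfl : νiid = fun n => Measure.pi (fun _ : Fin n => gaussianReal 0 v) := funext hiid
    refine MSO.final P σ2 ζ D hmom h2 h4 hD0 hDσ _ (fun n => inferInstance) ε hε z hz _ hδ ?_ ?_
    · intro b K
      rw [hσ]
      exact MSO.ach_iid v hv D b K hD0
    · intro b K
      rw [hσ]
      exact MSO.conv_iid v hv D b K hD0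

end
end

section
/- Expectation of the ε-cutoff of an i.i.d. sum: let Y_1,…,Y_n be i.i.d. real random variables with Var[Y_1] > 0 and E[|Y_1 − E[Y_1]|³] < ∞. For every ε ∈ (0,1), E[ ⟨ ∑_{i=1}^n Y_i ⟩_ε ] = (1−ε) n E[Y_1] − √(n Var[Y_1]/(2π)) exp(−(Q^{-1}(ε))²/2) + O(1) as n → ∞. -/
/-!
Expectation of the `ε`-cutoff of an i.i.d. sum
(Kostina–Polyanskiy–Verdú, Lemma `clt4cutoff`).
-/

open scoped BigOperators
open MeasureTheory

noncomputable section

open Filter Topology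

/-- moments of the tilted half Gaussian -/
def Lk (k : ℕ) (x : ℝ) : ℝ := ∫ s in Set.Ioi (0:ℝ), s ^ k * Real.exp (x * s - s ^ 2 / 2)

def gphi (x : ℝ) : ℝ := Real.exp (-x ^ 2 / 2) / Real.sqrt (2 * Real.pi)

lemma Lk_int (k : ℕ) (x : ℝ) :
    IntegrableOn (fun s : ℝ => s ^ k * Real.exp (x * s - s ^ 2 / 2)) (Set.Ioi (0:ℝ)) := by
  have h := integrableOn_rpow_mul_exp_neg_mul_sq (b := 1/4) (by norm_num) (s := (k:ℝ))
    (by have : (0:ℝ) ≤ k := Nat.cast_nonneg k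
        linarith)
  have h2 := h.const_mul (Real.exp (x ^ 2))
  refine Integrable.mono' h2 (by fun_prop) ?_
  refine (ae_restrict_iff' measurableSet_Ioi).2 (ae_of_all _ fun s hs => ?_)
  have hs' : 0 < s := hs
  rw [Real.norm_of_nonneg (by positivity), Real.rpow_natCast, mul_left_comm, ← Real.exp_add]
  gcongr
  nlinarith [sq_nonneg (x - s / 2)]

lemma Lk_nonneg (k : ℕ) (x : ℝ) : 0 ≤ Lk k x := by
  refine setIntegral_nonneg measurableSet_Ioi fun s hs => ?_
  have hs' : 0 < s := hs
  positivity

lemma Lk_mono (k : ℕ) : Monotone (Lk k) := by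
  intro x y hxy
  refine setIntegral_mono_on (Lk_int k x) (Lk_int k y) measurableSet_Ioi fun s hs => ?_
  have hs' : 0 < s := hs
  gcongr

lemma Lk_deriv (k : ℕ) (x : ℝ) : HasDerivAt (Lk k) (Lk (k+1) x) x := by
  have := (hasDerivAt_integral_of_dominated_loc_of_deriv_le (𝕜 := ℝ)
    (μ := volume.restrict (Set.Ioi (0:ℝ)))
    (F := fun x s => s ^ k * Real.exp (x * s - s ^ 2 / 2))
    (F' := fun x s => s ^ (k+1) * Real.exp (x * s - s ^ 2 / 2))
    (bound := fun s => s ^ (k+1) * Real.exp ((x + 1) * s - s ^ 2 / 2))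
    (x₀ := x) (s := Set.Iio (x+1)) (Iio_mem_nhds (by linarith))
    (Eventually.of_forall fun y => (Lk_int k y).aestronglyMeasurable)
    (Lk_int k x) (Lk_int (k+1) x).aestronglyMeasurable ?_ (Lk_int (k+1) (x+1)) ?_).2
  · exact this
  · refine (ae_restrict_iff' measurableSet_Ioi).2 (ae_of_all _ fun s hs y hy => ?_)
    have hs' : 0 < s := hs
    have hy' : y < x + 1 := hy
    rw [Real.norm_of_nonneg (by positivity)]
    gcongr
  · refine ae_of_all _ fun s y hy => ?_
    have h1 : HasDerivAt (fun y : ℝ => y * s - s ^ 2 / 2) s y := by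
      simpa using ((hasDerivAt_id y).mul_const s).sub_const (s ^ 2 / 2)
    refine (h1.exp.const_mul (s ^ k)).congr_deriv ?_
    ring

lemma L1_eq (x : ℝ) : Lk 1 x = 1 + x * Lk 0 x := by
  have hd : ∀ s ∈ Set.Ici (0:ℝ), HasDerivAt (fun s : ℝ => -Real.exp (x * s - s ^ 2 / 2))
      (s ^ 1 * Real.exp (x * s - s ^ 2 / 2) - x * (s ^ 0 * Real.exp (x * s - s ^ 2 / 2))) s := by
    intro s _
    have h1 : HasDerivAt (fun s : ℝ => x * s - s ^ 2 / 2) (x - s) s := by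
      refine HasDerivAt.congr_deriv (((hasDerivAt_id s).const_mul x).sub (((hasDerivAt_id s).pow 2).div_const 2)) ?_
      simp
    refine HasDerivAt.congr_deriv (h1.exp.neg) ?_
    ring
  have hi : IntegrableOn (fun s : ℝ => s ^ 1 * Real.exp (x * s - s ^ 2 / 2) -
      x * (s ^ 0 * Real.exp (x * s - s ^ 2 / 2))) (Set.Ioi 0) :=
    (Lk_int 1 x).sub ((Lk_int 0 x).const_mul x)
  have ht : Tendsto (fun s : ℝ => -Real.exp (x * s - s ^ 2 / 2)) atTop (𝓝 0) := by
    rw [← neg_zero]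
    refine Tendsto.neg (Real.tendsto_exp_atBot.comp ?_)
    refine tendsto_atBot_mono' _ ?_ (tendsto_atBot_add_const_left atTop (x * x + x + 1) tendsto_neg_atTop_atBot)
    filter_upwards with s
    nlinarith [sq_nonneg (x + 1 - s), sq_nonneg x]
  have h := integral_Ioi_of_hasDerivAt_of_tendsto' hd hi ht
  rw [integral_sub (Lk_int 1 x) ((Lk_int 0 x).const_mul x), integral_const_mul] at h
  change Lk 1 x - x * Lk 0 x = _ at h
  simp at h
  linarith

lemma gphi_pos (x : ℝ) : 0 < gphi x := by unfold gphi; positivity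

lemma gphi_le (x : ℝ) : gphi x ≤ 1 := by
  unfold gphi
  rw [div_le_one (by positivity)]
  have h1 : Real.exp (-x ^ 2 / 2) ≤ 1 := Real.exp_le_one_iff.2 (by nlinarith [sq_nonneg x])
  have h2 : 1 ≤ Real.sqrt (2 * Real.pi) := Real.one_le_sqrt.2 (by nlinarith [Real.pi_gt_three])
  linarith

lemma gphi_deriv (x : ℝ) : HasDerivAt gphi (-x * gphi x) x := by
  have h1 : HasDerivAt (fun s : ℝ => -s ^ 2 / 2) (-x) x := by
    refine HasDerivAt.congr_deriv (((hasDerivAt_id x).pow 2).neg.div_const 2) ?_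
    simp; ring
  refine HasDerivAt.congr_deriv (h1.exp.div_const (Real.sqrt (2 * Real.pi))) ?_
  unfold gphi
  ring

/-- Gaussian cdf -/
def gPhi (x : ℝ) : ℝ := gphi x * Lk 0 x

lemma gPhi_deriv (x : ℝ) : HasDerivAt gPhi (gphi x) x := by
  refine HasDerivAt.congr_deriv ((gphi_deriv x).mul (Lk_deriv 0 x)) ?_
  rw [zero_add, L1_eq]; ring

lemma gPhi_add (x : ℝ) : gphi x * (Lk 0 x + Lk 0 (-x)) = 1 := by
  have hd : ∀ x, HasDerivAt (fun x => gphi x * (Lk 0 x + Lk 0 (-x))) 0 x := by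
    intro x
    have h2 : HasDerivAt (fun x => Lk 0 (-x)) (-Lk 1 (-x)) x := by
      exact ((Lk_deriv 0 (-x)).comp x (hasDerivAt_neg x)).congr_deriv (by simp)
    refine HasDerivAt.congr_deriv ((gphi_deriv x).mul ((Lk_deriv 0 x).add h2)) ?_
    simp only [zero_add, L1_eq]; ring
  have hc := is_const_of_deriv_eq_zero (fun x => (hd x).differentiableAt) (fun x => (hd x).deriv) x 0
  rw [hc]
  have h0 : Lk 0 0 = Real.sqrt (Real.pi / (1/2)) / 2 := by
    rw [← integral_gaussian_Ioi]
    unfold Lk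
    congr 1; ext s
    rw [pow_zero, one_mul]; congr 1; ring
  have e : Real.pi / (1/2) = 2 * Real.pi := by ring
  rw [neg_zero, h0, e]
  unfold gphi
  have : Real.sqrt (2 * Real.pi) ≠ 0 := by positivity
  simp
  field_simp

lemma gaussQ_eq (z : ℝ) : gaussQ z = gphi z * Lk 0 (-z) := by
  unfold gaussQ Lk
  rw [← integral_const_mul]
  have h := (measurePreserving_add_right volume z).setIntegral_preimage_emb
    (measurableEmbedding_addRight z)
    (fun u => Real.exp (-u ^ 2 / 2) / Real.sqrt (2 * Real.pi)) (Set.Ioi z)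
  rw [← h]
  have e : (fun x => x + z) ⁻¹' Set.Ioi z = Set.Ioi 0 := by ext; simp
  rw [e]
  congr 1; ext s
  unfold gphi
  rw [pow_zero, one_mul, div_mul_eq_mul_div, ← Real.exp_add]
  congr 2; ring

/-- `E (t - Z)^+` -/
def gc (t : ℝ) : ℝ := gphi t * Lk 1 t

lemma gc_eq (t : ℝ) : gc t = gphi t + t * gPhi t := by
  unfold gc gPhi; rw [L1_eq]; ring

lemma gc_deriv (t : ℝ) : HasDerivAt gc (gPhi t) t := by
  have : gc = fun t => gphi t + t * gPhi t := funext gc_eq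
  rw [this]
  refine HasDerivAt.congr_deriv ((gphi_deriv t).add ((hasDerivAt_id t).mul (gPhi_deriv t))) ?_
  simp

lemma gc_dual (z t : ℝ) : t * gPhi z - gc t ≤ - gphi z := by
  have hm : Monotone gPhi := monotone_of_hasDerivAt_nonneg gPhi_deriv fun x => (gphi_pos x).le
  have hz := gc_eq z
  rcases lt_trichotomy t z with h | h | h
  · obtain ⟨c, hc, hce⟩ := exists_hasDerivAt_eq_slope gc gPhi h
      (fun x _ => (gc_deriv x).continuousAt.continuousWithinAt) fun x _ => gc_deriv x
    rw [eq_div_iff (by linarith)] at hce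
    have := hm hc.2.le
    nlinarith
  · subst h; linarith
  · obtain ⟨c, hc, hce⟩ := exists_hasDerivAt_eq_slope gc gPhi h
      (fun x _ => (gc_deriv x).continuousAt.continuousWithinAt) fun x _ => gc_deriv x
    rw [eq_div_iff (by linarith)] at hce
    have := hm hc.1.le
    nlinarith

/-- The Stein solution: existence with uniform bounds on compacts. -/
lemma stein_exists (K : ℝ) : ∃ B : ℝ, 0 ≤ B ∧ ∀ t, |t| ≤ K → ∃ F F' : ℝ → ℝ,
    (∀ x, HasDerivAt F (F' x) x) ∧ (∀ x, |F x| ≤ B) ∧ (∀ x, |F' x| ≤ B) ∧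
    (∀ x y, |F' x - F' y| ≤ B * |x - y|) ∧ (∀ x, F' x - x * F x = max (t - x) 0 - gc t) := by
  have lip : ∀ t x y, x ≤ t → y ≤ t → |Lk 1 x - Lk 1 y| ≤ Lk 2 t * |x - y| := by
    intro t x y hx hy
    have := (convex_Iic t).norm_image_sub_le_of_norm_hasDerivWithin_le (f := Lk 1) (f' := Lk 2)
      (C := Lk 2 t) (fun u _ => (Lk_deriv 1 u).hasDerivWithinAt)
      (fun u hu => by rw [Real.norm_of_nonneg (Lk_nonneg 2 u)]; exact Lk_mono 2 hu) hy hx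
    simpa using this
  have M0 := Lk_nonneg 0 K
  have M1 := Lk_nonneg 1 K
  have M2 := Lk_nonneg 2 K
  refine ⟨1 + Lk 1 K * (Lk 0 K + 2 * Lk 1 K + 2 * Lk 2 K), by positivity, fun t ht => ?_⟩
  obtain ⟨ht1, ht2⟩ := abs_le.1 ht
  obtain ⟨A, hA⟩ : ∃ r, r = gphi t * Lk 1 (-t) := ⟨_, rfl⟩
  obtain ⟨B, hB⟩ : ∃ r, r = gphi t * Lk 1 t := ⟨_, rfl⟩
  have A0 : 0 ≤ A := hA ▸ mul_nonneg (gphi_pos t).le (Lk_nonneg _ _)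
  have B0 : 0 ≤ B := hB ▸ mul_nonneg (gphi_pos t).le (Lk_nonneg _ _)
  have A1 : A ≤ Lk 1 K := by
    calc A ≤ 1 * Lk 1 (-t) := hA ▸ mul_le_mul_of_nonneg_right (gphi_le t) (Lk_nonneg _ _)
      _ ≤ _ := by rw [one_mul]; exact Lk_mono 1 (by linarith)
  have B1 : B ≤ Lk 1 K := by
    calc B ≤ 1 * Lk 1 t := hB ▸ mul_le_mul_of_nonneg_right (gphi_le t) (Lk_nonneg _ _)
      _ ≤ _ := by rw [one_mul]; exact Lk_mono 1 (by linarith)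
  have hadd := gPhi_add t
  have glue1 : 1 - A * Lk 0 t = B * Lk 0 (-t) := by
    rw [hA, hB, L1_eq, L1_eq]; linear_combination -hadd
  have glue2 : -A * Lk 1 t = -B * Lk 1 (-t) := by rw [hA, hB]; ring
  have d1 : ∀ x, HasDerivAt (fun x => 1 - A * Lk 0 x) (-A * Lk 1 x) x := by
    intro x
    refine HasDerivAt.congr_deriv (((Lk_deriv 0 x).const_mul A).const_sub 1) ?_
    ring
  have d2 : ∀ x, HasDerivAt (fun x => B * Lk 0 (-x)) (-B * Lk 1 (-x)) x := by
    intro x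
    have h2 : HasDerivAt (fun x => Lk 0 (-x)) (-Lk 1 (-x)) x := by
      exact ((Lk_deriv 0 (-x)).comp x (hasDerivAt_neg x)).congr_deriv (by simp)
    refine HasDerivAt.congr_deriv (h2.const_mul B) ?_
    ring
  refine ⟨fun x => if x ≤ t then 1 - A * Lk 0 x else B * Lk 0 (-x),
    fun x => -A * Lk 1 (min x t) + -B * Lk 1 (-(max x t)) - (-A * Lk 1 t), ?_, ?_, ?_, ?_, ?_⟩
  · intro x
    beta_reduce
    rcases lt_trichotomy x t with h | h | h
    · rw [min_eq_left h.le, max_eq_right h.le, glue2]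
      simp only [add_sub_cancel_right]
      refine (d1 x).congr_of_eventuallyEq ?_
      filter_upwards [Iio_mem_nhds h] with y hy
      rw [if_pos (le_of_lt hy)]
    · subst h
      simp only [min_self, max_self, glue2, add_sub_cancel_right]
      have l : HasDerivWithinAt (fun y => if y ≤ x then 1 - A * Lk 0 y else B * Lk 0 (-y))
          (-B * Lk 1 (-x)) (Set.Iic x) x := by
        rw [← glue2]
        refine (d1 x).hasDerivWithinAt.congr (fun y hy => if_pos hy) (if_pos le_rfl)
      have r : HasDerivWithinAt (fun y => if y ≤ x then 1 - A * Lk 0 y else B * Lk 0 (-y))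
          (-B * Lk 1 (-x)) (Set.Ici x) x := by
        refine (d2 x).hasDerivWithinAt.congr (fun y hy => ?_) ?_
        · rcases eq_or_lt_of_le (show x ≤ y from hy) with h | h
          · subst h; rw [if_pos le_rfl, glue1]
          · rw [if_neg (not_le.2 h)]
        · rw [if_pos le_rfl, glue1]
      have := l.union r
      rwa [Set.Iic_union_Ici, hasDerivWithinAt_univ] at this
    · rw [min_eq_right h.le, max_eq_left h.le]
      simp only [add_sub_cancel_left]
      refine (d2 x).congr_of_eventuallyEq ?_
      filter_upwards [Ioi_mem_nhds h] with y hy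
      rw [if_neg (not_le.2 hy)]
  · intro x
    have P1 := mul_nonneg M1 M1
    have P2 := mul_nonneg M1 M2
    beta_reduce
    split_ifs with h
    · have h1 : A * Lk 0 x ≤ Lk 1 K * Lk 0 K :=
        mul_le_mul A1 (Lk_mono 0 (by linarith)) (Lk_nonneg _ _) M1
      have h2 := mul_nonneg A0 (Lk_nonneg 0 x)
      rw [abs_le]; constructor <;> nlinarith
    · have h1 : B * Lk 0 (-x) ≤ Lk 1 K * Lk 0 K :=
        mul_le_mul B1 (Lk_mono 0 (by linarith)) (Lk_nonneg _ _) M1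
      have h2 := mul_nonneg B0 (Lk_nonneg 0 (-x))
      rw [abs_le]; constructor <;> nlinarith
  · intro x
    have P1 := mul_nonneg M1 M0
    have P2 := mul_nonneg M1 M2
    have h1 : A * Lk 1 (min x t) ≤ Lk 1 K * Lk 1 K :=
        mul_le_mul A1 (Lk_mono 1 ((min_le_right _ _).trans ht2)) (Lk_nonneg _ _) M1
    have h2 : B * Lk 1 (-(max x t)) ≤ Lk 1 K * Lk 1 K :=
        mul_le_mul B1 (Lk_mono 1 (by linarith [le_max_right x t])) (Lk_nonneg _ _) M1
    have h3 : A * Lk 1 t ≤ Lk 1 K * Lk 1 K :=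
        mul_le_mul A1 (Lk_mono 1 ht2) (Lk_nonneg _ _) M1
    have h4 := mul_nonneg A0 (Lk_nonneg 1 (min x t))
    have h5 := mul_nonneg B0 (Lk_nonneg 1 (-(max x t)))
    have h6 := mul_nonneg A0 (Lk_nonneg 1 t)
    rw [abs_le]; constructor <;> nlinarith
  · intro x y
    have P0 := mul_nonneg M1 M0
    have P1 := mul_nonneg M1 M1
    have h1 := (lip K (min x t) (min y t) ((min_le_right _ _).trans ht2)
      ((min_le_right _ _).trans ht2)).trans
        (mul_le_mul_of_nonneg_left (b := |min x t - min y t|) (c := |x - y|) (by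
          have := abs_min_sub_min_le_max x t y t
          rwa [sub_self, abs_zero, max_eq_left (abs_nonneg (x - y))] at this) M2)
    have h2 := (lip K (-(max x t)) (-(max y t)) (by linarith [le_max_right x t])
      (by linarith [le_max_right y t])).trans
        (mul_le_mul_of_nonneg_left (b := |-(max x t) - -(max y t)|) (c := |x - y|) (by
          have := abs_max_sub_max_le_max x t y t
          rw [sub_self, abs_zero, max_eq_left (abs_nonneg (x - y))] at this
          rwa [neg_sub_neg, abs_sub_comm]) M2)
    have h1' := mul_le_mul A1 h1 (abs_nonneg _) M1
    have h2' := mul_le_mul B1 h2 (abs_nonneg _) M1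
    have key : -A * Lk 1 (min x t) + -B * Lk 1 (-(max x t)) - (-A * Lk 1 t)
      - (-A * Lk 1 (min y t) + -B * Lk 1 (-(max y t)) - (-A * Lk 1 t))
      = -(A * (Lk 1 (min x t) - Lk 1 (min y t))) - B * (Lk 1 (-(max x t)) - Lk 1 (-(max y t))) := by
      ring
    rw [key]
    have h3 := abs_sub (-(A * (Lk 1 (min x t) - Lk 1 (min y t)))) (B * (Lk 1 (-(max x t)) - Lk 1 (-(max y t))))
    rw [abs_neg, abs_mul, abs_mul, abs_of_nonneg A0, abs_of_nonneg B0] at h3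
    have h4 : 0 ≤ (1 + Lk 1 K * Lk 0 K + 2 * (Lk 1 K * Lk 1 K)) * |x - y| := by positivity
    nlinarith
  · intro x
    have hAt : t - gc t = -A := by
      rw [gc, hA, L1_eq, L1_eq]; linear_combination (-t) * hadd
    simp only
    split_ifs with h
    · rw [min_eq_left h, max_eq_right h, glue2, max_eq_left (by linarith), L1_eq x]
      linear_combination -hAt
    · push Not at h
      rw [min_eq_right h.le, max_eq_left h.le, max_eq_right (by linarith), L1_eq (-x)]
      rw [gc, ← hB]; ring

lemma stein_inner (μ : Measure ℝ) [IsProbabilityMeasure μ] (m v : ℝ) (hv0 : 0 ≤ v)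
    (h1 : Integrable (fun y => y - m) μ) (hm : ∫ y, (y - m) ∂μ = 0)
    (h2 : Integrable (fun y => (y - m) ^ 2) μ) (hv : ∫ y, (y - m) ^ 2 ∂μ = v)
    (h3 : Integrable (fun y => |y - m| ^ 3) μ)
    (G G' : ℝ → ℝ) (B K : ℝ) (hG : ∀ x, HasDerivAt G (G' x) x)
    (hB : ∀ x, |G x| ≤ B) (hB' : ∀ x, |G' x| ≤ B)
    (hK0 : 0 ≤ K) (hK : ∀ x y, |G' x - G' y| ≤ K * |x - y|) (s : ℝ) :
    |∫ y, (v * G' (y - m + s) - (y - m) * G (y - m + s)) ∂μ|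
      ≤ K * ((∫ y, |y - m| ^ 3 ∂μ) + v * ∫ y, |y - m| ∂μ) := by
  have taylor : ∀ y, |G (y + s) - G s - y * G' s| ≤ K * |y| * |y| := by
    intro y
    have := (convex_uIcc s (y+s)).norm_image_sub_le_of_norm_hasDerivWithin_le
      (f := fun u => G u - u * G' s) (f' := fun u => G' u - G' s) (C := K * |y|)
      (fun u _ => ((hG u).sub ((hasDerivAt_id u).mul_const (G' s))).congr_deriv
        (by simp) |>.hasDerivWithinAt)
      (fun u hu => by
        refine (hK u s).trans (mul_le_mul_of_nonneg_left ?_ hK0)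
        have := Set.abs_sub_left_of_mem_uIcc hu
        simpa using this)
      Set.left_mem_uIcc Set.right_mem_uIcc
    simp only [Real.norm_eq_abs, add_sub_cancel_right] at this
    refine le_trans (le_of_eq ?_) this
    congr 1; ring
  have cG : Continuous G := continuous_iff_continuousAt.2 fun x => (hG x).continuousAt
  have cG' : Continuous G' := by
    refine (LipschitzWith.of_dist_le_mul (K := ⟨K, hK0⟩) fun x y => ?_).continuous
    exact hK x y
  have i1 : Integrable (fun y => v * G' (y - m + s)) μ := by
    refine (Integrable.of_bound (C := B) (by fun_prop) (ae_of_all _ fun y => hB' _)).const_mul v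
  have i2 : Integrable (fun y => (y - m) * G (y - m + s)) μ :=
    h1.mul_bdd (c := B) (by fun_prop) (ae_of_all _ fun y => hB _)
  have e : ∫ y, (v * G' (y - m + s) - (y - m) * G (y - m + s)) ∂μ
      = ∫ y, (v * (G' (y - m + s) - G' s)
        - (y - m) * (G (y - m + s) - G s - (y - m) * G' s)) ∂μ := by
    have j1 : Integrable (fun y => v * G' s - (y - m) * G s) μ :=
      (integrable_const _).sub (h1.mul_const _)
    have j2 : Integrable (fun y => v * G' s - (y - m) * G s - (y - m) ^ 2 * G' s) μ :=
      j1.sub (h2.mul_const _)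
    have j3 : Integrable (fun y => v * G' (y - m + s) - (y - m) * G (y - m + s)) μ := i1.sub i2
    have z : ∫ y, (v * G' s - (y - m) * G s - (y - m) ^ 2 * G' s) ∂μ = 0 := by
      rw [integral_sub j1 (h2.mul_const _),
        integral_sub (integrable_const _) (h1.mul_const _),
        integral_mul_const (G s) (fun y => y - m),
        integral_mul_const (G' s) (fun y => (y - m) ^ 2), hm, hv]
      simp
    rw [← sub_zero (∫ y, (v * G' (y - m + s) - (y - m) * G (y - m + s)) ∂μ), ← z,
      ← integral_sub j3 j2]
    congr 1; ext y; ring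
  rw [e]
  have hb : Integrable (fun y => K * (|y - m| ^ 3 + v * |y - m|)) μ :=
    (h3.add (h1.abs.const_mul v)).const_mul K
  have := norm_integral_le_of_norm_le hb (f := fun y => (v * (G' (y - m + s) - G' s)
        - (y - m) * (G (y - m + s) - G s - (y - m) * G' s))) (ae_of_all _ fun y => ?_)
  · rw [integral_const_mul, integral_add h3 (h1.abs.const_mul v), integral_const_mul] at this
    exact this
  · rw [Real.norm_eq_abs]
    refine (abs_sub _ _).trans ?_
    rw [abs_mul, abs_mul, abs_of_nonneg hv0]
    have a1 := mul_le_mul_of_nonneg_left (hK (y - m + s) s) hv0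
    rw [add_sub_cancel_right] at a1
    have a2 := mul_le_mul_of_nonneg_left (taylor (y - m)) (abs_nonneg (y - m))
    calc _ ≤ _ := add_le_add a1 a2
      _ = _ := by ring

lemma stein_bound (μ : Measure ℝ) [IsProbabilityMeasure μ] (m v : ℝ) (hv0 : 0 ≤ v)
    (h1 : Integrable (fun y => y - m) μ) (hm : ∫ y, (y - m) ∂μ = 0)
    (h2 : Integrable (fun y => (y - m) ^ 2) μ) (hv : ∫ y, (y - m) ^ 2 ∂μ = v)
    (h3 : Integrable (fun y => |y - m| ^ 3) μ)
    (G G' : ℝ → ℝ) (B K : ℝ) (hG : ∀ x, HasDerivAt G (G' x) x)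
    (hB : ∀ x, |G x| ≤ B) (hB' : ∀ x, |G' x| ≤ B)
    (hK0 : 0 ≤ K) (hK : ∀ x y, |G' x - G' y| ≤ K * |x - y|) (k : ℕ) :
    |∫ ω, (((k + 1 : ℕ) : ℝ) * v * G' (∑ i, (ω i - m)) - (∑ i, (ω i - m)) * G (∑ i, (ω i - m)))
        ∂(Measure.pi (fun _ : Fin (k+1) => μ))|
      ≤ ((k + 1 : ℕ) : ℝ) * (K * ((∫ y, |y - m| ^ 3 ∂μ) + v * ∫ y, |y - m| ∂μ)) := by
  have cG : Continuous G := continuous_iff_continuousAt.2 fun x => (hG x).continuousAt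
  have cG' : Continuous G' := by
    refine (LipschitzWith.of_dist_le_mul (K := ⟨K, hK0⟩) fun x y => ?_).continuous
    exact hK x y
  have cT : Continuous (fun ω : Fin (k+1) → ℝ => ∑ i, (ω i - m)) := by fun_prop
  have hint : ∀ i : Fin (k+1), Integrable (fun ω : Fin (k+1) → ℝ =>
      v * G' (∑ i, (ω i - m)) - (ω i - m) * G (∑ i, (ω i - m)))
      (Measure.pi (fun _ : Fin (k+1) => μ)) := by
    intro i
    refine Integrable.sub ?_ ?_
    · exact (Integrable.of_bound (C := B) (cG'.comp cT).aestronglyMeasurable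
        (ae_of_all _ fun y => hB' _)).const_mul v
    · exact (integrable_comp_eval (μ := fun _ : Fin (k+1) => μ) (i := i) h1).mul_bdd (c := B)
        (cG.comp cT).aestronglyMeasurable (ae_of_all _ fun y => hB _)
  have e : ∀ ω : Fin (k+1) → ℝ, (((k + 1 : ℕ) : ℝ) * v * G' (∑ i, (ω i - m))
      - (∑ i, (ω i - m)) * G (∑ i, (ω i - m))) =
      ∑ j, (v * G' (∑ i, (ω i - m)) - (ω j - m) * G (∑ i, (ω i - m))) := by
    intro ω
    generalize G' (∑ i, (ω i - m)) = a
    generalize G (∑ i, (ω i - m)) = b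
    rw [Finset.sum_sub_distrib (f := fun _ => v * a) (g := fun j => (ω j - m) * b),
      Finset.sum_mul, Finset.sum_const, Finset.card_univ, Fintype.card_fin, nsmul_eq_mul]
    ring
  simp_rw [e]
  rw [integral_finsetSum _ fun i _ => hint i]
  refine (Finset.abs_sum_le_sum_abs _ _).trans ?_
  refine (Finset.sum_le_card_nsmul _ _ (K * ((∫ y, |y - m| ^ 3 ∂μ) + v * ∫ y, |y - m| ∂μ))
    fun j _ => ?_).trans (by simp)
  have mp := measurePreserving_piFinSuccAbove (fun _ : Fin (k+1) => μ) j
  set g : ℝ × (Fin k → ℝ) → ℝ := fun p => v * G' (p.1 - m + ∑ i, (p.2 i - m))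
    - (p.1 - m) * G (p.1 - m + ∑ i, (p.2 i - m)) with hg
  have e2 : (fun ω : Fin (k+1) → ℝ => v * G' (∑ i, (ω i - m)) - (ω j - m) * G (∑ i, (ω i - m)))
      = g ∘ (MeasurableEquiv.piFinSuccAbove (fun _ : Fin (k+1) => ℝ) j) := by
    ext ω
    simp only [hg, Function.comp, Fin.sum_univ_succAbove _ j]
    rfl
  have gi : Integrable g (μ.prod (Measure.pi fun _ : Fin k => μ)) := by
    have := hint j
    rw [e2] at this
    exact (mp.integrable_comp_emb (MeasurableEquiv.measurableEmbedding _)).1 this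
  rw [e2]
  have e3 := mp.integral_comp (MeasurableEquiv.measurableEmbedding _) g
  simp only [Function.comp_def]
  rw [e3, integral_prod_symm g gi]
  have := norm_integral_le_of_norm_le_const (μ := Measure.pi fun _ : Fin k => μ)
    (f := fun y => ∫ x, g (x, y) ∂μ) (ae_of_all _ fun y =>
      stein_inner μ m v hv0 h1 hm h2 hv h3 G G' B K hG hB hB' hK0 hK (∑ i, (y i - m)))
  simpa using this

lemma cutoff_abs {Ω : Type*} [MeasurableSpace Ω] (P : Measure Ω) [IsProbabilityMeasure P]
    (S : Ω → ℝ) (hS : Measurable S) (hSi : Integrable S P) (η α ε : ℝ) (h0 : 0 ≤ α) (h1 : α ≤ 1)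
    (h : (P {ω | η < S ω}).toReal + α * (P {ω | S ω = η}).toReal = ε) :
    ∃ f : Ω → ℝ, Measurable f ∧ (∀ ω, 0 ≤ f ω) ∧ (∀ ω, f ω ≤ 1) ∧ (∀ ω, S ω < η → f ω = 1) ∧
      (∀ ω, η < S ω → f ω = 0) ∧ ∫ ω, f ω ∂P = 1 - ε ∧
      (∫ ω in {ω | S ω < η}, S ω ∂P) + (1 - α) * η * (P {ω | S ω = η}).toReal
        = ∫ ω, S ω * f ω ∂P := by
  have mA : MeasurableSet {ω | S ω < η} := measurableSet_lt hS measurable_const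
  have mE : MeasurableSet {ω | S ω = η} := measurableSet_eq_fun hS measurable_const
  have mC : MeasurableSet {ω | η < S ω} := measurableSet_lt measurable_const hS
  have iC : Integrable ({ω | η < S ω}.indicator (fun _ => (1:ℝ))) P :=
    (integrable_const _).indicator mC
  have iE : Integrable ({ω | S ω = η}.indicator (fun _ => (1:ℝ))) P :=
    (integrable_const _).indicator mE
  refine ⟨fun ω => 1 - {ω | η < S ω}.indicator (fun _ => 1) ω
      - α * {ω | S ω = η}.indicator (fun _ => 1) ω, ?_, ?_, ?_, ?_, ?_, ?_, ?_⟩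
  · exact ((measurable_const.sub (measurable_const.indicator mC))).sub
      ((measurable_const.indicator mE).const_mul α)
  · intro ω
    simp only [Set.indicator, Set.mem_ofPred_eq]
    split_ifs <;> linarith
  · intro ω
    simp only [Set.indicator, Set.mem_ofPred_eq]
    split_ifs <;> linarith
  · intro ω hω
    simp [Set.indicator, hω.not_gt, hω.ne]
  · intro ω hω
    simp [Set.indicator, hω, hω.ne']
  · have j : Integrable (fun ω => 1 - {ω | η < S ω}.indicator (fun _ => (1:ℝ)) ω) P :=
      (integrable_const _).sub iC
    rw [integral_sub j (iE.const_mul α),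
      integral_sub (integrable_const _) iC, integral_const_mul, integral_indicator_const _ mC,
      integral_indicator_const _ mE]
    simp [Measure.real]
    linarith
  · have : ∀ ω, S ω * (1 - {ω | η < S ω}.indicator (fun _ => 1) ω
      - α * {ω | S ω = η}.indicator (fun _ => 1) ω) = {ω | S ω < η}.indicator S ω +
        (1 - α) * η * {ω | S ω = η}.indicator (fun _ => 1) ω := by
      intro ω
      rcases lt_trichotomy (S ω) η with h | h | h
      · simp [Set.indicator, h, h.not_gt, h.ne]
      · simp [Set.indicator, h]; ring
      · simp [Set.indicator, h, h.not_gt, h.ne']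
    simp_rw [this]
    rw [integral_add (hSi.indicator mA) (iE.const_mul _), integral_const_mul,
      integral_indicator mA, integral_indicator_const _ mE]
    simp [Measure.real]

set_option maxHeartbeats 1000000

lemma wass (μ : Measure ℝ) [IsProbabilityMeasure μ] (m v : ℝ) (hv0 : 0 < v)
    (h1 : Integrable (fun y => y - m) μ) (hm : ∫ y, (y - m) ∂μ = 0)
    (h2 : Integrable (fun y => (y - m) ^ 2) μ) (hv : ∫ y, (y - m) ^ 2 ∂μ = v)
    (h3 : Integrable (fun y => |y - m| ^ 3) μ) (K : ℝ) :
    ∃ C : ℝ, ∀ (k : ℕ) (t : ℝ), |t| ≤ K → ∀ D : ℝ, 0 < D → D ^ 2 = ((k + 1 : ℕ) : ℝ) * v →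
      |(∫ ω, max (D * t - ∑ i, (ω i - m)) 0 ∂(Measure.pi (fun _ : Fin (k+1) => μ)))
        - D * gc t| ≤ C := by
  obtain ⟨B, hB0, hB⟩ := stein_exists K
  refine ⟨B * ((∫ y, |y - m| ^ 3 ∂μ) + v * ∫ y, |y - m| ∂μ) / v, fun k t ht D hD hD2 => ?_⟩
  obtain ⟨F, F', hF, bF, bF', lF, eF⟩ := hB t ht
  have hd0 : 0 ≤ B / D := by positivity
  have := stein_bound μ m v hv0.le h1 hm h2 hv h3 (fun s => F (s / D)) (fun s => F' (s / D) / D)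
    (B + B / D) (B / D ^ 2)
    (fun x => ((hF (x / D)).comp x ((hasDerivAt_id x).div_const D)).congr_deriv (by ring))
    (fun x => (bF _).trans (by linarith))
    (fun x => by
      rw [abs_div, abs_of_pos hD]
      have := div_le_div_of_nonneg_right (bF' (x / D)) hD.le
      linarith)
    (by positivity)
    (fun x y => by
      rw [← sub_div, abs_div, abs_of_pos hD]
      have := div_le_div_of_nonneg_right (lF (x / D) (y / D)) hD.le
      rw [← sub_div, abs_div, abs_of_pos hD] at this
      refine this.trans (le_of_eq ?_)
      field_simp) k
  have iT : Integrable (fun ω : Fin (k+1) → ℝ => ∑ i, (ω i - m))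
      (Measure.pi (fun _ : Fin (k+1) => μ)) :=
    integrable_finsetSum _ fun i _ => integrable_comp_eval (μ := fun _ : Fin (k+1) => μ) (i := i) h1
  have iM : Integrable (fun ω : Fin (k+1) → ℝ => max (D * t - ∑ i, (ω i - m)) 0)
      (Measure.pi (fun _ : Fin (k+1) => μ)) := ((integrable_const (D * t)).sub iT).pos_part
  have e : ∀ T : ℝ, ((k + 1 : ℕ) : ℝ) * v * (F' (T / D) / D) - T * F (T / D)
      = max (D * t - T) 0 - D * gc t := by
    intro T
    have h := eF (T / D)
    have e1 : max (D * t - T) 0 = D * max (t - T / D) 0 := by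
      rw [mul_max_of_nonneg _ _ hD.le, mul_zero, mul_sub, mul_div_cancel₀ _ hD.ne']
    rw [e1, ← mul_sub, ← h, ← hD2]
    field_simp
  simp only [e] at this
  rw [integral_sub iM (integrable_const _)] at this
  simp only [integral_const, probReal_univ, one_smul] at this
  refine this.trans (le_of_eq ?_)
  rw [hD2]
  have : ((k + 1 : ℕ) : ℝ) ≠ 0 := by positivity
  field_simp

/-- **Expectation of the `ε`-cutoff of an i.i.d. sum.**
Let `Y_1,…,Y_n` be i.i.d. with law `μ`, mean `m`, variance `v > 0` and finite third
absolute central moment.  For every `ε ∈ (0,1)`,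
`E[⟨∑ᵢ Yᵢ⟩_ε] = (1−ε) n m − √(n v/(2π)) e^{−(Q⁻¹(ε))²/2} + O(1)`,
where the cutoff parameters `(η, α)` satisfy `Pr{S > η} + α Pr{S = η} = ε` and the
expectation of the cutoff equals `E[S·1{S<η}] + (1−α) η Pr{S = η}`. -/
theorem cutoff_clt
    (μ : Measure ℝ) [IsProbabilityMeasure μ]
    (hInt : Integrable (fun y => y) μ)
    (m : ℝ) (hm : m = ∫ y, y ∂μ)
    (hmom3 : Integrable (fun y => |y - m| ^ 3) μ)
    (v : ℝ) (hv : v = ∫ y, (y - m) ^ 2 ∂μ) (hvpos : 0 < v)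
    (ε : ℝ) (hε : ε ∈ Set.Ioo (0 : ℝ) 1) (z : ℝ) (hz : gaussQ z = ε) :
    ∃ C : ℝ, ∃ n₀ : ℕ, ∀ n ≥ n₀, ∀ η α : ℝ, 0 ≤ α → α ≤ 1 →
      ((Measure.pi (fun _ : Fin n => μ)) {ω | η < ∑ i, ω i}).toReal
          + α * ((Measure.pi (fun _ : Fin n => μ)) {ω | (∑ i, ω i) = η}).toReal = ε →
      |((∫ ω in {ω : Fin n → ℝ | (∑ i, ω i) < η}, (∑ i, ω i)
            ∂(Measure.pi (fun _ : Fin n => μ)))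
          + (1 - α) * η *
            ((Measure.pi (fun _ : Fin n => μ)) {ω | (∑ i, ω i) = η}).toReal)
        - ((1 - ε) * n * m
            - Real.sqrt (n * v / (2 * Real.pi)) * Real.exp (-z ^ 2 / 2))| ≤ C := by
  obtain ⟨hε0, hε1⟩ := hε
  have h1 : Integrable (fun y => y - m) μ := hInt.sub (integrable_const m)
  have hm0 : ∫ y, (y - m) ∂μ = 0 := by
    rw [integral_sub hInt (integrable_const m), ← hm]; simp
  have h2 : Integrable (fun y => (y - m) ^ 2) μ :=
    Integrable.of_integral_ne_zero (by rw [← hv]; exact hvpos.ne')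
  have hPhi : gPhi z = 1 - ε := by
    have := gPhi_add z
    rw [gaussQ_eq] at hz
    unfold gPhi
    linarith
  have hq : 0 < ε * (1 - ε) := mul_pos hε0 (by linarith)
  have hq1 : ε * (1 - ε) ≤ 1 := by nlinarith
  obtain ⟨C, hC⟩ := wass μ m v hvpos h1 hm0 h2 hv.symm hmom3 (max |z| (1 / (ε * (1 - ε))))
  refine ⟨C, 1, fun n hn η α hα0 hα1 hηα => ?_⟩
  obtain ⟨k, rfl⟩ : ∃ k, n = k + 1 := ⟨n - 1, by omega⟩
  set P := Measure.pi (fun _ : Fin (k+1) => μ) with hP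
  have iS : Integrable (fun ω : Fin (k+1) → ℝ => ∑ i, ω i) P :=
    integrable_finsetSum _ fun i _ =>
      integrable_comp_eval (μ := fun _ : Fin (k+1) => μ) (i := i) hInt
  obtain ⟨f, mf, f0, f1, fl, fr, ifn, iSf⟩ := cutoff_abs P (fun ω => ∑ i, ω i) (by fun_prop) iS
    η α ε hα0 hα1 hηα
  rw [iSf]
  have hn0 : (0:ℝ) < ((k + 1 : ℕ) : ℝ) := by positivity
  set N : ℝ := ((k + 1 : ℕ) : ℝ) with hN
  obtain ⟨D, hD⟩ : ∃ D, D = Real.sqrt (N * v) := ⟨_, rfl⟩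
  have hDpos : 0 < D := by rw [hD]; positivity
  have hD2 : D ^ 2 = N * v := by rw [hD]; exact Real.sq_sqrt (by positivity)
  have eT : ∀ ω : Fin (k+1) → ℝ, ∑ i, (ω i - m) = ∑ i, ω i - N * m := by
    intro ω; rw [Finset.sum_sub_distrib]; simp [hN]
  have hfi : Integrable f P := Integrable.of_bound (C := 1) mf.aestronglyMeasurable
    (ae_of_all _ fun ω => by rw [Real.norm_of_nonneg (f0 ω)]; exact f1 ω)
  have hSfi : Integrable (fun ω => (∑ i, ω i) * f ω) P :=
    iS.mul_bdd (c := 1) mf.aestronglyMeasurable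
      (ae_of_all _ fun ω => by rw [Real.norm_of_nonneg (f0 ω)]; exact f1 ω)
  have hgoal : Real.sqrt (N * v / (2 * Real.pi)) * Real.exp (-z ^ 2 / 2) = D * gphi z := by
    rw [Real.sqrt_div (by positivity), ← hD, gphi]; ring
  rw [hgoal]
  -- the quantile in normalised units
  obtain ⟨t, ht⟩ : ∃ t, η = N * m + D * t := ⟨(η - N * m) / D, by field_simp; ring⟩
  have iM : ∀ a, Integrable (fun ω : Fin (k+1) → ℝ => max (D * a - ∑ i, (ω i - m)) 0) P := by
    intro a
    simp_rw [eT]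
    exact ((integrable_const (D * a)).sub (iS.sub (integrable_const _))).pos_part
  have elin : ∀ a, ∫ ω, (D * a - ∑ i, (ω i - m)) * f ω ∂P
      = (N * m + D * a) * (1 - ε) - ∫ ω, (∑ i, ω i) * f ω ∂P := by
    intro a
    rw [← ifn, ← integral_const_mul, ← integral_sub (hfi.const_mul _) hSfi]
    congr 1; ext ω; rw [eT]; ring
  have ilin : ∀ a, Integrable (fun ω => (D * a - ∑ i, (ω i - m)) * f ω) P := by
    intro a
    have := (hfi.const_mul (N * m + D * a)).sub hSfi
    refine this.congr (ae_of_all _ fun ω => ?_)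
    simp only [Pi.sub_apply]
    rw [eT]; ring
  have up : (N * m + D * z) * (1 - ε) - ∫ ω, (∑ i, ω i) * f ω ∂P
      ≤ ∫ ω, max (D * z - ∑ i, (ω i - m)) 0 ∂P := by
    rw [← elin]
    refine integral_mono (ilin z) (iM z) fun ω => ?_
    rcases le_total 0 (D * z - ∑ i, (ω i - m)) with h | h
    · exact (mul_le_of_le_one_right h (f1 ω)).trans (le_max_left _ _)
    · exact (mul_nonpos_of_nonpos_of_nonneg h (f0 ω)).trans (le_max_right _ _)
  have eq : (N * m + D * t) * (1 - ε) - ∫ ω, (∑ i, ω i) * f ω ∂P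
      = ∫ ω, max (D * t - ∑ i, (ω i - m)) 0 ∂P := by
    rw [← elin]
    congr 1; ext ω
    rw [eT]
    rcases lt_trichotomy (∑ i, ω i) η with h | h | h
    · rw [fl ω h, mul_one, max_eq_left (by linarith)]
    · have : D * t - (∑ i, ω i - N * m) = 0 := by linarith
      rw [this]; simp
    · rw [fr ω h, mul_zero, max_eq_right (by linarith)]
  -- Chebyshev
  have mem : ∀ i : Fin (k+1), MemLp (fun y => y - m) 2 μ := fun i =>
    (memLp_two_iff_integrable_sq h1.aestronglyMeasurable).2 h2
  have memT : MemLp (fun ω : Fin (k+1) → ℝ => ∑ i, (ω i - m)) 2 P :=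
    memLp_finsetSum _ fun i _ => (mem i).comp_measurePreserving
      (measurePreserving_eval (fun _ : Fin (k+1) => μ) i)
  have iT2 : Integrable (fun ω : Fin (k+1) → ℝ => (∑ i, (ω i - m)) ^ 2) P := memT.integrable_sq
  have ET : ∫ ω, (∑ i, (ω i - m)) ∂P = 0 := by
    rw [integral_finsetSum _ fun i _ =>
      integrable_comp_eval (μ := fun _ : Fin (k+1) => μ) (i := i) h1]
    refine Finset.sum_eq_zero fun i _ => ?_
    rw [integral_comp_eval (μ := fun _ : Fin (k+1) => μ) (i := i) (f := fun y => y - m)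
      h1.aestronglyMeasurable, hm0]
  have VT : ∫ ω, (∑ i, (ω i - m)) ^ 2 ∂P = D ^ 2 := by
    have := ProbabilityTheory.variance_sum_pi (μ := fun _ : Fin (k+1) => μ)
      (X := fun _ y => y - m) mem
    rw [ProbabilityTheory.variance_of_integral_eq_zero h1.aemeasurable hm0, ← hv] at this
    have e : (∑ i : Fin (k+1), fun ω : Fin (k+1) → ℝ => ω i - m) = fun ω => ∑ i, (ω i - m) := by
      ext ω; simp
    rw [e, ProbabilityTheory.variance_of_integral_eq_zero memT.aestronglyMeasurable.aemeasurable ET]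
      at this
    rw [this, hD2]; simp [hN]
  have cheb : ∀ g : (Fin (k+1) → ℝ) → ℝ, Measurable g → (∀ ω, 0 ≤ g ω) → (∀ ω, g ω ≤ 1) →
      (∀ ω, g ω ≠ 0 → (D * t) ^ 2 ≤ (∑ i, (ω i - m)) ^ 2) → t ^ 2 * ∫ ω, g ω ∂P ≤ 1 := by
    intro g mg g0 g1 hg
    have gi : Integrable g P := Integrable.of_bound (C := 1) mg.aestronglyMeasurable
      (ae_of_all _ fun ω => by rw [Real.norm_of_nonneg (g0 ω)]; exact g1 ω)
    have : ∫ ω, (D * t) ^ 2 * g ω ∂P ≤ ∫ ω, (∑ i, (ω i - m)) ^ 2 ∂P := by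
      refine integral_mono (gi.const_mul _) iT2 fun ω => ?_
      by_cases h : g ω = 0
      · simp only [h, mul_zero]; positivity
      · exact (mul_le_of_le_one_right (sq_nonneg _) (g1 ω)).trans (hg ω h)
    rw [integral_const_mul, VT, mul_pow, mul_assoc] at this
    exact le_of_mul_le_mul_left (by linarith) (show 0 < D ^ 2 by positivity)
  have htq : t ^ 2 * (ε * (1 - ε)) ≤ 1 := by
    rcases le_total 0 t with h | h
    · have := cheb (fun ω => 1 - f ω) (measurable_const.sub mf) (fun ω => by linarith [f1 ω])
        (fun ω => by linarith [f0 ω]) (fun ω hω => by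
          have h' : ¬ (∑ i, ω i < η) := fun h => hω (by rw [fl ω h]; ring)
          rw [eT]
          exact pow_le_pow_left₀ (by positivity) (by linarith) 2)
      rw [integral_sub (integrable_const _) hfi, ifn] at this
      simp at this
      nlinarith [mul_nonneg (sq_nonneg t) (sq_nonneg ε)]
    · have := cheb f mf f0 f1 (fun ω hω => by
          have h' : ¬ (η < ∑ i, ω i) := fun h => hω (fr ω h)
          rw [eT, ← neg_sq, ← neg_sq (∑ i, ω i - N * m)]
          have : D * t ≤ 0 := mul_nonpos_of_nonneg_of_nonpos hDpos.le h
          exact pow_le_pow_left₀ (by linarith) (by linarith) 2)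
      rw [ifn] at this
      nlinarith [mul_nonneg (sq_nonneg t) (sq_nonneg (1 - ε))]
  have htK : |t| ≤ 1 / (ε * (1 - ε)) := by
    refine abs_le_of_sq_le_sq ?_ (by positivity)
    rw [div_pow, one_pow, le_div_iff₀ (by positivity)]
    nlinarith
  have b1 := abs_le.1 (hC k z (le_max_left _ _) D hDpos hD2)
  have b2 := abs_le.1 (hC k t (htK.trans (le_max_right _ _)) D hDpos hD2)
  rw [← hP] at b1 b2
  have hz' := gc_eq z
  rw [hPhi] at hz'
  have hd := mul_le_mul_of_nonneg_left (gc_dual z t) hDpos.le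
  rw [hPhi] at hd
  rw [hz'] at b1
  rw [abs_le]
  constructor <;> nlinarith

end
end
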